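/- arXiv:2306.05184 — 2 statements merged into one kernel-verified Lean document; each statement's English description precedes it below -/
import Mathlib

section
/- Let n ≥ 4 and let (u, p) be a smooth solution of the steady Navier-Stokes equations on Ω = ℝⁿ₊ \ {0} satisfying |u(x)| ≤ C/|x| on Ω and the Dirichlet boundary condition u = 0 on {x : xₙ = 0, x ≠ 0}. Then, after subtracting a suitable constant from p, there is a constant C′ such that |∇u(x)| + |p(x)| ≤ C′/|x|² for all x ∈ Ω. -/
namespace HalfSpaceNS

open scoped ContDiff Topology

/-- The partial derivative of `f` in the `i`-th coordinate direction. -/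
noncomputable def pd {n : ℕ} (i : Fin n) (f : EuclideanSpace ℝ (Fin n) → ℝ) :
    EuclideanSpace ℝ (Fin n) → ℝ :=
  fun x => fderiv ℝ f x (EuclideanSpace.single i 1)

/-- The Laplacian, as the sum of the pure second partial derivatives. -/
noncomputable def lap {n : ℕ} (f : EuclideanSpace ℝ (Fin n) → ℝ) :
    EuclideanSpace ℝ (Fin n) → ℝ :=
  fun x => ∑ i, pd i (pd i f) x

section Calculus

variable {n : ℕ} {U : Set (EuclideanSpace ℝ (Fin n))} {f g : EuclideanSpace ℝ (Fin n) → ℝ}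
  {x : EuclideanSpace ℝ (Fin n)}

lemma differentiableAt_of_smooth (hU : IsOpen U) (hf : ContDiffOn ℝ ∞ f U) (hx : x ∈ U) :
    DifferentiableAt ℝ f x :=
  (hf.contDiffAt (hU.mem_nhds hx)).differentiableAt (by simp)

lemma smooth_pd (hU : IsOpen U) (hf : ContDiffOn ℝ ∞ f U) (i : Fin n) :
    ContDiffOn ℝ ∞ (pd i f) U :=
  (hf.fderiv_of_isOpen hU (by simp)).clm_apply contDiffOn_const

lemma smooth_lap (hU : IsOpen U) (hf : ContDiffOn ℝ ∞ f U) : ContDiffOn ℝ ∞ (lap f) U :=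
  ContDiffOn.sum fun i _ => smooth_pd hU (smooth_pd hU hf i) i

lemma smooth_coord (m : Fin n) : ContDiffOn ℝ ∞ (fun y : EuclideanSpace ℝ (Fin n) => y m) U :=
  (EuclideanSpace.proj (𝕜 := ℝ) m).contDiff.contDiffOn

lemma pd_congr (hU : IsOpen U) (h : Set.EqOn f g U) (hx : x ∈ U) (i : Fin n) :
    pd i f x = pd i g x := by
  unfold pd
  rw [(h.eventuallyEq_of_mem (hU.mem_nhds hx)).fderiv_eq]

lemma lap_congr (hU : IsOpen U) (h : Set.EqOn f g U) (hx : x ∈ U) : lap f x = lap g x :=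
  Finset.sum_congr rfl fun i _ => pd_congr hU (fun _ hy => pd_congr hU h hy i) hx i

lemma pd_const (c : ℝ) (i : Fin n) : pd i (fun _ => c) x = 0 := by
  simp [pd]

lemma pd_add (hU : IsOpen U) (hf : ContDiffOn ℝ ∞ f U) (hg : ContDiffOn ℝ ∞ g U) (hx : x ∈ U)
    (i : Fin n) : pd i (fun y => f y + g y) x = pd i f x + pd i g x := by
  simp [pd, fderiv_fun_add (differentiableAt_of_smooth hU hf hx)
    (differentiableAt_of_smooth hU hg hx)]

lemma pd_sub (hU : IsOpen U) (hf : ContDiffOn ℝ ∞ f U) (hg : ContDiffOn ℝ ∞ g U) (hx : x ∈ U)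
    (i : Fin n) : pd i (fun y => f y - g y) x = pd i f x - pd i g x := by
  simp [pd, fderiv_fun_sub (differentiableAt_of_smooth hU hf hx)
    (differentiableAt_of_smooth hU hg hx)]

lemma pd_const_mul (hU : IsOpen U) (hf : ContDiffOn ℝ ∞ f U) (hx : x ∈ U) (c : ℝ) (i : Fin n) :
    pd i (fun y => c * f y) x = c * pd i f x := by
  simp [pd, fderiv_const_mul (differentiableAt_of_smooth hU hf hx)]

lemma pd_mul (hU : IsOpen U) (hf : ContDiffOn ℝ ∞ f U) (hg : ContDiffOn ℝ ∞ g U) (hx : x ∈ U)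
    (i : Fin n) : pd i (fun y => f y * g y) x = pd i f x * g x + f x * pd i g x := by
  simp only [pd, fderiv_fun_mul (differentiableAt_of_smooth hU hf hx)
    (differentiableAt_of_smooth hU hg hx)]
  simp
  ring

lemma pd_sum {ι : Type*} (s : Finset ι) {F : ι → EuclideanSpace ℝ (Fin n) → ℝ} (hU : IsOpen U)
    (hF : ∀ k ∈ s, ContDiffOn ℝ ∞ (F k) U) (hx : x ∈ U) (i : Fin n) :
    pd i (fun y => ∑ k ∈ s, F k y) x = ∑ k ∈ s, pd i (F k) x := by
  simp only [pd]
  rw [fderiv_fun_sum fun k hk => differentiableAt_of_smooth hU (hF k hk) hx]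
  simp

lemma pd_coord (m i : Fin n) :
    pd i (fun y : EuclideanSpace ℝ (Fin n) => y m) x = if i = m then 1 else 0 := by
  have : fderiv ℝ (fun y : EuclideanSpace ℝ (Fin n) => y m) x = EuclideanSpace.proj (𝕜 := ℝ) m :=
    (EuclideanSpace.proj (𝕜 := ℝ) m).fderiv
  simp [pd, this, PiLp.single_apply, eq_comm]

lemma pd_comm (hU : IsOpen U) (hf : ContDiffOn ℝ ∞ f U) (hx : x ∈ U) (i j : Fin n) :
    pd i (pd j f) x = pd j (pd i f) x := by
  have hd : DifferentiableAt ℝ (fderiv ℝ f) x :=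
    ((hf.fderiv_of_isOpen (m := ∞) hU (by simp)).contDiffAt (hU.mem_nhds hx)).differentiableAt
      (by simp)
  have key : ∀ a b : Fin n, pd a (pd b f) x =
      fderiv ℝ (fderiv ℝ f) x (EuclideanSpace.single a 1) (EuclideanSpace.single b 1) := by
    intro a b
    unfold pd
    rw [fderiv_clm_apply hd (by fun_prop)]
    simp
  rw [key, key]
  exact ((hf.contDiffAt (hU.mem_nhds hx)).isSymmSndFDerivAt (by
    rw [minSmoothness_of_isRCLikeNormedField]; exact WithTop.coe_le_coe.2 (le_top : (2 : ℕ∞) ≤ ⊤))) _ _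

lemma lap_sub (hU : IsOpen U) (hf : ContDiffOn ℝ ∞ f U) (hg : ContDiffOn ℝ ∞ g U) (hx : x ∈ U) :
    lap (fun y => f y - g y) x = lap f x - lap g x := by
  unfold lap
  rw [← Finset.sum_sub_distrib]
  refine Finset.sum_congr rfl fun i _ => ?_
  rw [pd_congr hU (fun y hy => pd_sub hU hf hg hy i) hx,
    pd_sub hU (smooth_pd hU hf i) (smooth_pd hU hg i) hx]

lemma lap_const_mul (hU : IsOpen U) (hf : ContDiffOn ℝ ∞ f U) (hx : x ∈ U) (c : ℝ) :
    lap (fun y => c * f y) x = c * lap f x := by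
  unfold lap
  rw [Finset.mul_sum]
  refine Finset.sum_congr rfl fun i _ => ?_
  rw [pd_congr hU (fun y hy => pd_const_mul hU hf hy c i) hx,
    pd_const_mul hU (smooth_pd hU hf i) hx]

lemma lap_pd (hU : IsOpen U) (hf : ContDiffOn ℝ ∞ f U) (hx : x ∈ U) (j : Fin n) :
    lap (pd j f) x = pd j (lap f) x := by
  unfold lap
  rw [pd_sum _ hU (fun i _ => smooth_pd hU (smooth_pd hU hf i) i) hx]
  refine Finset.sum_congr rfl fun i _ => ?_
  rw [pd_congr hU (fun y hy => pd_comm hU hf hy i j) hx, pd_comm hU (smooth_pd hU hf i) hx]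

lemma lap_coord_sub_mul (hU : IsOpen U) (hf : ContDiffOn ℝ ∞ f U) (hx : x ∈ U) (m : Fin n)
    (c : ℝ) : lap (fun y => (y m - c) * f y) x = 2 * pd m f x + (x m - c) * lap f x := by
  have hs : ContDiffOn ℝ ∞ (fun y : EuclideanSpace ℝ (Fin n) => y m - c) U :=
    (smooth_coord m).sub contDiffOn_const
  have h1 : ∀ y ∈ U, ∀ i, pd i (fun y : EuclideanSpace ℝ (Fin n) => y m - c) y
      = if i = m then 1 else 0 := by
    intro y hy i
    rw [pd_sub hU (smooth_coord m) contDiffOn_const hy, pd_coord, pd_const, sub_zero]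
  have h2 : ∀ i, pd i (pd i (fun y => (y m - c) * f y)) x
      = 2 * (if i = m then pd i f x else 0) + (x m - c) * pd i (pd i f) x := by
    intro i
    have : Set.EqOn (pd i (fun y => (y m - c) * f y))
        (fun y => (if i = m then 1 else 0) * f y + (y m - c) * pd i f y) U := by
      intro y hy
      rw [pd_mul hU hs hf hy, h1 y hy]
    rw [pd_congr hU this hx, pd_add hU (contDiffOn_const.mul hf) (hs.mul (smooth_pd hU hf i)) hx,
      pd_const_mul hU hf hx, pd_mul hU hs (smooth_pd hU hf i) hx, h1 x hx]
    split_ifs <;> ring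
  unfold lap
  simp_rw [h2]
  rw [Finset.sum_add_distrib, ← Finset.mul_sum, ← Finset.mul_sum]
  simp

/-- The derivative of a smooth function along a coordinate line. -/
lemma hasDerivAt_line (hU : IsOpen U) (hf : ContDiffOn ℝ ∞ f U) (i : Fin n) (t : ℝ)
    (hx : x + t • EuclideanSpace.single i (1 : ℝ) ∈ U) :
    HasDerivAt (fun s : ℝ => f (x + s • EuclideanSpace.single i (1 : ℝ)))
      (pd i f (x + t • EuclideanSpace.single i (1 : ℝ))) t := by
  have h1 : HasDerivAt (fun s : ℝ => x + s • EuclideanSpace.single i (1 : ℝ))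
      (EuclideanSpace.single i (1 : ℝ)) t := by
    simpa using ((hasDerivAt_id t).smul_const (EuclideanSpace.single i (1 : ℝ))).const_add x
  exact (differentiableAt_of_smooth hU hf hx).hasFDerivAt.comp_hasDerivAt t h1

lemma norm_fderiv_le_sum_pd (f : EuclideanSpace ℝ (Fin n) → ℝ) (x : EuclideanSpace ℝ (Fin n)) :
    ‖fderiv ℝ f x‖ ≤ ∑ i, |pd i f x| := by
  refine ContinuousLinearMap.opNorm_le_bound _ (Finset.sum_nonneg fun _ _ => abs_nonneg _) ?_
  intro y
  have hy : y = ∑ i, y i • EuclideanSpace.single i (1 : ℝ) := by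
    have := (EuclideanSpace.basisFun (Fin n) ℝ).sum_repr y
    simpa using this.symm
  conv_lhs => rw [hy]
  rw [map_sum, Finset.sum_mul]
  refine (norm_sum_le _ _).trans (Finset.sum_le_sum fun i _ => ?_)
  rw [map_smul, norm_smul, mul_comm]
  exact mul_le_mul_of_nonneg_left (PiLp.norm_apply_le y i) (abs_nonneg _)

/-- Affine rescaling of the partial derivatives. -/
lemma pd_comp_scale (f : EuclideanSpace ℝ (Fin n) → ℝ) (z : EuclideanSpace ℝ (Fin n)) (a r : ℝ)
    (i : Fin n) :
    pd i (fun y => a * f (z + r • y)) = fun y => (a * r) * pd i f (z + r • y) := by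
  funext y
  unfold pd
  have h1 : fderiv ℝ (fun y => a * f (z + r • y)) y = a • fderiv ℝ (fun y => f (z + r • y)) y := by
    exact congrFun (fderiv_const_smul_field (f := fun y => f (z + r • y)) a) y
  have h2 : fderiv ℝ (fun y => f (z + r • y)) y = r • fderiv ℝ f (z + r • y) := by
    rw [fderiv_comp_smul (f := fun w => f (z + w)), fderiv_comp_add_left]
  rw [h1, h2]
  simp [mul_assoc]

end Calculus

section Barrier

variable {n : ℕ}

/-- The part of the ball of radius `R` about `z` lying in the half space `{x | c < x m}`. -/
def Dom (z : EuclideanSpace ℝ (Fin n)) (R : ℝ) (m : Fin n) (c : ℝ) :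
    Set (EuclideanSpace ℝ (Fin n)) :=
  {x | ‖x - z‖ < R ∧ c < x m}

/-- `w` vanishes at least linearly on the flat part of the boundary. -/
def LinVanish (m : Fin n) (c : ℝ) (D : Set (EuclideanSpace ℝ (Fin n)))
    (w : EuclideanSpace ℝ (Fin n) → ℝ) : Prop :=
  ∃ K, ∀ x ∈ D, |w x| ≤ K * (x m - c)

variable {z x : EuclideanSpace ℝ (Fin n)} {R r c : ℝ} {m : Fin n}

lemma isOpen_dom : IsOpen (Dom z R m c) := by
  have h1 : IsOpen {x : EuclideanSpace ℝ (Fin n) | ‖x - z‖ < R} :=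
    isOpen_lt (by fun_prop) continuous_const
  have h2 : IsOpen {x : EuclideanSpace ℝ (Fin n) | c < x m} :=
    isOpen_lt continuous_const (EuclideanSpace.proj (𝕜 := ℝ) m).continuous
  exact h1.inter h2

lemma convex_dom : Convex ℝ (Dom z R m c) := by
  have h1 : Dom z R m c = Metric.ball z R ∩ {x | c < EuclideanSpace.proj (𝕜 := ℝ) m x} := by
    ext y
    simp [Dom, dist_eq_norm]
  rw [h1]
  exact (convex_ball z R).inter
    (convex_halfSpace_gt (EuclideanSpace.proj (𝕜 := ℝ) m).toLinearMap.isLinear c)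

lemma dom_subset (h : ‖x - z‖ + r ≤ R) : Dom x r m c ⊆ Dom z R m c := by
  rintro y ⟨hy, hc⟩
  refine ⟨?_, hc⟩
  have : ‖y - z‖ ≤ ‖y - x‖ + ‖x - z‖ := by
    simpa using norm_add_le (y - x) (x - z)
  linarith

lemma dom_mono {R' : ℝ} (h : R' ≤ R) : Dom z R' m c ⊆ Dom z R m c :=
  fun _ hy => ⟨hy.1.trans_le h, hy.2⟩

lemma norm_smul_single (t : ℝ) (i : Fin n) : ‖t • EuclideanSpace.single i (1 : ℝ)‖ = |t| := by
  simp [norm_smul]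

lemma add_smul_single_apply (t : ℝ) (i k : Fin n) :
    (x + t • EuclideanSpace.single i (1 : ℝ)) k = x k + if k = i then t else 0 := by
  simp [PiLp.single_apply]

/-- Moving a point of the domain tangentially or upwards. -/
lemma dom_add {i : Fin n} {t δ : ℝ} (hx : x ∈ Dom z (R - δ) m c) (ht : |t| ≤ δ)
    (hi : i ≠ m ∨ 0 ≤ t) : x + t • EuclideanSpace.single i (1 : ℝ) ∈ Dom z R m c := by
  refine ⟨?_, ?_⟩
  · have h := norm_add_le (x - z) (t • EuclideanSpace.single i (1 : ℝ))
    rw [norm_smul_single] at h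
    have e : x + t • EuclideanSpace.single i (1 : ℝ) - z
        = x - z + t • EuclideanSpace.single i (1 : ℝ) := by abel
    rw [e]
    linarith [hx.1]
  · rw [add_smul_single_apply]
    have := hx.2
    split_ifs with h
    · rcases hi with hi | hi
      · exact absurd h.symm hi
      · linarith
    · linarith

lemma second_deriv_nonpos_of_isLocalMax {φ φ₁ : ℝ → ℝ} {a : ℝ}
    (h1 : ∀ᶠ t in 𝓝 0, HasDerivAt φ (φ₁ t) t) (h2 : HasDerivAt φ₁ a 0) (hmax : IsLocalMax φ 0) :
    a ≤ 0 := by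
  by_contra! ha
  have e1 : deriv φ =ᶠ[𝓝 0] φ₁ := h1.mono fun t ht => ht.deriv
  have e2 : deriv (deriv φ) 0 = a := by rw [e1.deriv_eq, h2.deriv]
  have hmin : IsLocalMin φ 0 := isLocalMin_of_deriv_deriv_pos (by rw [e2]; exact ha)
    hmax.deriv_eq_zero h1.self_of_nhds.continuousAt
  have hc : φ =ᶠ[𝓝 0] fun _ => φ 0 := by
    filter_upwards [hmax, hmin] with t ht1 ht2 using le_antisymm ht1 ht2
  have e3 : deriv (deriv φ) 0 = 0 := by
    rw [hc.deriv.deriv_eq]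
    simp
  linarith

variable {U : Set (EuclideanSpace ℝ (Fin n))} {f : EuclideanSpace ℝ (Fin n) → ℝ}

lemma lap_nonpos_of_isLocalMax (hU : IsOpen U) (hf : ContDiffOn ℝ ∞ f U) (hx : x ∈ U)
    (hmax : IsLocalMax f x) : lap f x ≤ 0 := by
  refine Finset.sum_nonpos fun i _ => ?_
  have hc : Continuous fun s : ℝ => x + s • EuclideanSpace.single i (1 : ℝ) := by fun_prop
  have h0 : x + (0 : ℝ) • EuclideanSpace.single i (1 : ℝ) = x := by simp
  have hev : ∀ᶠ t in 𝓝 (0 : ℝ), x + t • EuclideanSpace.single i (1 : ℝ) ∈ U :=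
    hc.continuousAt.eventually (by simpa only [h0] using hU.eventually_mem hx)
  have h2 := hasDerivAt_line (x := x) hU (smooth_pd hU hf i) i 0 (by rwa [h0])
  rw [h0] at h2
  refine second_deriv_nonpos_of_isLocalMax
    (hev.mono fun t ht => hasDerivAt_line hU hf i t ht) h2 ?_
  have hm : ∀ᶠ y in 𝓝 (x + (0 : ℝ) • EuclideanSpace.single i (1 : ℝ)), f y ≤ f x := by
    rw [h0]; exact hmax
  have := hc.continuousAt.eventually hm
  simpa [IsLocalMax, IsMaxFilter] using this

lemma lap_sum {ι : Type*} (s : Finset ι) {F : ι → EuclideanSpace ℝ (Fin n) → ℝ} (hU : IsOpen U)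
    (hF : ∀ k ∈ s, ContDiffOn ℝ ∞ (F k) U) (hx : x ∈ U) :
    lap (fun y => ∑ k ∈ s, F k y) x = ∑ k ∈ s, lap (F k) x := by
  unfold lap
  rw [Finset.sum_comm]
  refine Finset.sum_congr rfl fun i _ => ?_
  rw [pd_congr hU (fun y hy => pd_sum s hU hF hy i) hx,
    pd_sum s hU (fun k hk => smooth_pd hU (hF k hk) i) hx]

lemma smooth_coord_sub (k : Fin n) (c : ℝ) :
    ContDiffOn ℝ ∞ (fun y : EuclideanSpace ℝ (Fin n) => y k - c) U :=
  (smooth_coord k).sub contDiffOn_const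

lemma pd_coord_sub (hU : IsOpen U) (hx : x ∈ U) (k i : Fin n) (c : ℝ) :
    pd i (fun y : EuclideanSpace ℝ (Fin n) => y k - c) x = if i = k then 1 else 0 := by
  rw [pd_sub hU (smooth_coord k) contDiffOn_const hx, pd_coord, pd_const, sub_zero]

lemma lap_coord_sub (hU : IsOpen U) (hx : x ∈ U) (k : Fin n) (c : ℝ) :
    lap (fun y : EuclideanSpace ℝ (Fin n) => y k - c) x = 0 := by
  refine Finset.sum_eq_zero fun i _ => ?_
  rw [pd_congr hU (fun y hy => pd_coord_sub hU hy k i c) hx, pd_const]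

lemma lap_sq_coord_sub (hU : IsOpen U) (hx : x ∈ U) (k : Fin n) (c : ℝ) :
    lap (fun y : EuclideanSpace ℝ (Fin n) => (y k - c) * (y k - c)) x = 2 := by
  rw [lap_coord_sub_mul hU (smooth_coord_sub k c) hx, pd_coord_sub hU hx, lap_coord_sub hU hx]
  simp

/-- One-sided barrier estimate for a function vanishing linearly on the flat boundary. -/
lemma barrier_upper {S F t : ℝ} {w : EuclideanSpace ℝ (Fin n) → ℝ} (hr : 0 < r) (hS0 : 0 ≤ S)
    (hF0 : 0 < F) (hw : ContDiffOn ℝ ∞ w (Dom z r m (z m)))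
    (hS : ∀ x ∈ Dom z r m (z m), |w x| ≤ S) (hF : ∀ x ∈ Dom z r m (z m), |lap w x| ≤ F)
    (hBC : LinVanish m (z m) (Dom z r m (z m)) w) (ht : 0 < t) (ht2 : t < r / 2) :
    w (z + t • EuclideanSpace.single m (1 : ℝ)) ≤ 4 * (n + 1) * (S / r + r * F) * t := by
  obtain ⟨K, hK⟩ := hBC
  set ρ := r / 2 with hρ
  have hρ0 : 0 < ρ := by positivity
  set B := n * S / ρ ^ 2 + F with hB
  have hB0 : 0 < B := by positivity
  set D := Dom z r m (z m) with hD
  have hDo : IsOpen D := isOpen_dom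
  let sq : EuclideanSpace ℝ (Fin n) → ℝ := fun y => ∑ k, (y k - z k) * (y k - z k)
  have hsq : ∀ y, sq y = ‖y - z‖ ^ 2 := by
    intro y
    rw [EuclideanSpace.norm_sq_eq]
    exact Finset.sum_congr rfl fun k _ => by simp [pow_two]
  let Φ : EuclideanSpace ℝ (Fin n) → ℝ := fun y =>
    w y - S / ρ ^ 2 * sq y - (B * ρ) * (y m - z m) - (-B) * ((y m - z m) * (y m - z m))
  have s1 : ContDiffOn ℝ ∞ sq D :=
    ContDiffOn.sum fun k _ => (smooth_coord_sub k _).mul (smooth_coord_sub k _)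
  have s1' : ContDiffOn ℝ ∞ (fun y => S / ρ ^ 2 * sq y) D := contDiffOn_const.mul s1
  have s2 : ContDiffOn ℝ ∞ (fun y : EuclideanSpace ℝ (Fin n) => (B * ρ) * (y m - z m)) D :=
    contDiffOn_const.mul (smooth_coord_sub m _)
  have s3 : ContDiffOn ℝ ∞
      (fun y : EuclideanSpace ℝ (Fin n) => (y m - z m) * (y m - z m)) D :=
    (smooth_coord_sub m _).mul (smooth_coord_sub m _)
  have s3' : ContDiffOn ℝ ∞
      (fun y : EuclideanSpace ℝ (Fin n) => (-B) * ((y m - z m) * (y m - z m))) D :=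
    contDiffOn_const.mul s3
  have hΦ : ContDiffOn ℝ ∞ Φ D := ((hw.sub s1').sub s2).sub s3'
  have hlap : ∀ y ∈ D, 0 < lap Φ y := by
    intro y hy
    have e : lap Φ y = lap w y - S / ρ ^ 2 * (∑ _k : Fin n, 2) - (B * ρ) * 0 - (-B) * 2 := by
      rw [lap_sub hDo ((hw.sub s1').sub s2) s3' hy, lap_sub hDo (hw.sub s1') s2 hy,
        lap_sub hDo hw s1' hy, lap_const_mul hDo s1 hy, lap_const_mul hDo (smooth_coord_sub m _) hy,
        lap_const_mul hDo s3 hy, lap_coord_sub hDo hy, lap_sq_coord_sub hDo hy,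
        lap_sum _ hDo (fun k _ => (smooth_coord_sub k _).mul (smooth_coord_sub k _)) hy]
      simp_rw [lap_sq_coord_sub hDo hy]
    have h1 := (abs_le.1 (hF y hy)).1
    rw [e, hB]
    simp only [Finset.sum_const, Finset.card_univ, Fintype.card_fin, nsmul_eq_mul]
    have : S / ρ ^ 2 * (n * 2) = 2 * (n * S / ρ ^ 2) := by ring
    rw [this]
    linarith
  have main : ∀ τ, 0 < τ → τ ≤ t → Φ (z + t • EuclideanSpace.single m (1 : ℝ)) ≤ |K| * τ := by
    intro τ hτ hτt
    let A : Set (EuclideanSpace ℝ (Fin n)) := {y | ‖y - z‖ ≤ ρ ∧ z m + τ ≤ y m}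
    have hAc : IsCompact A := by
      refine (isCompact_closedBall z ρ).of_isClosed_subset ?_ ?_
      · have h1 : IsClosed {y : EuclideanSpace ℝ (Fin n) | ‖y - z‖ ≤ ρ} :=
          isClosed_le (by fun_prop) continuous_const
        have h2 : IsClosed {y : EuclideanSpace ℝ (Fin n) | z m + τ ≤ y m} :=
          isClosed_le continuous_const (EuclideanSpace.proj (𝕜 := ℝ) m).continuous
        exact h1.inter h2
      · intro y hy
        rw [mem_closedBall_iff_norm]
        exact hy.1
    have hAD : A ⊆ D := fun y hy => ⟨by linarith [hy.1], by linarith [hy.2]⟩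
    have hy0 : z + t • EuclideanSpace.single m (1 : ℝ) ∈ A := by
      refine ⟨?_, ?_⟩
      · rw [add_sub_cancel_left, norm_smul_single, abs_of_pos ht]
        exact ht2.le
      · rw [add_smul_single_apply, if_pos rfl]
        linarith
    obtain ⟨y, hyA, hymax⟩ := hAc.exists_isMaxOn ⟨_, hy0⟩ (hΦ.continuousOn.mono hAD)
    refine (hymax hy0).trans ?_
    have hyD := hAD hyA
    have hym : y m - z m ≤ ρ := by
      have h1 := PiLp.norm_apply_le (y - z) m
      have h2 := (le_abs_self _).trans h1
      have h3 : (y - z) m = y m - z m := rfl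
      rw [h3] at h2
      exact h2.trans hyA.1
    have hpos : 0 ≤ (B * ρ) * (y m - z m) + (-B) * ((y m - z m) * (y m - z m)) := by
      have : 0 ≤ B * ((y m - z m) * (ρ - (y m - z m))) :=
        mul_nonneg hB0.le (mul_nonneg (by linarith [hyA.2]) (by linarith))
      nlinarith
    have hKτ : 0 ≤ |K| * τ := by positivity
    have hw1 := (abs_le.1 (hS y hyD)).2
    rcases hyA.1.lt_or_eq with hlt | heq
    · rcases hyA.2.lt_or_eq with hlt2 | heq2
      · exfalso
        have hA' : A ∈ 𝓝 y := by
          refine Filter.mem_of_superset ((isOpen_dom (z := z) (R := ρ) (m := m)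
            (c := z m + τ)).mem_nhds ⟨hlt, hlt2⟩) fun a ha => ⟨ha.1.le, ha.2.le⟩
        have := lap_nonpos_of_isLocalMax hDo hΦ hyD (hymax.isLocalMax hA')
        linarith [hlap y hyD]
      · have h1 : w y ≤ |K| * τ := by
          have h2 := (le_abs_self _).trans (hK y hyD)
          rw [show y m - z m = τ by linarith] at h2
          exact h2.trans (mul_le_mul_of_nonneg_right (le_abs_self K) hτ.le)
        have h3 : 0 ≤ S / ρ ^ 2 * sq y := by rw [hsq]; positivity
        show w y - _ - _ - _ ≤ _
        linarith
    · have h3 : S / ρ ^ 2 * sq y = S := by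
        rw [hsq, heq]
        field_simp
      show w y - _ - _ - _ ≤ _
      linarith
  have hΦ0 : Φ (z + t • EuclideanSpace.single m (1 : ℝ)) ≤ 0 := by
    by_contra! hcon
    set v := Φ (z + t • EuclideanSpace.single m (1 : ℝ))
    have h1 := main (min t (v / (2 * (|K| + 1)))) (by positivity) (min_le_left _ _)
    have h2 : |K| * min t (v / (2 * (|K| + 1))) ≤ (|K| + 1) * (v / (2 * (|K| + 1))) := by
      refine mul_le_mul (by linarith) (min_le_right _ _) (by positivity) (by positivity)
    have h3 : (|K| + 1) * (v / (2 * (|K| + 1))) = v / 2 := by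
      field_simp
    linarith
  have e1 : sq (z + t • EuclideanSpace.single m (1 : ℝ)) = t ^ 2 := by
    rw [hsq, add_sub_cancel_left, norm_smul_single, sq_abs]
  have e2 : (z + t • EuclideanSpace.single m (1 : ℝ)) m - z m = t := by
    rw [add_smul_single_apply, if_pos rfl]
    ring
  simp only [Φ] at hΦ0
  rw [e1, e2] at hΦ0
  have h4 : w (z + t • EuclideanSpace.single m (1 : ℝ)) ≤ S / ρ ^ 2 * t ^ 2 + B * ρ * t := by
    nlinarith [mul_pos hB0 (mul_pos ht ht)]
  refine h4.trans ?_
  have h5 : S / ρ ^ 2 * t ^ 2 ≤ S / ρ ^ 2 * (ρ * t) := by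
    refine mul_le_mul_of_nonneg_left ?_ (by positivity)
    nlinarith
  have h6 : S / ρ ^ 2 * (ρ * t) + B * ρ * t = (2 * (n + 1) * (S / r) + r * F / 2) * t := by
    rw [hB, hρ]
    field_simp
    ring
  have h7 : (2 * (n + 1) * (S / r) + r * F / 2) ≤ 4 * (n + 1) * (S / r + r * F) := by
    have a1 : 0 ≤ S / r := by positivity
    have a2 : 0 < r * F := by positivity
    have a3 : (0 : ℝ) ≤ n := Nat.cast_nonneg n
    nlinarith [mul_nonneg a3 a1, mul_nonneg a3 a2.le]
  have := mul_le_mul_of_nonneg_right h7 ht.le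
  linarith

lemma LinVanish.const_mul {D : Set (EuclideanSpace ℝ (Fin n))}
    {w : EuclideanSpace ℝ (Fin n) → ℝ} (h : LinVanish m c D w) (a : ℝ) :
    LinVanish m c D (fun y => a * w y) := by
  obtain ⟨K, hK⟩ := h
  refine ⟨|a| * K, fun y hy => ?_⟩
  rw [abs_mul, mul_assoc]
  exact mul_le_mul_of_nonneg_left (hK y hy) (abs_nonneg a)

lemma barrier {S F t : ℝ} {w : EuclideanSpace ℝ (Fin n) → ℝ} (hr : 0 < r) (hS0 : 0 ≤ S)
    (hF0 : 0 < F) (hw : ContDiffOn ℝ ∞ w (Dom z r m (z m)))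
    (hS : ∀ x ∈ Dom z r m (z m), |w x| ≤ S) (hF : ∀ x ∈ Dom z r m (z m), |lap w x| ≤ F)
    (hBC : LinVanish m (z m) (Dom z r m (z m)) w) (ht : 0 < t) (ht2 : t < r / 2) :
    |w (z + t • EuclideanSpace.single m (1 : ℝ))| ≤ 4 * (n + 1) * (S / r + r * F) * t := by
  refine abs_le'.2 ⟨barrier_upper hr hS0 hF0 hw hS hF hBC ht ht2, ?_⟩
  have := barrier_upper (w := fun y => (-1) * w y) hr hS0 hF0 (contDiffOn_const.mul hw)
    (fun x hx => by simpa using hS x hx)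
    (fun x hx => by rw [lap_const_mul isOpen_dom hw hx]; simpa using hF x hx)
    (hBC.const_mul _) ht ht2
  simpa using this

end Barrier

section Gradient

variable {n : ℕ} {U : Set (EuclideanSpace ℝ (Fin n))} {x z : EuclideanSpace ℝ (Fin n)}
  {f w : EuclideanSpace ℝ (Fin n) → ℝ} {r c : ℝ} {m : Fin n}

/-- Reflection across the hyperplane through `x` orthogonal to the `j`-th coordinate axis. -/
noncomputable def refl (x : EuclideanSpace ℝ (Fin n)) (j : Fin n)
    (y : EuclideanSpace ℝ (Fin n)) : EuclideanSpace ℝ (Fin n) :=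
  y + (2 * (x j - y j)) • EuclideanSpace.single j (1 : ℝ)

lemma norm_refl_sub (x : EuclideanSpace ℝ (Fin n)) (j : Fin n) (y : EuclideanSpace ℝ (Fin n)) :
    ‖refl x j y - x‖ = ‖y - x‖ := by
  rw [EuclideanSpace.norm_eq, EuclideanSpace.norm_eq]
  congr 1
  refine Finset.sum_congr rfl fun k _ => ?_
  have : (refl x j y - x) k = (y k + if k = j then 2 * (x j - y j) else 0) - x k := by
    rw [← add_smul_single_apply]
    rfl
  rw [this]
  simp only [PiLp.sub_apply, Real.norm_eq_abs, sq_abs]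
  split_ifs with h
  · subst h
    ring
  · ring

lemma continuous_refl (x : EuclideanSpace ℝ (Fin n)) (j : Fin n) : Continuous (refl x j) := by
  have : Continuous fun y : EuclideanSpace ℝ (Fin n) => y j :=
    (EuclideanSpace.proj (𝕜 := ℝ) j).continuous
  unfold refl
  fun_prop

lemma contDiff_refl (x : EuclideanSpace ℝ (Fin n)) (j : Fin n) : ContDiff ℝ ∞ (refl x j) := by
  have : ContDiff ℝ ∞ fun y : EuclideanSpace ℝ (Fin n) => y j :=
    (EuclideanSpace.proj (𝕜 := ℝ) j).contDiff
  unfold refl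
  fun_prop

lemma pd_comp_refl (hU : IsOpen U) (hf : ContDiffOn ℝ ∞ f U) (j i : Fin n)
    (y : EuclideanSpace ℝ (Fin n)) (hy : refl x j y ∈ U) :
    pd i (fun y => f (refl x j y)) y = (if i = j then -1 else 1) * pd i f (refl x j y) := by
  have h1 : HasFDerivAt (fun y : EuclideanSpace ℝ (Fin n) => y j)
      (EuclideanSpace.proj (𝕜 := ℝ) j) y := (EuclideanSpace.proj (𝕜 := ℝ) j).hasFDerivAt
  have h2 := (hasFDerivAt_id y).add
    ((((h1.const_sub (x j)).const_mul 2)).smul_const (EuclideanSpace.single j (1 : ℝ)))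
  have h3 := (differentiableAt_of_smooth hU hf hy).hasFDerivAt.comp y h2
  have h4 : fderiv ℝ (fun y => f (refl x j y)) y = _ := h3.fderiv
  unfold pd
  rw [h4]
  by_cases h : i = j
  · subst h
    simp
    ring
  · have h' : j ≠ i := fun e => h e.symm
    simp [h, h']

lemma lap_comp_refl (hU : IsOpen U) (hf : ContDiffOn ℝ ∞ f U) (j : Fin n)
    (y : EuclideanSpace ℝ (Fin n)) (hy : refl x j y ∈ U) :
    lap (fun y => f (refl x j y)) y = lap f (refl x j y) := by
  have hV : IsOpen (refl x j ⁻¹' U) := hU.preimage (continuous_refl x j)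
  refine Finset.sum_congr rfl fun i _ => ?_
  have hs : ContDiffOn ℝ ∞ (fun y => pd i f (refl x j y)) (refl x j ⁻¹' U) :=
    (smooth_pd hU hf i).comp (contDiff_refl x j).contDiffOn (Set.mapsTo_preimage _ _)
  rw [pd_congr hV (fun v hv => pd_comp_refl hU hf j i v hv) hy, pd_const_mul hV hs hy,
    pd_comp_refl hU (smooth_pd hU hf i) j i y hy, ← mul_assoc]
  split_ifs <;> simp

lemma abs_deriv_le_of_right {ψ : ℝ → ℝ} {a K δ : ℝ} (h : HasDerivAt ψ a 0) (hδ : 0 < δ)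
    (hK : ∀ t, 0 < t → t < δ → |ψ t - ψ 0| ≤ K * t) : |a| ≤ K := by
  have h1 := h.tendsto_slope_zero_right.abs
  refine le_of_tendsto h1 ?_
  filter_upwards [Ioo_mem_nhdsGT hδ] with t ht
  have := hK t ht.1 ht.2
  rw [zero_add, smul_eq_mul, abs_mul, abs_inv, abs_of_pos ht.1, inv_mul_le_iff₀ ht.1]
  linarith

lemma grad_interior {S F : ℝ} (hr : 0 < r) (hS0 : 0 ≤ S) (hF0 : 0 < F)
    (hw : ContDiffOn ℝ ∞ w (Metric.ball x r)) (hS : ∀ y ∈ Metric.ball x r, |w y| ≤ S)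
    (hF : ∀ y ∈ Metric.ball x r, |lap w y| ≤ F) (j : Fin n) :
    |pd j w x| ≤ 8 * (n + 1) * (S / r + r * F) := by
  have hB : IsOpen (Metric.ball x r) := Metric.isOpen_ball
  have hcl : Metric.closedBall x (r / 2) ⊆ Metric.ball x r :=
    Metric.closedBall_subset_ball (by linarith)
  set D := Dom x (r / 2) j (x j) with hD
  have hDcl : D ⊆ Metric.closedBall x (r / 2) := fun y hy => by
    rw [mem_closedBall_iff_norm]
    exact hy.1.le
  have hRcl : ∀ y ∈ D, refl x j y ∈ Metric.closedBall x (r / 2) := fun y hy => by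
    rw [mem_closedBall_iff_norm, norm_refl_sub]
    exact hy.1.le
  have hDB : D ⊆ Metric.ball x r := hDcl.trans hcl
  have hRB : ∀ y ∈ D, refl x j y ∈ Metric.ball x r := fun y hy => hcl (hRcl y hy)
  have hwr : ContDiffOn ℝ ∞ (fun y => w (refl x j y)) D :=
    hw.comp (contDiff_refl x j).contDiffOn hRB
  have hD0 : IsOpen D := isOpen_dom
  have hlin : LinVanish j (x j) D (fun y => w y - w (refl x j y)) := by
    obtain ⟨G, hG⟩ := (isCompact_closedBall x (r / 2)).exists_bound_of_continuousOn
      ((hw.continuousOn_fderiv_of_isOpen hB (by simp)).mono hcl)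
    refine ⟨2 * G, fun y hy => ?_⟩
    have h1 := (convex_closedBall x (r / 2)).norm_image_sub_le_of_norm_fderiv_le (𝕜 := ℝ)
      (fun v hv => differentiableAt_of_smooth hB hw (hcl hv)) hG (hRcl y hy) (hDcl hy)
    have h2 : ‖y - refl x j y‖ = 2 * (y j - x j) := by
      rw [refl, sub_add_cancel_left, norm_neg, norm_smul_single, abs_of_neg]
      · ring
      · linarith [hy.2]
    rw [h2] at h1
    rw [← Real.norm_eq_abs]
    linarith
  have hbar : ∀ t, 0 < t → t < r / 4 →
      |w (x + t • EuclideanSpace.single j (1 : ℝ)) - w (x + (-t) • EuclideanSpace.single j (1 : ℝ))|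
        ≤ 4 * (n + 1) * (2 * S / (r / 2) + (r / 2) * (2 * F)) * t := by
    intro t ht ht2
    have := barrier (w := fun y => w y - w (refl x j y)) (z := x) (r := r / 2) (m := j)
      (S := 2 * S) (F := 2 * F) (t := t) (by linarith) (by linarith) (by linarith)
      ((hw.mono hDB).sub hwr)
      (fun y hy => by
        have h1 := hS y (hDB hy)
        have h2 := hS _ (hRB y hy)
        have h3 := abs_sub (w y) (w (refl x j y))
        linarith)
      (fun y hy => by
        rw [lap_sub hD0 (hw.mono hDB) hwr hy, lap_comp_refl hB hw j y (hRB y hy)]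
        have h1 := hF y (hDB hy)
        have h2 := hF _ (hRB y hy)
        have h3 := abs_sub (lap w y) (lap w (refl x j y))
        linarith)
      hlin ht (by linarith)
    have e : refl x j (x + t • EuclideanSpace.single j (1 : ℝ))
        = x + (-t) • EuclideanSpace.single j (1 : ℝ) := by
      unfold refl
      rw [add_smul_single_apply, if_pos rfl, add_assoc, ← add_smul]
      congr 2
      ring
    rwa [e] at this
  have hx0 : x + (0 : ℝ) • EuclideanSpace.single j (1 : ℝ) = x := by simp
  have hxm : x + (0 : ℝ) • EuclideanSpace.single j (1 : ℝ) ∈ Metric.ball x r := by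
    rw [hx0]
    exact Metric.mem_ball_self hr
  have d1 := hasDerivAt_line hB hw j 0 hxm
  have d2 : HasDerivAt (fun s : ℝ => w (x + (-s) • EuclideanSpace.single j (1 : ℝ)))
      (-(pd j w x)) 0 := by
    have h3 := HasDerivAt.scomp (h := fun s : ℝ => -s) (x := 0) (h' := -1)
      (g₁ := fun s : ℝ => w (x + s • EuclideanSpace.single j (1 : ℝ))) (g₁' := pd j w x)
      (by rw [neg_zero]; rwa [hx0] at d1) (hasDerivAt_neg' 0)
    simpa [Function.comp_def] using h3
  rw [hx0] at d1
  have d3 := d1.sub d2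
  have := abs_deriv_le_of_right d3 (δ := r / 4) (by linarith)
    (K := 4 * (n + 1) * (2 * S / (r / 2) + (r / 2) * (2 * F))) (fun t h1 h2 => by
      simpa using hbar t h1 h2)
  rw [show pd j w x - -pd j w x = 2 * pd j w x by ring, abs_mul, abs_two] at this
  have e : (4 : ℝ) * (n + 1) * (2 * S / (r / 2) + (r / 2) * (2 * F))
      = 2 * (8 * (n + 1) * (S / r + r * F)) - 12 * (n + 1) * (r * F) := by
    field_simp
    ring
  have : 0 ≤ 12 * ((n : ℝ) + 1) * (r * F) := by positivity
  linarith

/-- The constant in the gradient estimate up to the flat boundary. -/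
noncomputable def gradConst (n : ℕ) : ℝ := 200 * (n + 1) ^ 2

lemma gradConst_ge (n : ℕ) : 200 ≤ gradConst n := by
  unfold gradConst
  have : (0 : ℝ) ≤ n := Nat.cast_nonneg n
  nlinarith

/-- Gradient estimate up to the flat boundary. -/
lemma grad_le {S F : ℝ} (hr : 0 < r) (hS0 : 0 ≤ S) (hF0 : 0 < F) (hxc : c < x m)
    (hw : ContDiffOn ℝ ∞ w (Dom x r m c)) (hS : ∀ y ∈ Dom x r m c, |w y| ≤ S)
    (hF : ∀ y ∈ Dom x r m c, |lap w y| ≤ F) (hBC : LinVanish m c (Dom x r m c) w) (j : Fin n) :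
    |pd j w x| ≤ gradConst n * (S / r + r * F) := by
  have hn : (0 : ℝ) ≤ n := Nat.cast_nonneg n
  have a1 : 0 ≤ S / r := by positivity
  have a2 : 0 < r * F := by positivity
  have hcoord : ∀ y, |y m - x m| ≤ ‖y - x‖ := fun y => by
    simpa using PiLp.norm_apply_le (y - x) m
  set t := x m - c with ht
  have ht0 : 0 < t := by linarith
  rcases le_or_gt (r / 8) t with h | h
  · have hsub : Metric.ball x (r / 8) ⊆ Dom x r m c := fun y hy => by
      rw [mem_ball_iff_norm] at hy
      have := neg_abs_le (y m - x m)
      exact ⟨by linarith, by linarith [hcoord y]⟩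
    have := grad_interior (x := x) (r := r / 8) (by linarith) hS0 hF0 (hw.mono hsub)
      (fun y hy => hS y (hsub hy)) (fun y hy => hF y (hsub hy)) j
    refine this.trans ?_
    have e : S / (r / 8) + r / 8 * F = 8 * (S / r) + r * F / 8 := by
      field_simp
    rw [e, gradConst]
    have : 8 * ((n : ℝ) + 1) * (8 * (S / r) + r * F / 8) ≤ 64 * (n + 1) * (S / r + r * F) := by
      nlinarith [mul_nonneg hn a2.le]
    refine this.trans (mul_le_mul_of_nonneg_right ?_ (by positivity))
    nlinarith
  · have hsub : Metric.ball x t ⊆ Dom x r m c := fun y hy => by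
      rw [mem_ball_iff_norm] at hy
      have := neg_abs_le (y m - x m)
      exact ⟨by linarith, by linarith [hcoord y]⟩
    have key : ∀ y ∈ Metric.ball x t, |w y| ≤ 16 * (n + 1) * (S / r + r * F) * t := by
      intro y hy
      have hyD := hsub hy
      rw [mem_ball_iff_norm] at hy
      have hs0 : 0 < y m - c := by linarith [hyD.2]
      have hs1 : y m - c < 2 * t := by
        have := le_abs_self (y m - x m)
        linarith [hcoord y]
      set p := y + (-(y m - c)) • EuclideanSpace.single m (1 : ℝ) with hp
      have hpm : p m = c := by
        rw [hp, add_smul_single_apply, if_pos rfl]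
        ring
      have hpx : ‖p - x‖ ≤ t + 2 * t := by
        have h1 := norm_add_le (y - x) ((-(y m - c)) • EuclideanSpace.single m (1 : ℝ))
        rw [norm_smul_single, abs_neg, abs_of_pos hs0] at h1
        have e : p - x = y - x + (-(y m - c)) • EuclideanSpace.single m (1 : ℝ) := by
          rw [hp]
          abel
        rw [e]
        linarith
      have hsub2 : Dom p (r / 2) m (p m) ⊆ Dom x r m c := by
        rw [hpm]
        exact dom_subset (by linarith)
      have hb := barrier (z := p) (r := r / 2) (m := m) (w := w) (S := S) (F := F) (t := y m - c)
        (by linarith) hS0 hF0 (hw.mono hsub2) (fun v hv => hS v (hsub2 hv))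
        (fun v hv => hF v (hsub2 hv))
        (by
          obtain ⟨K, hK⟩ := hBC
          exact ⟨K, fun v hv => by rw [hpm]; exact hK v (hsub2 hv)⟩) hs0 (by linarith)
      have e : p + (y m - c) • EuclideanSpace.single m (1 : ℝ) = y := by
        rw [hp, add_assoc, ← add_smul]
        simp
      rw [e] at hb
      refine hb.trans ?_
      have e2 : S / (r / 2) + r / 2 * F = 2 * (S / r) + r * F / 2 := by
        field_simp
      rw [e2]
      have h3 : 4 * ((n : ℝ) + 1) * (2 * (S / r) + r * F / 2) ≤ 8 * (n + 1) * (S / r + r * F) := by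
        nlinarith [mul_nonneg hn a2.le]
      calc _ ≤ 8 * (n + 1) * (S / r + r * F) * (2 * t) :=
            mul_le_mul h3 hs1.le hs0.le (by positivity)
        _ = _ := by ring
    have := grad_interior (x := x) (r := t) ht0 (by positivity) hF0 (hw.mono hsub)
      key (fun y hy => hF y (hsub hy)) j
    refine this.trans ?_
    have e : 16 * ((n : ℝ) + 1) * (S / r + r * F) * t / t = 16 * (n + 1) * (S / r + r * F) := by
      field_simp
    rw [e, gradConst]
    have h4 : t * F ≤ S / r + r * F := by nlinarith
    calc 8 * ((n : ℝ) + 1) * (16 * (n + 1) * (S / r + r * F) + t * F)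
        ≤ 8 * ((n : ℝ) + 1) * (16 * (n + 1) * (S / r + r * F) + (S / r + r * F)) := by gcongr
      _ = (8 * (n + 1) * (16 * (n + 1) + 1)) * (S / r + r * F) := by ring
      _ ≤ _ := by
        refine mul_le_mul_of_nonneg_right ?_ (by positivity)
        nlinarith

end Gradient

section Differences

variable {n : ℕ} {U : Set (EuclideanSpace ℝ (Fin n))} {x z : EuclideanSpace ℝ (Fin n)}
  {f w : EuclideanSpace ℝ (Fin n) → ℝ} {R r c : ℝ} {m : Fin n}

lemma pd_shift (f : EuclideanSpace ℝ (Fin n) → ℝ) (v : EuclideanSpace ℝ (Fin n)) (i : Fin n) :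
    pd i (fun y => f (y + v)) = fun y => pd i f (y + v) := by
  funext y
  unfold pd
  rw [fderiv_comp_add_right]

lemma lap_shift (f : EuclideanSpace ℝ (Fin n) → ℝ) (v : EuclideanSpace ℝ (Fin n)) :
    lap (fun y => f (y + v)) = fun y => lap f (y + v) := by
  funext y
  simp only [lap, pd_shift]

lemma smooth_shift {V : Set (EuclideanSpace ℝ (Fin n))} {v : EuclideanSpace ℝ (Fin n)}
    (hf : ContDiffOn ℝ ∞ f U) (h : ∀ y ∈ V, y + v ∈ U) :
    ContDiffOn ℝ ∞ (fun y => f (y + v)) V :=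
  hf.comp (contDiff_id.add contDiff_const).contDiffOn h

lemma abs_shift_sub_le {A η : ℝ} {a : Fin n} (hU : IsOpen U) (hf : ContDiffOn ℝ ∞ f U)
    (hη : 0 ≤ η) (hseg : ∀ t ∈ Set.Icc 0 η, x + t • EuclideanSpace.single a (1 : ℝ) ∈ U)
    (hA : ∀ t ∈ Set.Icc 0 η, |pd a f (x + t • EuclideanSpace.single a (1 : ℝ))| ≤ A) :
    |f (x + η • EuclideanSpace.single a (1 : ℝ)) - f x| ≤ A * η := by
  have := Convex.norm_image_sub_le_of_norm_hasDerivWithin_le (𝕜 := ℝ) (s := Set.Icc 0 η)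
    (f := fun t : ℝ => f (x + t • EuclideanSpace.single a (1 : ℝ))) (C := A) (x := 0) (y := η)
    (fun t ht => (hasDerivAt_line hU hf a t (hseg t ht)).hasDerivWithinAt)
    hA (convex_Icc 0 η) (Set.left_mem_Icc.2 hη) (Set.right_mem_Icc.2 hη)
  simpa [abs_of_nonneg hη] using this

lemma abs_shift_sub_linear_le {A η : ℝ} {a : Fin n} (hU : IsOpen U) (hf : ContDiffOn ℝ ∞ f U)
    (hη : 0 ≤ η) (hseg : ∀ t ∈ Set.Icc 0 η, x + t • EuclideanSpace.single a (1 : ℝ) ∈ U)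
    (hA : ∀ t ∈ Set.Icc 0 η, |pd a (pd a f) (x + t • EuclideanSpace.single a (1 : ℝ))| ≤ A) :
    |f (x + η • EuclideanSpace.single a (1 : ℝ)) - f x - η * pd a f x| ≤ A * η * η := by
  have hA0 : 0 ≤ A := (abs_nonneg _).trans (hA 0 (Set.left_mem_Icc.2 hη))
  have h1 : ∀ t ∈ Set.Icc 0 η,
      |pd a f (x + t • EuclideanSpace.single a (1 : ℝ)) - pd a f x| ≤ A * η := fun t ht =>
    (abs_shift_sub_le hU (smooth_pd hU hf a) ht.1 (fun s hs => hseg s ⟨hs.1, hs.2.trans ht.2⟩)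
      (fun s hs => hA s ⟨hs.1, hs.2.trans ht.2⟩)).trans (mul_le_mul_of_nonneg_left ht.2 hA0)
  have := Convex.norm_image_sub_le_of_norm_hasDerivWithin_le (𝕜 := ℝ) (s := Set.Icc 0 η)
    (f := fun t : ℝ => f (x + t • EuclideanSpace.single a (1 : ℝ)) - t * pd a f x)
    (C := A * η) (x := 0) (y := η)
    (fun t ht => ((hasDerivAt_line hU hf a t (hseg t ht)).sub
      ((hasDerivAt_id t).mul_const (pd a f x))).hasDerivWithinAt)
    (by simpa using h1) (convex_Icc 0 η) (Set.left_mem_Icc.2 hη) (Set.right_mem_Icc.2 hη)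
  simp only [zero_smul, add_zero, zero_mul, sub_zero, Real.norm_eq_abs, abs_of_nonneg hη] at this
  rwa [sub_right_comm] at this

lemma dom_add' {i : Fin n} {t δ R' : ℝ} (hx : x ∈ Dom z R' m c) (ht : |t| ≤ δ) (hR : R' + δ ≤ R)
    (hi : i ≠ m ∨ 0 ≤ t) : x + t • EuclideanSpace.single i (1 : ℝ) ∈ Dom z R m c :=
  dom_add (dom_mono (by linarith) hx) ht hi

lemma dom_subset_of_mem {R' : ℝ} (hx : x ∈ Dom z R' m c) (h : R' + r ≤ R) :
    Dom x r m c ⊆ Dom z R m c :=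
  dom_subset (by linarith [hx.1])

/-- Gradient estimate on a smaller domain. -/
lemma grad_le_of_mem {S F R' : ℝ} (hr : 0 < r) (hF0 : 0 < F)
    (hw : ContDiffOn ℝ ∞ w (Dom z R m c)) (hS : ∀ y ∈ Dom z R m c, |w y| ≤ S)
    (hF : ∀ y ∈ Dom z R m c, |lap w y| ≤ F) (hBC : LinVanish m c (Dom z R m c) w)
    (hx : x ∈ Dom z R' m c) (hR : R' + r ≤ R) (j : Fin n) :
    |pd j w x| ≤ gradConst n * (S / r + r * F) := by
  have hsub := dom_subset_of_mem hx hR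
  have hS0 : 0 ≤ S := (abs_nonneg _).trans (hS x (dom_mono (by linarith) hx))
  obtain ⟨K, hK⟩ := hBC
  exact grad_le hr hS0 hF0 hx.2 (hw.mono hsub) (fun y hy => hS y (hsub hy))
    (fun y hy => hF y (hsub hy)) ⟨K, fun y hy => hK y (hsub hy)⟩ j

lemma LinVanish.shift_sub {D D' : Set (EuclideanSpace ℝ (Fin n))} (h : LinVanish m c D w)
    {a : Fin n} (ha : a ≠ m) {η : ℝ} (hD : D' ⊆ D)
    (hD' : ∀ y ∈ D', y + η • EuclideanSpace.single a (1 : ℝ) ∈ D) :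
    LinVanish m c D' (fun y => w (y + η • EuclideanSpace.single a (1 : ℝ)) - w y) := by
  obtain ⟨K, hK⟩ := h
  refine ⟨2 * K, fun y hy => ?_⟩
  have h1 := hK y (hD hy)
  have h2 := hK _ (hD' y hy)
  rw [add_smul_single_apply, if_neg ha.symm, add_zero] at h2
  have h3 := abs_sub (w (y + η • EuclideanSpace.single a (1 : ℝ))) (w y)
  linarith

/-- The constant in the tangential Hölder estimate for the gradient. -/
noncomputable def holderConst (n : ℕ) (δ : ℝ) : ℝ := gradConst n * (2 * gradConst n / δ + 2)

lemma grad_tangential_holder {S δ s : ℝ} {a : Fin n} (ha : a ≠ m) (hδ : 0 < δ) (hδ1 : δ ≤ 1)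
    (hS0 : 0 < S) (hw : ContDiffOn ℝ ∞ w (Dom z R m c)) (hS : ∀ y ∈ Dom z R m c, |w y| ≤ S)
    (hF : ∀ y ∈ Dom z R m c, |lap w y| ≤ S) (hBC : LinVanish m c (Dom z R m c) w)
    (hs : 0 < s) (hsδ : s ≤ δ) (hx : x ∈ Dom z (R - 3 * δ) m c) (j : Fin n) :
    |pd j w (x + s ^ 2 • EuclideanSpace.single a (1 : ℝ)) - pd j w x|
      ≤ holderConst n δ * S * s := by
  have hg := gradConst_ge n
  have hs2 : s ^ 2 ≤ δ := by nlinarith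
  have hs2' : |s ^ 2| ≤ δ := by rwa [abs_of_pos (by positivity)]
  set A := gradConst n * (2 * S / δ) with hA
  have hA1 : ∀ y ∈ Dom z (R - δ) m c, |pd a w y| ≤ A := by
    intro y hy
    refine (grad_le_of_mem hδ hS0 hw hS hF hBC hy (by linarith) a).trans ?_
    refine mul_le_mul_of_nonneg_left ?_ (by linarith)
    have : δ * S ≤ S / δ := by
      rw [le_div_iff₀ hδ]
      nlinarith [mul_pos hδ hS0]
    have e : 2 * S / δ = S / δ + S / δ := by ring
    linarith
  have hsub2 : Dom z (R - 2 * δ) m c ⊆ Dom z R m c := dom_mono (by linarith)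
  have hsh : ∀ y ∈ Dom z (R - 2 * δ) m c,
      y + s ^ 2 • EuclideanSpace.single a (1 : ℝ) ∈ Dom z R m c := fun y hy =>
    dom_add' hy hs2' (by linarith) (Or.inl ha)
  have hws := smooth_shift hw hsh
  have h1 := grad_le_of_mem (w := fun y => w (y + s ^ 2 • EuclideanSpace.single a (1 : ℝ)) - w y)
    (S := A * s ^ 2) (F := 2 * S) (R := R - 2 * δ) hs (by linarith)
    (hws.sub (hw.mono hsub2))
    (fun y hy => abs_shift_sub_le (U := Dom z R m c) isOpen_dom hw (by positivity)
      (fun t ht => dom_add' (δ := δ) hy (by rw [abs_of_nonneg ht.1]; exact ht.2.trans hs2) (by linarith)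
        (Or.inl ha))
      (fun t ht => hA1 _ (dom_add' (δ := δ) hy (by rw [abs_of_nonneg ht.1]; exact ht.2.trans hs2)
        (by linarith) (Or.inl ha))))
    (fun y hy => by
      rw [lap_sub isOpen_dom hws (hw.mono hsub2) hy, lap_shift]
      have h2 := hF y (hsub2 hy)
      have h3 := hF _ (hsh y hy)
      have h4 := abs_sub (lap w (y + s ^ 2 • EuclideanSpace.single a (1 : ℝ))) (lap w y)
      linarith)
    (hBC.shift_sub ha hsub2 hsh) hx (by linarith) j
  have hx2 : x ∈ Dom z (R - 2 * δ) m c := dom_mono (by linarith) hx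
  rw [pd_sub isOpen_dom hws (hw.mono hsub2) hx2, pd_shift] at h1
  refine h1.trans (le_of_eq ?_)
  rw [hA, holderConst]
  field_simp

/-- Second differences of size `η ^ (5 / 4)` control the derivative by a difference quotient. -/
lemma deriv_le_of_second_difference {φ : ℝ → ℝ} {d C s : ℝ} (hd : HasDerivAt φ d 0)
    (hC : 0 ≤ C) (hs : 0 < s)
    (h : ∀ σ, 0 < σ → σ ≤ s → |φ (2 * σ ^ 4) - 2 * φ (σ ^ 4) + φ 0| ≤ C * σ ^ 5) :
    |d| ≤ |φ (s ^ 4) - φ 0| / s ^ 4 + 8 * C * s := by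
  set κ : ℝ := Real.sqrt (Real.sqrt (1 / 2)) with hκ
  have hκ4 : κ ^ 4 = 1 / 2 := by
    rw [show (4 : ℕ) = 2 * 2 by norm_num, pow_mul, hκ, Real.sq_sqrt (by positivity),
      Real.sq_sqrt (by positivity)]
  have hκ0 : 0 < κ := by positivity
  have hκ1 : κ ≤ 7 / 8 := by
    by_contra! hcon
    have : (7 / 8 : ℝ) ^ 4 < κ ^ 4 := by gcongr
    rw [hκ4] at this
    norm_num at this
  let t : ℕ → ℝ := fun k => s * κ ^ k
  have ht0 : ∀ k, 0 < t k := fun k => by positivity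
  have hts : ∀ k, t k ≤ s := fun k => by
    have : κ ^ k ≤ 1 := pow_le_one₀ hκ0.le (by linarith)
    simpa [t] using mul_le_mul_of_nonneg_left this hs.le
  have htk : ∀ k, t k ^ 4 = 2 * t (k + 1) ^ 4 := fun k => by
    simp only [t, pow_succ κ k]
    rw [show (s * (κ ^ k * κ)) ^ 4 = (s * κ ^ k) ^ 4 * κ ^ 4 by ring, hκ4]
    ring
  let D : ℕ → ℝ := fun k => (φ (t k ^ 4) - φ 0) / t k ^ 4
  have hD : ∀ k, dist (D k) (D (k + 1)) ≤ C * s * κ ^ k := by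
    intro k
    have h1 := h _ (ht0 (k + 1)) (hts (k + 1))
    have h0 := ht0 (k + 1)
    have e : D k - D (k + 1) = (φ (2 * t (k + 1) ^ 4) - 2 * φ (t (k + 1) ^ 4) + φ 0)
        / (2 * t (k + 1) ^ 4) := by
      simp only [D, htk k]
      field_simp
      ring
    rw [Real.dist_eq, e, abs_div, abs_of_pos (by positivity : 0 < 2 * t (k + 1) ^ 4),
      div_le_iff₀ (by positivity)]
    refine h1.trans ?_
    have e2 : t (k + 1) ≤ s * κ ^ k := by
      have : s * κ ^ k * κ ≤ s * κ ^ k * 1 :=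
        mul_le_mul_of_nonneg_left (by linarith) (by positivity)
      simp only [t, pow_succ]
      linarith
    calc C * t (k + 1) ^ 5 = C * t (k + 1) * t (k + 1) ^ 4 := by ring
      _ ≤ C * (s * κ ^ k) * t (k + 1) ^ 4 := by gcongr
      _ ≤ C * (s * κ ^ k) * (2 * t (k + 1) ^ 4) := by
        refine mul_le_mul_of_nonneg_left ?_ (by positivity)
        linarith [pow_pos h0 4]
      _ = _ := by ring
  have hlim : Filter.Tendsto D Filter.atTop (𝓝 d) := by
    have h1 := hd.tendsto_slope_zero_right
    have h2 : Filter.Tendsto (fun k => t k ^ 4) Filter.atTop (𝓝[>] 0) := by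
      refine tendsto_nhdsWithin_iff.2 ⟨?_, Filter.Eventually.of_forall fun k => pow_pos (ht0 k) 4⟩
      have h3 : Filter.Tendsto t Filter.atTop (𝓝 (s * 0)) :=
        (tendsto_pow_atTop_nhds_zero_of_lt_one hκ0.le (by linarith)).const_mul s
      simpa using h3.pow 4
    have h4 := h1.comp h2
    refine h4.congr fun k => ?_
    simp [D, div_eq_inv_mul]
  have h5 := dist_le_of_le_geometric_of_tendsto₀ κ (C * s) (by linarith) hD hlim
  have h6 : C * s / (1 - κ) ≤ 8 * C * s := by
    rw [div_le_iff₀ (by linarith)]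
    have : 0 ≤ C * s := by positivity
    nlinarith
  have h7 : |D 0| = |φ (s ^ 4) - φ 0| / s ^ 4 := by
    simp [D, t, abs_div, abs_of_pos hs]
  rw [Real.dist_eq] at h5
  have h8 := abs_sub_abs_le_abs_sub d (D 0)
  rw [abs_sub_comm d] at h8
  linarith

/-- Interpolation: a small solution of Poisson's equation with tangentially Hölder continuous
right-hand side and bounded tangential second derivatives has small mixed second derivatives. -/
lemma small_second_deriv (n : ℕ) {δ K σ : ℝ} (hδ : 0 < δ) (hδ1 : δ ≤ 1) (hK : 0 < K)
    (hσ : 0 < σ) : ∃ μ > 0, ∀ (z : EuclideanSpace ℝ (Fin n)) (R : ℝ) (m : Fin n) (c : ℝ)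
      (w : EuclideanSpace ℝ (Fin n) → ℝ) (a : Fin n), a ≠ m →
      ContDiffOn ℝ ∞ w (Dom z R m c) → (∀ y ∈ Dom z R m c, |w y| ≤ μ) →
      (∀ y ∈ Dom z R m c, |pd a (pd a w) y| ≤ 1) → (∀ y ∈ Dom z R m c, |lap w y| ≤ K) →
      (∀ y ∈ Dom z (R - δ) m c, ∀ s, 0 < s → s ≤ δ →
        |lap w (y + s ^ 2 • EuclideanSpace.single a (1 : ℝ)) - lap w y| ≤ K * s) →
      LinVanish m c (Dom z R m c) w →
      ∀ x ∈ Dom z (R - 3 * δ) m c, ∀ j, |pd a (pd j w) x| ≤ σ := by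
  have hg := gradConst_ge n
  set C := gradConst n * (1 + 2 * K) with hC
  have hC0 : 0 < C := by positivity
  set s₀ := min (δ / 2) (σ / (16 * C)) with hs₀
  have hs₀0 : 0 < s₀ := by positivity
  set ν := min δ (s₀ ^ 4 * σ / (4 * (gradConst n * (1 + K)))) with hν
  have hG0 : 0 < gradConst n * (1 + K) := by positivity
  have hν0 : 0 < ν := by positivity
  have hνδ : ν ≤ δ := min_le_left _ _
  refine ⟨ν ^ 2, by positivity, fun z R m c w a ha hw hS h2 hF hH hBC x hx j => ?_⟩
  have hDo : IsOpen (Dom z R m c) := isOpen_dom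
  have hgrad : ∀ y ∈ Dom z (R - δ) m c, |pd j w y| ≤ gradConst n * (1 + K) * ν := by
    intro y hy
    refine (grad_le_of_mem hν0 hK hw hS hF hBC hy (by linarith) j).trans (le_of_eq ?_)
    field_simp
  have hx2 : x ∈ Dom z (R - 2 * δ) m c := dom_mono (by linarith) hx
  have hxR : x ∈ Dom z R m c := dom_mono (by linarith) hx
  have hx0 : x + (0 : ℝ) • EuclideanSpace.single a (1 : ℝ) = x := by simp
  have hd := hasDerivAt_line hDo (smooth_pd hDo hw j) a 0 (by rwa [hx0])
  rw [hx0] at hd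
  have key := deriv_le_of_second_difference (C := C) (s := s₀) hd hC0.le hs₀0 ?_
  · refine key.trans ?_
    have hs₀δ : s₀ ≤ δ / 2 := min_le_left _ _
    have h4 : s₀ ^ 4 ≤ δ := by
      have : s₀ ^ 4 ≤ s₀ ^ 1 := pow_le_pow_of_le_one hs₀0.le (by linarith) (by norm_num)
      rw [pow_one] at this
      linarith
    have b1 := hgrad _ (dom_add' (t := s₀ ^ 4) (i := a) (R := R - δ) (δ := δ) hx2
      (by rwa [abs_of_pos (by positivity)]) (by linarith) (Or.inl ha))
    have b2 := hgrad x (dom_mono (by linarith) hx)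
    have b3 : |pd j w (x + s₀ ^ 4 • EuclideanSpace.single a (1 : ℝ)) -
        pd j w (x + (0 : ℝ) • EuclideanSpace.single a (1 : ℝ))| / s₀ ^ 4 ≤ σ / 2 := by
      rw [hx0, div_le_iff₀ (by positivity)]
      refine (abs_sub _ _).trans ((add_le_add b1 b2).trans ?_)
      have : ν ≤ s₀ ^ 4 * σ / (4 * (gradConst n * (1 + K))) := min_le_right _ _
      rw [le_div_iff₀ (by positivity)] at this
      linarith
    have b4 : 8 * C * s₀ ≤ σ / 2 := by
      have : s₀ ≤ σ / (16 * C) := min_le_right _ _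
      rw [le_div_iff₀ (by positivity)] at this
      linarith
    linarith
  · intro s hs hss
    have hsδ : s ≤ δ / 2 := hss.trans (min_le_left _ _)
    have p4 : s ^ 4 ≤ s ^ 1 := pow_le_pow_of_le_one hs.le (by linarith) (by norm_num)
    have p3 : s ^ 3 ≤ s ^ 1 := pow_le_pow_of_le_one hs.le (by linarith) (by norm_num)
    have p2 : s ^ 2 ≤ s ^ 1 := pow_le_pow_of_le_one hs.le (by linarith) (by norm_num)
    rw [pow_one] at p2 p3 p4
    set e := s ^ 4 • EuclideanSpace.single a (1 : ℝ) with he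
    have a4 : |s ^ 4| ≤ δ / 2 := by
      rw [abs_of_pos (by positivity)]
      linarith
    have m1 : ∀ R' : ℝ, ∀ y ∈ Dom z R' m c, ∀ t ∈ Set.Icc 0 (s ^ 4),
        y + t • EuclideanSpace.single a (1 : ℝ) ∈ Dom z (R' + δ / 2) m c := fun R' y hy t ht =>
      dom_add' hy (by rw [abs_of_nonneg ht.1]; linarith [ht.2]) le_rfl (Or.inl ha)
    have h4m : s ^ 4 ∈ Set.Icc 0 (s ^ 4) := Set.right_mem_Icc.2 (by positivity)
    have hsub1 : Dom z (R - δ / 2) m c ⊆ Dom z R m c := dom_mono (by linarith)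
    have hsub2 : Dom z (R - δ) m c ⊆ Dom z (R - δ / 2) m c := dom_mono (by linarith)
    have sh1 : ∀ y ∈ Dom z (R - δ / 2) m c, y + e ∈ Dom z R m c := fun y hy =>
      dom_mono (by linarith) (m1 _ y hy _ h4m)
    have sh2 : ∀ y ∈ Dom z (R - δ) m c, y + e ∈ Dom z (R - δ / 2) m c := fun y hy =>
      dom_mono (by linarith) (m1 _ y hy _ h4m)
    let h : EuclideanSpace ℝ (Fin n) → ℝ := fun y => w (y + e) - w y
    let W : EuclideanSpace ℝ (Fin n) → ℝ := fun y => h (y + e) - h y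
    have sw1 := smooth_shift hw sh1
    have sh : ContDiffOn ℝ ∞ h (Dom z (R - δ / 2) m c) := sw1.sub (hw.mono hsub1)
    have sH1 := smooth_shift sh sh2
    have sW : ContDiffOn ℝ ∞ W (Dom z (R - δ) m c) := sH1.sub (sh.mono hsub2)
    have pdh : ∀ y ∈ Dom z (R - δ / 2) m c, ∀ i, pd i h y = pd i w (y + e) - pd i w y := by
      intro y hy i
      rw [pd_sub isOpen_dom sw1 (hw.mono hsub1) hy, pd_shift]
    have pdW : ∀ y ∈ Dom z (R - δ) m c, ∀ i, pd i W y = pd i h (y + e) - pd i h y := by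
      intro y hy i
      rw [pd_sub isOpen_dom sH1 (sh.mono hsub2) hy, pd_shift]
    have bh : ∀ y ∈ Dom z (R - δ / 2) m c, |pd a h y| ≤ s ^ 4 := by
      intro y hy
      rw [pdh y hy]
      have := abs_shift_sub_le (f := pd a w) (A := 1) (η := s ^ 4) (x := y) hDo
        (smooth_pd hDo hw a)
        (by positivity) (fun t ht => dom_mono (by linarith) (m1 _ y hy t ht))
        (fun t ht => h2 _ (dom_mono (by linarith) (m1 _ y hy t ht)))
      simpa using this
    have bW : ∀ y ∈ Dom z (R - δ) m c, |W y| ≤ s ^ 8 := by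
      intro y hy
      have := abs_shift_sub_le (f := h) (A := s ^ 4) (η := s ^ 4) (x := y)
        (isOpen_dom (z := z) (R := R - δ / 2) (m := m) (c := c)) sh
        (by positivity) (fun t ht => dom_mono (by linarith) (m1 _ y hy t ht))
        (fun t ht => bh _ (dom_mono (by linarith) (m1 _ y hy t ht)))
      exact this.trans (le_of_eq (by ring))
    have lh : ∀ y ∈ Dom z (R - δ / 2) m c, lap h y = lap w (y + e) - lap w y := by
      intro y hy
      rw [lap_sub isOpen_dom sw1 (hw.mono hsub1) hy, lap_shift]
    have lW : ∀ y ∈ Dom z (R - 2 * δ) m c, |lap W y| ≤ 2 * K * s ^ 2 := by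
      intro y hy
      have hy1 : y ∈ Dom z (R - δ) m c := dom_mono (by linarith) hy
      rw [lap_sub isOpen_dom sH1 (sh.mono hsub2) hy1, lap_shift]
      beta_reduce
      rw [lh y (hsub2 hy1), lh _ (sh2 y hy1)]
      have e1 : e = (s ^ 2) ^ 2 • EuclideanSpace.single a (1 : ℝ) := by
        rw [he, ← pow_mul]
      have q1 := hH y hy1 (s ^ 2) (by positivity) (by linarith)
      have q2 := hH (y + e) (dom_mono (by linarith) (m1 _ y hy _ h4m)) (s ^ 2) (by positivity)
        (by linarith)
      rw [← e1] at q1 q2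
      have q3 := abs_sub (lap w (y + e + e) - lap w (y + e)) (lap w (y + e) - lap w y)
      linarith
    have hsub3 : Dom z (R - 2 * δ) m c ⊆ Dom z (R - δ) m c := dom_mono (by linarith)
    have bc1 : LinVanish m c (Dom z (R - δ / 2) m c) h := hBC.shift_sub ha hsub1 sh1
    have bc2 : LinVanish m c (Dom z (R - δ) m c) W := bc1.shift_sub ha hsub2 sh2
    have fin := grad_le_of_mem (w := W) (S := s ^ 8) (F := 2 * K * s ^ 2) (r := s ^ 3)
      (R := R - 2 * δ) (x := x) (by positivity) (by positivity) (sW.mono hsub3)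
      (fun y hy => bW y (hsub3 hy)) lW
      (by
        obtain ⟨K', hK'⟩ := bc2
        exact ⟨K', fun y hy => hK' y (hsub3 hy)⟩) hx (by linarith) j
    have hx1 : x ∈ Dom z (R - δ) m c := hsub3 hx2
    rw [pdW x hx1, pdh x (hsub2 hx1), pdh _ (sh2 x hx1)] at fin
    have e2 : x + e + e = x + (2 * s ^ 4) • EuclideanSpace.single a (1 : ℝ) := by
      rw [he, add_assoc, ← two_smul ℝ, smul_smul]
    rw [e2] at fin
    rw [hx0]
    have e3 : gradConst n * (s ^ 8 / s ^ 3 + s ^ 3 * (2 * K * s ^ 2)) = C * s ^ 5 := by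
      rw [hC]
      field_simp
    rw [e3] at fin
    refine le_trans (le_of_eq ?_) fin
    congr 1
    ring

end Differences

section Solutions

variable {n : ℕ} {D : Set (EuclideanSpace ℝ (Fin n))} {x z : EuclideanSpace ℝ (Fin n)}
  {v : Fin n → EuclideanSpace ℝ (Fin n) → ℝ} {q : EuclideanSpace ℝ (Fin n) → ℝ} {ε R c : ℝ}
  {m : Fin n}

/-- The convective term of the Navier-Stokes equations, with coefficient `ε`. -/
noncomputable def conv (ε : ℝ) (v : Fin n → EuclideanSpace ℝ (Fin n) → ℝ) (j : Fin n) :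
    EuclideanSpace ℝ (Fin n) → ℝ :=
  fun x => ε * ∑ i, v i x * pd i (v j) x

/-- The right-hand side of the pressure equation. -/
noncomputable def pressureSource (ε : ℝ) (v : Fin n → EuclideanSpace ℝ (Fin n) → ℝ) :
    EuclideanSpace ℝ (Fin n) → ℝ :=
  fun x => -ε * ∑ j, ∑ i, pd j (v i) x * pd i (v j) x

/-- Smooth solutions of the steady Navier-Stokes equations with convection coefficient `ε`. -/
structure IsSol (ε : ℝ) (v : Fin n → EuclideanSpace ℝ (Fin n) → ℝ)
    (q : EuclideanSpace ℝ (Fin n) → ℝ) (D : Set (EuclideanSpace ℝ (Fin n))) : Prop where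
  smooth_v : ∀ k, ContDiffOn ℝ ∞ (v k) D
  smooth_q : ContDiffOn ℝ ∞ q D
  eq : ∀ x ∈ D, ∀ j, lap (v j) x = conv ε v j x + pd j q x
  div : ∀ x ∈ D, ∑ i, pd i (v i) x = 0

lemma IsSol.mono {D' : Set (EuclideanSpace ℝ (Fin n))} (h : IsSol ε v q D) (hD : D' ⊆ D) :
    IsSol ε v q D' :=
  ⟨fun k => (h.smooth_v k).mono hD, h.smooth_q.mono hD, fun x hx => h.eq x (hD hx),
    fun x hx => h.div x (hD hx)⟩

lemma IsSol.sub_const (h : IsSol ε v q D) (hD : IsOpen D) (a : ℝ) :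
    IsSol ε v (fun y => q y - a) D :=
  ⟨h.smooth_v, h.smooth_q.sub contDiffOn_const, fun x hx j => by
    rw [h.eq x hx, pd_sub hD h.smooth_q contDiffOn_const hx, pd_const, sub_zero], h.div⟩

lemma IsSol.smooth_conv (h : IsSol ε v q D) (hD : IsOpen D) (j : Fin n) :
    ContDiffOn ℝ ∞ (conv ε v j) D :=
  contDiffOn_const.mul (ContDiffOn.sum fun i _ =>
    (h.smooth_v i).mul (smooth_pd hD (h.smooth_v j) i))

lemma IsSol.smooth_pressureSource (h : IsSol ε v q D) (hD : IsOpen D) :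
    ContDiffOn ℝ ∞ (pressureSource ε v) D :=
  contDiffOn_const.mul (ContDiffOn.sum fun j _ => ContDiffOn.sum fun i _ =>
    (smooth_pd hD (h.smooth_v i) j).mul (smooth_pd hD (h.smooth_v j) i))

lemma IsSol.pd_conv (h : IsSol ε v q D) (hD : IsOpen D) (hx : x ∈ D) (k j : Fin n) :
    pd k (conv ε v j) x
      = ε * ∑ i, (pd k (v i) x * pd i (v j) x + v i x * pd k (pd i (v j)) x) := by
  have s : ∀ i ∈ Finset.univ, ContDiffOn ℝ ∞ (fun y => v i y * pd i (v j) y) D := fun i _ =>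
    (h.smooth_v i).mul (smooth_pd hD (h.smooth_v j) i)
  unfold conv
  rw [pd_const_mul hD (ContDiffOn.sum s) hx, pd_sum _ hD s hx]
  congr 1
  exact Finset.sum_congr rfl fun i _ =>
    pd_mul hD (h.smooth_v i) (smooth_pd hD (h.smooth_v j) i) hx k

lemma IsSol.pd_pressureSource (h : IsSol ε v q D) (hD : IsOpen D) (hx : x ∈ D) (k : Fin n) :
    pd k (pressureSource ε v) x
      = -ε * ∑ j, ∑ i, (pd k (pd j (v i)) x * pd i (v j) x
        + pd j (v i) x * pd k (pd i (v j)) x) := by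
  have s : ∀ j, ∀ i ∈ Finset.univ, ContDiffOn ℝ ∞ (fun y => pd j (v i) y * pd i (v j) y) D :=
    fun j i _ => (smooth_pd hD (h.smooth_v i) j).mul (smooth_pd hD (h.smooth_v j) i)
  unfold pressureSource
  rw [pd_const_mul hD (ContDiffOn.sum fun j _ => ContDiffOn.sum (s j)) hx,
    pd_sum _ hD (fun j _ => ContDiffOn.sum (s j)) hx]
  congr 1
  refine Finset.sum_congr rfl fun j _ => ?_
  rw [pd_sum _ hD (s j) hx]
  exact Finset.sum_congr rfl fun i _ =>
    pd_mul hD (smooth_pd hD (h.smooth_v i) j) (smooth_pd hD (h.smooth_v j) i) hx k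

lemma IsSol.lap_pressure (h : IsSol ε v q D) (hD : IsOpen D) (hx : x ∈ D) :
    lap q x = pressureSource ε v x := by
  have e1 : ∀ j, pd j (pd j q) x = lap (pd j (v j)) x - pd j (conv ε v j) x := by
    intro j
    have : Set.EqOn (pd j q) (fun y => lap (v j) y - conv ε v j y) D := fun y hy => by
      simp only [h.eq y hy j]
      ring
    rw [pd_congr hD this hx, pd_sub hD (smooth_lap hD (h.smooth_v j)) (h.smooth_conv hD j) hx,
      lap_pd hD (h.smooth_v j) hx]
  have e2 : ∑ j, lap (pd j (v j)) x = 0 := by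
    rw [← lap_sum _ hD (fun j _ => smooth_pd hD (h.smooth_v j) j) hx,
      lap_congr hD (g := fun _ => 0) (fun y hy => h.div y hy) hx]
    refine Finset.sum_eq_zero fun i _ => ?_
    rw [pd_congr hD (g := fun _ => 0) (fun y _ => pd_const 0 i) hx, pd_const]
  have e3 : ∑ j, ∑ i, v i x * pd j (pd i (v j)) x = 0 := by
    rw [Finset.sum_comm]
    refine Finset.sum_eq_zero fun i _ => ?_
    rw [← Finset.mul_sum]
    have : ∑ j, pd j (pd i (v j)) x = 0 := by
      rw [Finset.sum_congr rfl fun j _ => pd_comm hD (h.smooth_v j) hx j i,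
        ← pd_sum _ hD (fun j _ => smooth_pd hD (h.smooth_v j) j) hx,
        pd_congr hD (g := fun _ => 0) (fun y hy => h.div y hy) hx, pd_const]
    rw [this, mul_zero]
  unfold lap
  simp_rw [e1]
  rw [Finset.sum_sub_distrib, e2, zero_sub]
  simp_rw [h.pd_conv hD hx]
  rw [← Finset.mul_sum]
  simp_rw [Finset.sum_add_distrib]
  rw [e3, add_zero, pressureSource]
  ring

lemma abs_sum_le_card_mul {F : Fin n → ℝ} {A : ℝ} (h : ∀ i, |F i| ≤ A) :
    |∑ i, F i| ≤ n * A := by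
  refine (Finset.abs_sum_le_sum_abs _ _).trans ((Finset.sum_le_sum fun i _ => h i).trans ?_)
  simp

/-- A solution of size `ν` whose second derivatives are at most one. -/
structure IsSmallSol (ε ν : ℝ) (v : Fin n → EuclideanSpace ℝ (Fin n) → ℝ)
    (q : EuclideanSpace ℝ (Fin n) → ℝ) (D : Set (EuclideanSpace ℝ (Fin n))) : Prop
    extends IsSol ε v q D where
  ε_nonneg : 0 ≤ ε
  ε_le : ε ≤ 1
  bound : ∀ x ∈ D, ∀ k, |v k x| ≤ ν
  second : ∀ x ∈ D, ∀ i j k, |pd i (pd j (v k)) x| ≤ 1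

lemma IsSmallSol.mono {ν : ℝ} {D' : Set (EuclideanSpace ℝ (Fin n))} (h : IsSmallSol ε ν v q D)
    (hD : D' ⊆ D) : IsSmallSol ε ν v q D' :=
  ⟨h.toIsSol.mono hD, h.ε_nonneg, h.ε_le, fun x hx => h.bound x (hD hx),
    fun x hx => h.second x (hD hx)⟩

lemma IsSmallSol.first_le {ν R' r : ℝ} (h : IsSmallSol ε ν v q (Dom z R m c))
    (hr : 0 < r) (hR : R' + r ≤ R) (hx : x ∈ Dom z R' m c) (i k : Fin n) :
    |pd i (v k) x| ≤ 2 * ν / r + r := by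
  have hseg : ∀ t ∈ Set.Icc 0 r, x + t • EuclideanSpace.single i (1 : ℝ) ∈ Dom z R m c :=
    fun t ht => dom_add' (δ := r) hx (by rw [abs_of_nonneg ht.1]; exact ht.2) hR (Or.inr ht.1)
  have h1 := abs_shift_sub_linear_le (A := 1) isOpen_dom (h.smooth_v k) hr.le hseg
    (fun t ht => h.second _ (hseg t ht) i i k)
  have h2 := h.bound _ (hseg r (Set.right_mem_Icc.2 hr.le)) k
  have h3 := h.bound x (dom_mono (by linarith) hx) k
  have h4 : |r * pd i (v k) x| ≤ 2 * ν + r * r := by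
    rw [abs_le] at *
    constructor <;> linarith [h1.1, h1.2, h2.1, h2.2, h3.1, h3.2]
  rw [abs_mul, abs_of_pos hr] at h4
  rw [show 2 * ν / r + r = (2 * ν + r * r) / r by field_simp, le_div_iff₀ hr]
  linarith

/-- The constant bounding all auxiliary quantities attached to a small solution. -/
noncomputable def auxConst (n : ℕ) : ℝ := 200 * n ^ 2

/-- Bounds for the auxiliary quantities attached to a small solution. -/
structure AuxBounds (K ν : ℝ) (ε : ℝ) (v : Fin n → EuclideanSpace ℝ (Fin n) → ℝ)
    (q : EuclideanSpace ℝ (Fin n) → ℝ) (D : Set (EuclideanSpace ℝ (Fin n))) : Prop where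
  conv_le : ∀ x ∈ D, ∀ j, |conv ε v j x| ≤ K * ν
  pd_conv_le : ∀ x ∈ D, ∀ i j, |pd i (conv ε v j) x| ≤ K
  source_le : ∀ x ∈ D, |pressureSource ε v x| ≤ K
  pd_source_le : ∀ x ∈ D, ∀ i, |pd i (pressureSource ε v) x| ≤ K
  pressure_le : ∀ x ∈ D, |q x| ≤ K
  pd_pressure_le : ∀ x ∈ D, ∀ i, |pd i q x| ≤ K

lemma IsSmallSol.exists_auxBounds {ν : ℝ} (hn : 1 ≤ n) (hν : ν ≤ 1) (hν0 : 0 ≤ ν)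
    (h : IsSmallSol ε ν v q (Dom z 1 m c)) :
    ∃ a, AuxBounds (auxConst n) ν ε v (fun y => q y - a) (Dom z (3 / 4) m c) := by
  have hn' : (1 : ℝ) ≤ n := by exact_mod_cast hn
  have hnn : (n : ℝ) ≤ n ^ 2 := by nlinarith
  have hn2 : (1 : ℝ) ≤ n ^ 2 := hn'.trans hnn
  have hsub : Dom z (3 / 4) m c ⊆ Dom z 1 m c := dom_mono (by norm_num)
  have hO : IsOpen (Dom z 1 m c) := isOpen_dom
  have hO' : IsOpen (Dom z (3 / 4) m c) := isOpen_dom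
  have h1 : ∀ x ∈ Dom z (3 / 4) m c, ∀ i k, |pd i (v k) x| ≤ 9 := fun x hx i k => by
    have := h.first_le (r := 1 / 4) (by norm_num) (by norm_num) hx i k
    norm_num at this
    linarith
  have hε := abs_of_nonneg h.ε_nonneg
  have hmul : ∀ {a b A B : ℝ}, |a| ≤ A → |b| ≤ B → |a * b| ≤ A * B := fun {a b A B} ha hb => by
    rw [abs_mul]
    exact mul_le_mul ha hb (abs_nonneg _) ((abs_nonneg _).trans ha)
  have hadd : ∀ {a b A B : ℝ}, |a| ≤ A → |b| ≤ B → |a + b| ≤ A + B := fun {a b A B} ha hb =>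
    (abs_add_le _ _).trans (add_le_add ha hb)
  have hεm : ∀ {a A : ℝ}, |a| ≤ A → |ε * a| ≤ A := fun {a A} ha => by
    have := hmul (hε.le.trans h.ε_le) ha
    rwa [one_mul] at this
  have hεm' : ∀ {a A : ℝ}, |a| ≤ A → |-ε * a| ≤ A := fun {a A} ha => by
    rw [neg_mul, abs_neg]
    exact hεm ha
  have bconv : ∀ x ∈ Dom z (3 / 4) m c, ∀ j, |conv ε v j x| ≤ 9 * n * ν := fun x hx j => by
    have := hεm (abs_sum_le_card_mul fun i => hmul (h.bound x (hsub hx) i) (h1 x hx i j))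
    exact this.trans (le_of_eq (by ring))
  have bq1 : ∀ x ∈ Dom z (3 / 4) m c, ∀ i, |pd i q x| ≤ 10 * n := by
    intro x hx i
    have e : pd i q x = lap (v i) x - conv ε v i x := by
      rw [h.eq x (hsub hx)]
      ring
    rw [e]
    have b1 : |lap (v i) x| ≤ n * 1 :=
      abs_sum_le_card_mul fun k => h.second x (hsub hx) k k i
    have b2 := bconv x hx i
    have b3 := abs_sub (lap (v i) x) (conv ε v i x)
    nlinarith
  obtain ⟨a, ha⟩ : ∃ a, ∀ x ∈ Dom z (3 / 4) m c, |q x - a| ≤ 15 * n ^ 2 := by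
    rcases (Dom z (3 / 4) m c).eq_empty_or_nonempty with he | ⟨p, hp⟩
    · exact ⟨0, fun x hx => by simp [he] at hx⟩
    · refine ⟨q p, fun x hx => ?_⟩
      have := convex_dom.norm_image_sub_le_of_norm_fderiv_le (𝕜 := ℝ) (f := q)
        (C := n * (10 * n))
        (fun y hy => differentiableAt_of_smooth hO h.smooth_q (hsub hy))
        (fun y hy => (norm_fderiv_le_sum_pd q y).trans
          ((Finset.sum_le_sum fun i _ => bq1 y hy i).trans (by simp))) hp hx
      have h4 : ‖x - p‖ ≤ 3 / 2 := by
        have h5 := norm_sub_le (x - z) (p - z)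
        rw [sub_sub_sub_cancel_right] at h5
        linarith [hx.1, hp.1]
      rw [Real.norm_eq_abs] at this
      refine this.trans ((mul_le_mul_of_nonneg_left h4 (by positivity)).trans (le_of_eq ?_))
      ring
  refine ⟨a, ⟨?_, ?_, ?_, ?_, ?_, ?_⟩⟩
  · intro x hx j
    refine (bconv x hx j).trans (mul_le_mul_of_nonneg_right ?_ hν0)
    unfold auxConst
    linarith
  · intro x hx i j
    rw [h.pd_conv hO (hsub hx)]
    refine (hεm (abs_sum_le_card_mul fun k => hadd (hmul (h1 x hx i k) (h1 x hx k j))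
      (hmul (h.bound x (hsub hx) k) (h.second x (hsub hx) i k j)))).trans ?_
    unfold auxConst
    nlinarith
  · intro x hx
    refine (hεm' (abs_sum_le_card_mul fun j => abs_sum_le_card_mul fun i =>
      hmul (h1 x hx j i) (h1 x hx i j))).trans ?_
    unfold auxConst
    nlinarith
  · intro x hx k
    rw [h.pd_pressureSource hO (hsub hx)]
    refine (hεm' (abs_sum_le_card_mul fun j => abs_sum_le_card_mul fun i =>
      hadd (hmul (h.second x (hsub hx) k j i) (h1 x hx i j))
        (hmul (h1 x hx j i) (h.second x (hsub hx) k i j)))).trans ?_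
    unfold auxConst
    nlinarith
  · intro x hx
    refine (ha x hx).trans ?_
    unfold auxConst
    linarith
  · intro x hx i
    rw [pd_sub hO h.smooth_q contDiffOn_const (hsub hx), pd_const, sub_zero]
    refine (bq1 x hx i).trans ?_
    unfold auxConst
    linarith

end Solutions

section Interior

variable {n : ℕ} {D : Set (EuclideanSpace ℝ (Fin n))} {x z : EuclideanSpace ℝ (Fin n)}
  {v : Fin n → EuclideanSpace ℝ (Fin n) → ℝ} {q : EuclideanSpace ℝ (Fin n) → ℝ} {ε ν R c : ℝ}
  {m : Fin n}

lemma LinVanish.mono {D' : Set (EuclideanSpace ℝ (Fin n))} {w : EuclideanSpace ℝ (Fin n) → ℝ}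
    (h : LinVanish m c D w) (hD : D' ⊆ D) : LinVanish m c D' w := by
  obtain ⟨K, hK⟩ := h
  exact ⟨K, fun y hy => hK y (hD hy)⟩

lemma auxConst_pos (hn : 1 ≤ n) : 0 < auxConst n := by
  have : (0 : ℝ) < n := by exact_mod_cast hn
  unfold auxConst
  positivity

lemma mixed_second_deriv_small (hn : 1 ≤ n) {K σ : ℝ} (hK : 0 < K) (hσ : 0 < σ) :
    ∃ μ > 0, ∀ (z : EuclideanSpace ℝ (Fin n)) (m : Fin n) (c ε ν : ℝ)
      (v : Fin n → EuclideanSpace ℝ (Fin n) → ℝ) (q : EuclideanSpace ℝ (Fin n) → ℝ) (a : Fin n),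
      ν ≤ μ → a ≠ m → IsSmallSol ε ν v q (Dom z (3 / 4) m c) →
      AuxBounds (auxConst n) ν ε v q (Dom z (3 / 4) m c) →
      (∀ k, LinVanish m c (Dom z (3 / 4) m c) (v k)) →
      (∀ x ∈ Dom z (9 / 16) m c, ∀ s, 0 < s → s ≤ 1 / 16 → ∀ j,
        |pd j q (x + s ^ 2 • EuclideanSpace.single a (1 : ℝ)) - pd j q x| ≤ K * s) →
      ∀ x ∈ Dom z (7 / 16) m c, ∀ j k, |pd a (pd j (v k)) x| ≤ σ := by
  have hA := auxConst_pos hn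
  obtain ⟨μ, hμ, H⟩ := small_second_deriv n (δ := 1 / 16) (K := n + auxConst n + K)
    (by norm_num) (by norm_num) (by positivity) hσ
  refine ⟨μ, hμ, fun z m c ε ν v q a hν ha h hb hBC hq x hx j k => ?_⟩
  have hsub : Dom z (5 / 8) m c ⊆ Dom z (3 / 4) m c := dom_mono (by norm_num)
  refine H z (5 / 8) m c (v k) a ha ((h.smooth_v k).mono hsub)
    (fun y hy => (h.bound y (hsub hy) k).trans hν) (fun y hy => h.second y (hsub hy) a a k)
    (fun y hy => ?_) (fun y hy s hs hsδ => ?_) ((hBC k).mono hsub) x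
    (dom_mono (by norm_num) hx) j
  · refine (abs_sum_le_card_mul fun i => h.second y (hsub hy) i i k).trans ?_
    linarith
  · have hy' : y ∈ Dom z (9 / 16) m c := dom_mono (by norm_num) hy
    have hs2 : s ^ 2 ≤ 1 / 16 := by nlinarith
    have hss : s ^ 2 ≤ s := by nlinarith
    have hseg : ∀ t ∈ Set.Icc 0 (s ^ 2),
        y + t • EuclideanSpace.single a (1 : ℝ) ∈ Dom z (3 / 4) m c := fun t ht =>
      dom_add' (δ := 1 / 16) hy' (by rw [abs_of_nonneg ht.1]; exact ht.2.trans hs2)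
        (by norm_num) (Or.inl ha)
    have h0 : y ∈ Dom z (3 / 4) m c := dom_mono (by norm_num) hy'
    have h1 := hseg _ (Set.right_mem_Icc.2 (by positivity))
    rw [h.eq y h0, h.eq _ h1]
    have b1 := abs_shift_sub_le (f := conv ε v k) (A := auxConst n) isOpen_dom
      (h.smooth_conv isOpen_dom k) (by positivity) hseg
      (fun t ht => hb.pd_conv_le _ (hseg t ht) a k)
    have b2 := hq y hy' s hs hsδ k
    have b3 := abs_add_le
      (conv ε v k (y + s ^ 2 • EuclideanSpace.single a (1 : ℝ)) - conv ε v k y)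
      (pd k q (y + s ^ 2 • EuclideanSpace.single a (1 : ℝ)) - pd k q y)
    have b4 : auxConst n * s ^ 2 ≤ auxConst n * s := mul_le_mul_of_nonneg_left hss hA.le
    have b5 : 0 ≤ (n : ℝ) * s := by positivity
    rw [add_sub_add_comm]
    nlinarith

lemma dom_eq_ball (hR : R ≤ 1) : Dom z R m (z m - 2) = Metric.ball z R := by
  ext y
  rw [mem_ball_iff_norm]
  refine ⟨fun h => h.1, fun h => ⟨h, ?_⟩⟩
  have h1 : |y m - z m| ≤ ‖y - z‖ := by simpa using PiLp.norm_apply_le (y - z) m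
  have h2 := neg_abs_le (y m - z m)
  linarith

lemma linVanish_of_bounded {w : EuclideanSpace ℝ (Fin n) → ℝ} {S : ℝ} (hR : R ≤ 1)
    (hS : ∀ y ∈ Dom z R m (z m - 2), |w y| ≤ S) :
    LinVanish m (z m - 2) (Dom z R m (z m - 2)) w := by
  refine ⟨S, fun y hy => (hS y hy).trans ?_⟩
  have h0 : 0 ≤ S := (abs_nonneg _).trans (hS y hy)
  have h1 : |y m - z m| ≤ ‖y - z‖ := by simpa using PiLp.norm_apply_le (y - z) m
  have h2 := neg_abs_le (y m - z m)
  have h3 := hy.1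
  nlinarith

lemma holderConst_pos (n : ℕ) {δ : ℝ} (hδ : 0 < δ) : 0 < holderConst n δ := by
  have := gradConst_ge n
  unfold holderConst
  positivity

/-- Small interior solutions have small second derivatives. -/
lemma second_deriv_small_interior (hn : 2 ≤ n) {σ : ℝ} (hσ : 0 < σ) :
    ∃ μ > 0, ∀ (z : EuclideanSpace ℝ (Fin n)) (ε : ℝ)
      (v : Fin n → EuclideanSpace ℝ (Fin n) → ℝ) (q : EuclideanSpace ℝ (Fin n) → ℝ),
      IsSmallSol ε μ v q (Metric.ball z 1) → ∀ i j k, |pd i (pd j (v k)) z| ≤ σ := by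
  have hA := auxConst_pos (n := n) (by omega)
  have hH := holderConst_pos n (δ := 1 / 16) (by norm_num)
  obtain ⟨μ, hμ, H⟩ := mixed_second_deriv_small (n := n) (by omega)
    (K := holderConst n (1 / 16) * auxConst n) (by positivity) hσ
  refine ⟨min μ 1, by positivity, fun z ε v q h i j k => ?_⟩
  obtain ⟨m, hm⟩ : ∃ m : Fin n, i ≠ m := by
    have : Nontrivial (Fin n) := Fin.nontrivial_iff_two_le.2 hn
    obtain ⟨m, hm⟩ := exists_ne i
    exact ⟨m, hm.symm⟩
  rw [← dom_eq_ball (m := m) le_rfl] at h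
  have hz : z ∈ Dom z (7 / 16) m (z m - 2) := ⟨by simp, by linarith⟩
  obtain ⟨a, hb⟩ := h.exists_auxBounds (by omega) (min_le_right _ _) (by positivity)
  have hsub : Dom z (3 / 4) m (z m - 2) ⊆ Dom z 1 m (z m - 2) := dom_mono (by norm_num)
  have h' : IsSmallSol ε (min μ 1) v (fun y => q y - a) (Dom z (3 / 4) m (z m - 2)) :=
    ⟨(h.toIsSol.mono hsub).sub_const isOpen_dom a, h.ε_nonneg, h.ε_le,
      fun x hx => h.bound x (hsub hx), fun x hx => h.second x (hsub hx)⟩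
  refine H z m (z m - 2) ε (min μ 1) v _ i (min_le_left _ _) hm h' hb
    (fun k => linVanish_of_bounded (by norm_num) fun y hy => h'.bound y hy k)
    (fun x hx s hs hsδ j => ?_) z hz j k
  exact grad_tangential_holder hm (by norm_num) (by norm_num) hA h'.smooth_q hb.pressure_le
    (fun y hy => by rw [h'.lap_pressure isOpen_dom hy]; exact hb.source_le y hy)
    (linVanish_of_bounded (by norm_num) hb.pressure_le) hs hsδ (dom_mono (by norm_num) hx) j

end Interior

section Boundary

variable {n : ℕ} {x z : EuclideanSpace ℝ (Fin n)}
  {v : Fin n → EuclideanSpace ℝ (Fin n) → ℝ} {q : EuclideanSpace ℝ (Fin n) → ℝ} {ε ν R c : ℝ}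
  {m : Fin n}

/-- Moving vertically towards the flat boundary stays inside a half ball. -/
lemma dom_sub_vertical (hx : x ∈ Dom z R m (z m)) {t : ℝ} (ht : 0 ≤ t) (htx : t < x m - z m) :
    x + (-t) • EuclideanSpace.single m (1 : ℝ) ∈ Dom z R m (z m) := by
  refine ⟨lt_of_le_of_lt ?_ hx.1, ?_⟩
  · rw [EuclideanSpace.norm_eq, EuclideanSpace.norm_eq]
    refine Real.sqrt_le_sqrt (Finset.sum_le_sum fun k _ => ?_)
    have : (x + (-t) • EuclideanSpace.single m (1 : ℝ) - z) k
        = (x k + if k = m then -t else 0) - z k := by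
      rw [← add_smul_single_apply]
      rfl
    rw [this]
    simp only [PiLp.sub_apply, Real.norm_eq_abs, sq_abs]
    split_ifs with h
    · subst h
      nlinarith
    · simp
  · rw [add_smul_single_apply, if_pos rfl]
    linarith

/-- Tangential derivatives of a function vanishing on the flat boundary vanish there, too. -/
lemma tangential_deriv_le {w : EuclideanSpace ℝ (Fin n) → ℝ} {a : Fin n} (ha : a ≠ m)
    (hw : ContDiffOn ℝ ∞ w (Dom z 1 m (z m)))
    (h1 : ∀ y ∈ Dom z 1 m (z m), |pd m (pd a w) y| ≤ 1)
    (h2 : ∀ y ∈ Dom z 1 m (z m), |pd a (pd a w) y| ≤ 1)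
    (hBC : LinVanish m (z m) (Dom z 1 m (z m)) w) (hR : R < 1) (hx : x ∈ Dom z R m (z m)) :
    |pd a w x| ≤ x m - z m := by
  obtain ⟨K, hK⟩ := hBC
  have hO : IsOpen (Dom z 1 m (z m)) := isOpen_dom
  have main : ∀ s, 0 < s → s < 1 - R → s ^ 2 < x m - z m →
      |pd a w x| ≤ (x m - z m) + (2 * |K| + 1) * s := by
    intro s hs hsR hsx
    set t := x m - z m - s ^ 2 with ht
    have ht0 : 0 < t := by linarith
    set y := x + (-t) • EuclideanSpace.single m (1 : ℝ) with hy
    have hyD : y ∈ Dom z R m (z m) := dom_sub_vertical hx ht0.le (by rw [ht]; nlinarith)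
    have hym : y m - z m = s ^ 2 := by
      rw [hy, add_smul_single_apply, if_pos rfl, ht]
      ring
    have hseg : ∀ τ ∈ Set.Icc 0 s, y + τ • EuclideanSpace.single a (1 : ℝ) ∈ Dom z 1 m (z m) :=
      fun τ hτ => dom_add' (δ := s) hyD (by rw [abs_of_nonneg hτ.1]; exact hτ.2) (by linarith)
        (Or.inl ha)
    have b1 := abs_shift_sub_linear_le (A := 1) hO hw hs.le hseg (fun τ hτ => h2 _ (hseg τ hτ))
    have hKs : K * s ^ 2 ≤ |K| * s ^ 2 :=
      mul_le_mul_of_nonneg_right (le_abs_self K) (by positivity)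
    have b2 := hK y (dom_mono hR.le hyD)
    have b3 := hK _ (hseg s (Set.right_mem_Icc.2 hs.le))
    rw [add_smul_single_apply, if_neg ha.symm, add_zero] at b3
    rw [hym] at b2 b3
    have b4 : |s * pd a w y| ≤ s * ((2 * |K| + 1) * s) := by
      rw [abs_le] at *
      constructor <;> nlinarith [b1.1, b1.2, b2.1, b2.2, b3.1, b3.2]
    rw [abs_mul, abs_of_pos hs] at b4
    have b5 := le_of_mul_le_mul_left b4 hs
    have hyx : y + t • EuclideanSpace.single m (1 : ℝ) = x := by
      rw [hy, add_assoc, ← add_smul]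
      simp
    have hseg2 : ∀ τ ∈ Set.Icc 0 t, y + τ • EuclideanSpace.single m (1 : ℝ) ∈ Dom z 1 m (z m) := by
      intro τ hτ
      have e : y + τ • EuclideanSpace.single m (1 : ℝ)
          = x + (-(t - τ)) • EuclideanSpace.single m (1 : ℝ) := by
        rw [hy, add_assoc, ← add_smul]
        congr 2
        ring
      rw [e]
      exact dom_mono hR.le (dom_sub_vertical hx (by linarith [hτ.2])
        (by rw [ht]; nlinarith [hτ.1]))
    have b6 := abs_shift_sub_le (f := pd a w) (A := 1) hO (smooth_pd hO hw a) ht0.le hseg2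
      (fun τ hτ => h1 _ (hseg2 τ hτ))
    rw [hyx] at b6
    have b7 := abs_sub_abs_le_abs_sub (pd a w x) (pd a w y)
    nlinarith
  have hx0 : 0 < x m - z m := by linarith [hx.2]
  refine le_of_forall_pos_le_add fun e he => ?_
  set s := min (min ((1 - R) / 2) (min (1 / 2) ((x m - z m) / 2))) (e / (2 * |K| + 1)) with hs
  have hs0 : 0 < s := by
    have : 0 < 1 - R := by linarith
    positivity
  have e1 : s ≤ (1 - R) / 2 := (min_le_left _ _).trans (min_le_left _ _)
  have e2 : s ≤ 1 / 2 := (min_le_left _ _).trans ((min_le_right _ _).trans (min_le_left _ _))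
  have e3 : s ≤ (x m - z m) / 2 :=
    (min_le_left _ _).trans ((min_le_right _ _).trans (min_le_right _ _))
  have e4 : s ≤ e / (2 * |K| + 1) := min_le_right _ _
  rw [le_div_iff₀ (by positivity)] at e4
  have := main s hs0 (by linarith) (by nlinarith)
  linarith

end Boundary

section BoundaryPressure

variable {n : ℕ} {x z : EuclideanSpace ℝ (Fin n)}
  {v : Fin n → EuclideanSpace ℝ (Fin n) → ℝ} {q : EuclideanSpace ℝ (Fin n) → ℝ} {ε ν R c : ℝ}
  {m : Fin n}

lemma auxConst_ge (hn : 1 ≤ n) : 200 * (n : ℝ) ≤ auxConst n ∧ 200 ≤ auxConst n := by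
  have hn' : (1 : ℝ) ≤ n := by exact_mod_cast hn
  unfold auxConst
  constructor <;> nlinarith

/-- The tangential Hölder constant of the pressure gradient up to the boundary. -/
noncomputable def pressureHolderConst (n : ℕ) : ℝ :=
  (n + 2) * (holderConst n (1 / 16) * (4 * auxConst n)) + 4 * auxConst n

lemma pressureHolderConst_pos (hn : 1 ≤ n) : 0 < pressureHolderConst n := by
  have := auxConst_pos hn
  have := holderConst_pos n (δ := 1 / 16) (by norm_num)
  unfold pressureHolderConst
  positivity

lemma pressure_grad_tangential_holder (hn : 1 ≤ n)
    (h : IsSmallSol ε ν v q (Dom z 1 m (z m)))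
    (hb : AuxBounds (auxConst n) ν ε v q (Dom z (3 / 4) m (z m)))
    (hBC : ∀ k, LinVanish m (z m) (Dom z 1 m (z m)) (v k)) {a : Fin n} (ha : a ≠ m)
    (hx : x ∈ Dom z (9 / 16) m (z m)) {s : ℝ} (hs : 0 < s) (hsδ : s ≤ 1 / 16) (j : Fin n) :
    |pd j q (x + s ^ 2 • EuclideanSpace.single a (1 : ℝ)) - pd j q x|
      ≤ pressureHolderConst n * s := by
  set K := auxConst n with hK
  obtain ⟨hKn, hK200⟩ := auxConst_ge hn
  rw [← hK] at hKn hK200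
  have hn0 : (0 : ℝ) ≤ n := Nat.cast_nonneg n
  set D := Dom z (3 / 4) m (z m) with hD
  have hO : IsOpen D := isOpen_dom
  have hsub : D ⊆ Dom z 1 m (z m) := dom_mono (by norm_num)
  have h' := h.toIsSol.mono hsub
  have sv := h'.smooth_v
  have sq := h'.smooth_q
  have spv : ∀ i k, ContDiffOn ℝ ∞ (pd i (v k)) D := fun i k => smooth_pd hO (sv k) i
  have spq : ∀ i, ContDiffOn ℝ ∞ (pd i q) D := fun i => smooth_pd hO sq i
  have sc := h'.smooth_conv hO
  have sQ := h'.smooth_pressureSource hO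
  have sco : ContDiffOn ℝ ∞ (fun y : EuclideanSpace ℝ (Fin n) => y m - z m) D :=
    smooth_coord_sub m _
  have hxm : ∀ y ∈ D, 0 < y m - z m ∧ y m - z m ≤ 1 := by
    intro y hy
    have h1 : |y m - z m| ≤ ‖y - z‖ := by simpa using PiLp.norm_apply_le (y - z) m
    have h2 := le_abs_self (y m - z m)
    exact ⟨by linarith [hy.2], by linarith [hy.1]⟩
  have htan : ∀ b, b ≠ m → ∀ k, ∀ y ∈ D, |pd b (v k) y| ≤ y m - z m := fun b hb k y hy =>
    tangential_deriv_le hb (h.smooth_v k) (fun p hp => h.second p hp m b k)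
      (fun p hp => h.second p hp b b k) (hBC k) (by norm_num) hy
  have hmulc : ∀ y ∈ D, ∀ A : ℝ, |A| ≤ K → |(y m - z m) * A| ≤ K * (y m - z m) := by
    intro y hy A hA
    rw [abs_mul, abs_of_pos (hxm y hy).1, mul_comm]
    exact mul_le_mul_of_nonneg_right hA (hxm y hy).1.le
  have hmulc1 : ∀ y ∈ D, ∀ A : ℝ, |A| ≤ K → |(y m - z m) * A| ≤ K := fun y hy A hA =>
    (hmulc y hy A hA).trans (by nlinarith [hxm y hy])
  -- the auxiliary function `H = 2 vₘ - xₘ q`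
  let H : EuclideanSpace ℝ (Fin n) → ℝ := fun y => 2 * v m y - (y m - z m) * q y
  let FH : EuclideanSpace ℝ (Fin n) → ℝ := fun y =>
    2 * conv ε v m y - (y m - z m) * pressureSource ε v y
  have sH : ContDiffOn ℝ ∞ H D := (contDiffOn_const.mul (sv m)).sub (sco.mul sq)
  have sFH : ContDiffOn ℝ ∞ FH D := (contDiffOn_const.mul (sc m)).sub (sco.mul sQ)
  have lapH : Set.EqOn (lap H) FH D := by
    intro y hy
    rw [lap_sub hO (contDiffOn_const.mul (sv m)) (sco.mul sq) hy, lap_const_mul hO (sv m) hy,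
      lap_coord_sub_mul hO sq hy, h'.eq y hy, h'.lap_pressure hO hy]
    simp only [FH]
    ring
  have pdH : ∀ i, ∀ y ∈ D,
      pd i H y = 2 * pd i (v m) y - ((if i = m then 1 else 0) * q y + (y m - z m) * pd i q y) := by
    intro i y hy
    rw [pd_sub hO (contDiffOn_const.mul (sv m)) (sco.mul sq) hy, pd_const_mul hO (sv m) hy,
      pd_mul hO sco sq hy, pd_coord_sub hO hy]
  have pdFH : ∀ i, ∀ y ∈ D, |pd i FH y| ≤ 4 * K := by
    intro i y hy
    rw [pd_sub hO (contDiffOn_const.mul (sc m)) (sco.mul sQ) hy, pd_const_mul hO (sc m) hy,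
      pd_mul hO sco sQ hy, pd_coord_sub hO hy]
    have b1 := hb.pd_conv_le y hy i m
    have b2 := hmulc1 y hy _ (hb.pd_source_le y hy i)
    have b3 : |(if i = m then 1 else 0) * pressureSource ε v y| ≤ K := by
      split_ifs
      · simpa using hb.source_le y hy
      · simp only [zero_mul, abs_zero]
        linarith
    rw [abs_le] at *
    constructor <;> linarith [b1.1, b1.2, b2.1, b2.2, b3.1, b3.2]
  -- Hölder continuity of the gradient of tangential derivatives of `H`
  have hx34 : x ∈ Dom z (3 / 4 - 3 * (1 / 16)) m (z m) := dom_mono (by norm_num) hx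
  have holdH : ∀ b, b ≠ m → ∀ i,
      |pd i (pd b H) (x + s ^ 2 • EuclideanSpace.single a (1 : ℝ)) - pd i (pd b H) x|
        ≤ holderConst n (1 / 16) * (4 * K) * s := by
    intro b hbm i
    have bd : ∀ y ∈ D, |pd b H y| ≤ (2 + K) * (y m - z m) := by
      intro y hy
      rw [pdH b y hy, if_neg hbm, zero_mul, zero_add]
      have b1 := htan b hbm m y hy
      have b2 := hmulc y hy _ (hb.pd_pressure_le y hy b)
      rw [abs_le] at *
      constructor <;> linarith [b1.1, b1.2, b2.1, b2.2]
    refine grad_tangential_holder ha (by norm_num) (by norm_num) (by linarith)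
      (smooth_pd hO sH b) (fun y hy => ?_) (fun y hy => ?_) ⟨_, bd⟩ hs hsδ hx34 i
    · refine (bd y hy).trans ?_
      nlinarith [hxm y hy]
    · rw [lap_pd hO sH hy, pd_congr hO lapH hy]
      exact pdFH b y hy
  -- the auxiliary function `g = 2 ∂ₘvₘ - xₘ ∂ₘq`
  let g : EuclideanSpace ℝ (Fin n) → ℝ := fun y => 2 * pd m (v m) y - (y m - z m) * pd m q y
  have sg : ContDiffOn ℝ ∞ g D := (contDiffOn_const.mul (spv m m)).sub (sco.mul (spq m))
  have bg : ∀ y ∈ D, |g y| ≤ (2 * n + K) * (y m - z m) := by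
    intro y hy
    have e : pd m (v m) y = -∑ i, if i = m then 0 else pd i (v i) y := by
      have h1 := h'.div y hy
      rw [← Finset.add_sum_erase _ _ (Finset.mem_univ m)] at h1
      rw [← Finset.add_sum_erase _ _ (Finset.mem_univ m), if_pos rfl, zero_add,
        Finset.sum_congr rfl fun i hi => if_neg (Finset.ne_of_mem_erase hi)]
      linarith
    have b1 : |pd m (v m) y| ≤ n * (y m - z m) := by
      rw [e, abs_neg]
      refine abs_sum_le_card_mul fun i => ?_
      split_ifs with hi
      · rw [abs_zero]
        exact (hxm y hy).1.le
      · exact htan i hi i y hy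
    have b2 := hmulc y hy _ (hb.pd_pressure_le y hy m)
    simp only [g]
    rw [abs_le] at *
    constructor <;> linarith [b1.1, b1.2, b2.1, b2.2]
  have lapg : ∀ y ∈ D, |lap g y| ≤ 4 * K := by
    intro y hy
    have e1 : pd m (lap (v m)) y = pd m (conv ε v m) y + pd m (pd m q) y := by
      rw [pd_congr hO (fun p hp => h'.eq p hp m) hy, pd_add hO (sc m) (spq m) hy]
    have e2 : lap (pd m q) y = pd m (pressureSource ε v) y := by
      rw [lap_pd hO sq hy, pd_congr hO (fun p hp => h'.lap_pressure hO hp) hy]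
    have e : lap g y = 2 * pd m (conv ε v m) y - (y m - z m) * pd m (pressureSource ε v) y := by
      rw [lap_sub hO (contDiffOn_const.mul (spv m m)) (sco.mul (spq m)) hy,
        lap_const_mul hO (spv m m) hy, lap_coord_sub_mul hO (spq m) hy, lap_pd hO (sv m) hy, e1, e2]
      ring
    rw [e]
    have b1 := hb.pd_conv_le y hy m m
    have b2 := hmulc1 y hy _ (hb.pd_source_le y hy m)
    rw [abs_le] at *
    constructor <;> linarith [b1.1, b1.2, b2.1, b2.2]
  have holdg : ∀ i, |pd i g (x + s ^ 2 • EuclideanSpace.single a (1 : ℝ)) - pd i g x|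
        ≤ holderConst n (1 / 16) * (4 * K) * s := by
    intro i
    refine grad_tangential_holder ha (by norm_num) (by norm_num) (by linarith)
      sg (fun y hy => (bg y hy).trans ?_) lapg ⟨_, bg⟩ hs hsδ hx34 i
    nlinarith [hxm y hy]
  -- the representation `q = g - ∂ₘH`
  have hq : Set.EqOn q (fun y => g y - pd m H y) D := by
    intro y hy
    simp only [g, pdH m y hy, if_pos]
    ring
  have hpq : ∀ i, ∀ y ∈ D, pd i q y = pd i g y - pd m (pd i H) y := by
    intro i y hy
    rw [pd_congr hO hq hy, pd_sub hO sg (smooth_pd hO sH m) hy, pd_comm hO sH hy]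
  have hs2 : s ^ 2 ≤ 1 / 16 := by nlinarith
  have hss : s ^ 2 ≤ s := by nlinarith
  have hseg : ∀ t ∈ Set.Icc 0 (s ^ 2), x + t • EuclideanSpace.single a (1 : ℝ) ∈ D :=
    fun t ht => dom_add' (δ := 1 / 16) hx (by rw [abs_of_nonneg ht.1]; exact ht.2.trans hs2)
      (by norm_num) (Or.inl ha)
  have hx0 : x ∈ D := dom_mono (by norm_num) hx
  have hx1 := hseg _ (Set.right_mem_Icc.2 (by positivity))
  set x' := x + s ^ 2 • EuclideanSpace.single a (1 : ℝ) with hx'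
  set T := holderConst n (1 / 16) * (4 * K) * s with hT
  have hT0 : 0 ≤ T := by
    have := holderConst_pos n (δ := 1 / 16) (by norm_num)
    have : 0 ≤ K := by linarith
    positivity
  have hfin : pressureHolderConst n * s = n * T + 2 * T + 4 * K * s := by
    rw [pressureHolderConst, hT]
    ring
  have hKs : 0 ≤ K * s := mul_nonneg (by linarith) hs.le
  have hnT : 0 ≤ n * T := by positivity
  have bg' := holdg j
  have main : |pd m (pd j H) x' - pd m (pd j H) x| ≤ n * T + T + 4 * K * s := by
    by_cases hj : j = m
    · subst hj
      have hlap : ∀ y ∈ D, pd j (pd j H) y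
          = FH y - ∑ i, if i = j then 0 else pd i (pd i H) y := by
        intro y hy
        have h1 := lapH hy
        unfold lap at h1
        rw [← Finset.add_sum_erase _ _ (Finset.mem_univ j)] at h1
        rw [← Finset.add_sum_erase _ _ (Finset.mem_univ j), if_pos rfl, zero_add,
          Finset.sum_congr rfl fun i hi => if_neg (Finset.ne_of_mem_erase hi)]
        linarith
      rw [hlap x hx0, hlap x' hx1]
      have b1 := abs_shift_sub_le (f := FH) (A := 4 * K) hO sFH (by positivity) hseg
        (fun t ht => pdFH a _ (hseg t ht))
      rw [← hx'] at b1
      have b2 : |∑ i, ((if i = j then 0 else pd i (pd i H) x')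
          - (if i = j then 0 else pd i (pd i H) x))| ≤ n * T := by
        refine abs_sum_le_card_mul fun i => ?_
        split_ifs with hi
        · simpa using hT0
        · exact holdH i hi i
      rw [Finset.sum_sub_distrib] at b2
      have b3 : 4 * K * s ^ 2 ≤ 4 * K * s := mul_le_mul_of_nonneg_left hss (by linarith)
      rw [abs_le] at *
      constructor <;> linarith [b1.1, b1.2, b2.1, b2.2]
    · have := holdH j hj m
      linarith
  rw [hpq j x hx0, hpq j x' hx1, hfin]
  rw [abs_le] at *
  constructor <;> linarith [bg'.1, bg'.2, main.1, main.2]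

end BoundaryPressure

section BoundaryCore

variable {n : ℕ} {x z : EuclideanSpace ℝ (Fin n)} {U : Set (EuclideanSpace ℝ (Fin n))}
  {v : Fin n → EuclideanSpace ℝ (Fin n) → ℝ} {f q : EuclideanSpace ℝ (Fin n) → ℝ} {ε ν R c : ℝ}
  {m : Fin n}

lemma abs_shift_sub_mul_le {A η d : ℝ} {a : Fin n} (hU : IsOpen U) (hf : ContDiffOn ℝ ∞ f U)
    (hη : 0 ≤ η) (hseg : ∀ t ∈ Set.Icc 0 η, x + t • EuclideanSpace.single a (1 : ℝ) ∈ U)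
    (hA : ∀ t ∈ Set.Icc 0 η, |pd a f (x + t • EuclideanSpace.single a (1 : ℝ)) - d| ≤ A) :
    |f (x + η • EuclideanSpace.single a (1 : ℝ)) - f x - η * d| ≤ A * η := by
  have := Convex.norm_image_sub_le_of_norm_hasDerivWithin_le (𝕜 := ℝ) (s := Set.Icc 0 η)
    (f := fun t : ℝ => f (x + t • EuclideanSpace.single a (1 : ℝ)) - t * d)
    (C := A) (x := 0) (y := η)
    (fun t ht => ((hasDerivAt_line hU hf a t (hseg t ht)).sub
      ((hasDerivAt_id t).mul_const d)).hasDerivWithinAt)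
    (by simpa using hA) (convex_Icc 0 η) (Set.left_mem_Icc.2 hη) (Set.right_mem_Icc.2 hη)
  simp only [zero_smul, add_zero, zero_mul, sub_zero, Real.norm_eq_abs, abs_of_nonneg hη] at this
  rwa [sub_right_comm] at this

/-- A function whose vertical derivative is small and whose tangential derivative is tangentially
Hölder continuous has a tangential derivative that is nearly constant in the vertical direction. -/
lemma tangential_deriv_vertical_diff_le {b : Fin n} {s t τ H : ℝ} (hU : IsOpen U)
    (hq : ContDiffOn ℝ ∞ q U) (hs : 0 < s) (ht : 0 ≤ t) (hH : 0 ≤ H)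
    (hmem : ∀ r₁ ∈ Set.Icc 0 t, ∀ r₂ ∈ Set.Icc 0 (s ^ 2),
      x + r₁ • EuclideanSpace.single m (1 : ℝ) + r₂ • EuclideanSpace.single b (1 : ℝ) ∈ U)
    (hτ : ∀ y ∈ U, |pd m q y| ≤ τ)
    (hol : ∀ r₁ ∈ Set.Icc 0 t, ∀ r, 0 < r → r ≤ s →
      |pd b q (x + r₁ • EuclideanSpace.single m (1 : ℝ)
        + r ^ 2 • EuclideanSpace.single b (1 : ℝ))
        - pd b q (x + r₁ • EuclideanSpace.single m (1 : ℝ))| ≤ H * r) :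
    |pd b q (x + t • EuclideanSpace.single m (1 : ℝ)) - pd b q x|
      ≤ 2 * τ * t / s ^ 2 + 2 * H * s := by
  have hs2 : 0 ≤ s ^ 2 := by positivity
  have h0t : (0 : ℝ) ∈ Set.Icc 0 t := Set.left_mem_Icc.2 ht
  have htt : t ∈ Set.Icc 0 t := Set.right_mem_Icc.2 ht
  have h0s : (0 : ℝ) ∈ Set.Icc 0 (s ^ 2) := Set.left_mem_Icc.2 hs2
  have hss : s ^ 2 ∈ Set.Icc 0 (s ^ 2) := Set.right_mem_Icc.2 hs2
  have hx0 : x + (0 : ℝ) • EuclideanSpace.single m (1 : ℝ) = x := by simp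
  have tan : ∀ r₁ ∈ Set.Icc 0 t,
      |q (x + r₁ • EuclideanSpace.single m (1 : ℝ) + s ^ 2 • EuclideanSpace.single b (1 : ℝ))
        - q (x + r₁ • EuclideanSpace.single m (1 : ℝ))
        - s ^ 2 * pd b q (x + r₁ • EuclideanSpace.single m (1 : ℝ))| ≤ H * s * s ^ 2 := by
    intro r₁ hr₁
    refine abs_shift_sub_mul_le hU hq hs2 (hmem r₁ hr₁) fun r hr => ?_
    rcases hr.1.eq_or_lt with h | h
    · rw [← h]
      simp
      positivity
    · have h1 : Real.sqrt r ≤ s := by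
        rw [Real.sqrt_le_left hs.le]
        exact hr.2
      have := hol r₁ hr₁ (Real.sqrt r) (Real.sqrt_pos.2 h) h1
      rw [Real.sq_sqrt h.le] at this
      exact this.trans (mul_le_mul_of_nonneg_left h1 hH)
  have ver : ∀ r₂ ∈ Set.Icc 0 (s ^ 2),
      |q (x + t • EuclideanSpace.single m (1 : ℝ) + r₂ • EuclideanSpace.single b (1 : ℝ))
        - q (x + r₂ • EuclideanSpace.single b (1 : ℝ))| ≤ τ * t := by
    intro r₂ hr₂
    have e : ∀ r : ℝ, x + r • EuclideanSpace.single m (1 : ℝ)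
        + r₂ • EuclideanSpace.single b (1 : ℝ) = x + r₂ • EuclideanSpace.single b (1 : ℝ)
        + r • EuclideanSpace.single m (1 : ℝ) := fun r => by abel
    rw [e]
    exact abs_shift_sub_le hU hq ht (fun r hr => by rw [← e]; exact hmem r hr r₂ hr₂)
      (fun r hr => hτ _ (by rw [← e]; exact hmem r hr r₂ hr₂))
  have a1 := tan 0 h0t
  have a2 := tan t htt
  have a3 := ver 0 h0s
  have a4 := ver _ hss
  rw [hx0] at a1
  simp only [zero_smul, add_zero] at a3
  have key : |s ^ 2 * (pd b q (x + t • EuclideanSpace.single m (1 : ℝ)) - pd b q x)|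
      ≤ s ^ 2 * (2 * τ * t / s ^ 2 + 2 * H * s) := by
    have e : s ^ 2 * (2 * τ * t / s ^ 2 + 2 * H * s) = 2 * τ * t + 2 * (H * s * s ^ 2) := by
      field_simp
    rw [e]
    rw [abs_le] at *
    constructor <;> linarith [a1.1, a1.2, a2.1, a2.2, a3.1, a3.2, a4.1, a4.2]
  rw [abs_mul, abs_of_pos (by positivity : 0 < s ^ 2)] at key
  exact le_of_mul_le_mul_left key (by positivity)

lemma IsSol.div_erase (h : IsSol ε v q U) (hx : x ∈ U) (m : Fin n) :
    pd m (v m) x = -∑ i, if i = m then 0 else pd i (v i) x := by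
  have h1 := h.div x hx
  rw [← Finset.add_sum_erase _ _ (Finset.mem_univ m)] at h1
  rw [← Finset.add_sum_erase _ _ (Finset.mem_univ m), if_pos rfl, zero_add,
    Finset.sum_congr rfl fun i hi => if_neg (Finset.ne_of_mem_erase hi)]
  linarith

lemma lap_erase (f : EuclideanSpace ℝ (Fin n) → ℝ) (m : Fin n) :
    lap f x = pd m (pd m f) x + ∑ i, if i = m then 0 else pd i (pd i f) x := by
  unfold lap
  rw [← Finset.add_sum_erase _ _ (Finset.mem_univ m)]
  congr 1
  rw [← Finset.add_sum_erase _ _ (Finset.mem_univ m), if_pos rfl, zero_add,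
    Finset.sum_congr rfl fun i hi => if_neg (Finset.ne_of_mem_erase hi)]

/-- Small solutions vanishing on the flat boundary have small second derivatives there. -/
lemma second_deriv_small_boundary (hn : 1 ≤ n) {σ : ℝ} (hσ : 0 < σ) :
    ∃ μ > 0, ∀ (z : EuclideanSpace ℝ (Fin n)) (m : Fin n) (ε : ℝ)
      (v : Fin n → EuclideanSpace ℝ (Fin n) → ℝ) (q : EuclideanSpace ℝ (Fin n) → ℝ),
      IsSmallSol ε μ v q (Dom z 1 m (z m)) → (∀ k, LinVanish m (z m) (Dom z 1 m (z m)) (v k)) →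
      ∀ x ∈ Dom z (1 / 4) m (z m), ∀ i j k, |pd i (pd j (v k)) x| ≤ σ := by
  have hn' : (1 : ℝ) ≤ n := by exact_mod_cast hn
  have hK := auxConst_pos hn
  have hH := pressureHolderConst_pos hn
  set K := auxConst n with hKdef
  set H := pressureHolderConst n with hHdef
  set s := min (1 / 16) (σ / (16 * H)) with hs
  have hs0 : 0 < s := by positivity
  have hs16 : s ≤ 1 / 16 := min_le_left _ _
  have hsH : 2 * H * s ≤ σ / 8 := by
    have : s ≤ σ / (16 * H) := min_le_right _ _
    rw [le_div_iff₀ (by positivity)] at this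
    linarith
  have hs2 : s ^ 2 ≤ 1 / 16 := by nlinarith
  set σ₁ := σ * s ^ 2 / (32 * n) with hσ₁
  have hσ₁0 : 0 < σ₁ := by positivity
  have hnσ₁ : n * σ₁ = σ * s ^ 2 / 32 := by
    rw [hσ₁]
    field_simp
  have hσs : σ * s ^ 2 ≤ σ * (1 / 16) := mul_le_mul_of_nonneg_left hs2 hσ.le
  have hσ₁n : σ₁ ≤ n * σ₁ := by nlinarith
  set ρ := min (1 / 4) (σ / 96) with hρ
  have hρ0 : 0 < ρ := by positivity
  have hρσ : 96 * ρ ≤ σ := by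
    have : ρ ≤ σ / 96 := min_le_right _ _
    linarith
  obtain ⟨μ₁, hμ₁, hmix⟩ := mixed_second_deriv_small hn hH hσ₁0
  set μ := min (min μ₁ 1) (min (ρ ^ 2) (σ * s ^ 2 / (16 * K))) with hμ
  have hμ0 : 0 < μ := by positivity
  have hμμ₁ : μ ≤ μ₁ := (min_le_left _ _).trans (min_le_left _ _)
  have hμ1 : μ ≤ 1 := (min_le_left _ _).trans (min_le_right _ _)
  have hμρ : μ ≤ ρ ^ 2 := (min_le_right _ _).trans (min_le_left _ _)
  have hμK : K * μ ≤ σ * s ^ 2 / 16 := by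
    have : μ ≤ σ * s ^ 2 / (16 * K) := (min_le_right _ _).trans (min_le_right _ _)
    rw [le_div_iff₀ (by positivity)] at this
    linarith
  refine ⟨μ, hμ0, fun z m ε v q₀ h₀ hBC => ?_⟩
  obtain ⟨a₀, hb⟩ := h₀.exists_auxBounds hn hμ1 hμ0.le
  set q : EuclideanSpace ℝ (Fin n) → ℝ := fun y => q₀ y - a₀ with hq
  have h : IsSmallSol ε μ v q (Dom z 1 m (z m)) :=
    ⟨h₀.toIsSol.sub_const isOpen_dom a₀, h₀.ε_nonneg, h₀.ε_le, h₀.bound, h₀.second⟩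
  clear_value q
  have hsub34 : Dom z (3 / 4) m (z m) ⊆ Dom z 1 m (z m) := dom_mono (by norm_num)
  have hhol : ∀ a, a ≠ m → ∀ x ∈ Dom z (9 / 16) m (z m), ∀ r, 0 < r → r ≤ 1 / 16 → ∀ j,
      |pd j q (x + r ^ 2 • EuclideanSpace.single a (1 : ℝ)) - pd j q x| ≤ H * r :=
    fun a ha x hx r hr hr' j => pressure_grad_tangential_holder hn h hb hBC ha hx hr hr' j
  have hm1 : ∀ a, a ≠ m → ∀ x ∈ Dom z (7 / 16) m (z m), ∀ j k, |pd a (pd j (v k)) x| ≤ σ₁ :=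
    fun a ha => hmix z m (z m) ε μ v q a hμμ₁ ha (h.mono hsub34) hb
      (fun k => (hBC k).mono hsub34) (hhol a ha)
  have hO1 : IsOpen (Dom z 1 m (z m)) := isOpen_dom
  have hO : IsOpen (Dom z (7 / 16) m (z m)) := isOpen_dom
  have hsub : Dom z (7 / 16) m (z m) ⊆ Dom z 1 m (z m) := dom_mono (by norm_num)
  have hm2 : ∀ a, a ≠ m → ∀ x ∈ Dom z (7 / 16) m (z m), ∀ j k, |pd j (pd a (v k)) x| ≤ σ₁ :=
    fun a ha x hx j k => by
      rw [pd_comm hO1 (h.smooth_v k) (hsub hx)]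
      exact hm1 a ha x hx j k
  have hmm : ∀ x ∈ Dom z (7 / 16) m (z m), |pd m (pd m (v m)) x| ≤ n * σ₁ := by
    intro x hx
    have s1 : ∀ i ∈ Finset.univ, ContDiffOn ℝ ∞
        (fun y => if i = m then (0 : ℝ) else pd i (v i) y) (Dom z 1 m (z m)) := by
      intro i _
      split_ifs
      · exact contDiffOn_const
      · exact smooth_pd hO1 (h.smooth_v i) i
    have s2 : ContDiffOn ℝ ∞ (fun y => ∑ i, if i = m then (0 : ℝ) else pd i (v i) y)
        (Dom z 1 m (z m)) := ContDiffOn.sum s1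
    have e : pd m (pd m (v m)) x = -1 * ∑ i, pd m (fun y => if i = m then 0 else pd i (v i) y) x := by
      rw [← pd_sum _ hO1 s1 (hsub hx), ← pd_const_mul hO1 s2 (hsub hx)]
      refine pd_congr hO1 (fun y hy => ?_) (hsub hx) m
      rw [h.div_erase hy]
      ring
    rw [e, neg_one_mul, abs_neg]
    refine abs_sum_le_card_mul fun i => ?_
    by_cases hi : i = m
    · simp only [hi, if_true, pd_const, abs_zero]
      exact hσ₁0.le
    · simp only [hi, if_false]
      exact hm2 i hi x hx m i
  have herase : ∀ x ∈ Dom z (7 / 16) m (z m), ∀ k,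
      |∑ i, if i = m then 0 else pd i (pd i (v k)) x| ≤ n * σ₁ := by
    intro x hx k
    refine abs_sum_le_card_mul fun i => ?_
    split_ifs with hi
    · simpa using hσ₁0.le
    · exact hm1 i hi x hx i k
  have hsub' : Dom z (7 / 16) m (z m) ⊆ Dom z (3 / 4) m (z m) := dom_mono (by norm_num)
  have hqm : ∀ x ∈ Dom z (7 / 16) m (z m), |pd m q x| ≤ σ * s ^ 2 / 8 := by
    intro x hx
    have e : pd m q x = lap (v m) x - conv ε v m x := by
      rw [h.eq x (hsub hx)]
      ring
    rw [e, lap_erase _ m]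
    have b1 := hmm x hx
    have b2 := herase x hx m
    have b3 := hb.conv_le x (hsub' hx) m
    rw [hnσ₁] at b1 b2
    rw [abs_le] at *
    constructor <;> linarith [b1.1, b1.2, b2.1, b2.2, b3.1, b3.2]
  intro x hx i j k
  have hx7 : x ∈ Dom z (7 / 16) m (z m) := dom_mono (by norm_num) hx
  have hσσ : n * σ₁ ≤ σ := by
    rw [hnσ₁]
    linarith
  by_cases hi : i = m
  swap
  · exact (hm1 i hi x hx7 j k).trans (by linarith)
  by_cases hj : j = m
  swap
  · exact (hm2 j hj x hx7 i k).trans (by linarith)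
  subst hi
  subst hj
  by_cases hk : k = j
  · subst hk
    exact (hmm x hx7).trans hσσ
  have hmem : ∀ r₁ ∈ Set.Icc (0 : ℝ) (1 / 8), x + r₁ • EuclideanSpace.single j (1 : ℝ)
      ∈ Dom z (3 / 8) j (z j) := fun r₁ hr₁ =>
    dom_add' (δ := 1 / 8) hx (by rw [abs_of_nonneg hr₁.1]; exact hr₁.2) (by norm_num) (Or.inr hr₁.1)
  have hmem7 : ∀ r₁ ∈ Set.Icc (0 : ℝ) (1 / 8), x + r₁ • EuclideanSpace.single j (1 : ℝ)
      ∈ Dom z (7 / 16) j (z j) := fun r₁ hr₁ => dom_mono (by norm_num) (hmem r₁ hr₁)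
  have hmem2 : ∀ r₁ ∈ Set.Icc (0 : ℝ) (1 / 8), ∀ r₂ ∈ Set.Icc 0 (s ^ 2),
      x + r₁ • EuclideanSpace.single j (1 : ℝ) + r₂ • EuclideanSpace.single k (1 : ℝ)
      ∈ Dom z (7 / 16) j (z j) := fun r₁ hr₁ r₂ hr₂ =>
    dom_add' (δ := 1 / 16) (hmem r₁ hr₁) (by rw [abs_of_nonneg hr₂.1]; exact hr₂.2.trans hs2)
      (by norm_num) (Or.inl hk)
  have hdiff : ∀ t ∈ Set.Icc (0 : ℝ) (1 / 8),
      |pd j (pd j (v k)) (x + t • EuclideanSpace.single j (1 : ℝ)) - pd j (pd j (v k)) x|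
        ≤ σ / 2 := by
    intro t ht
    have hsub8 : Set.Icc 0 t ⊆ Set.Icc 0 (1 / 8) := Set.Icc_subset_Icc_right ht.2
    have e : ∀ y ∈ Dom z (7 / 16) j (z j), pd j (pd j (v k)) y
        = conv ε v k y + pd k q y - ∑ i, if i = j then 0 else pd i (pd i (v k)) y := by
      intro y hy
      rw [← h.eq y (hsub hy), lap_erase _ j]
      ring
    have hxt := hmem7 t ht
    rw [e x hx7, e _ hxt]
    have b1 := herase x hx7 k
    have b2 := herase _ hxt k
    have b3 := hb.conv_le x (hsub' hx7) k
    have b4 := hb.conv_le _ (hsub' hxt) k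
    have b5 := tangential_deriv_vertical_diff_le (q := q) (b := k) (m := j) (x := x) (s := s)
      (t := t) (τ := σ * s ^ 2 / 8) (H := H) hO (h.smooth_q.mono hsub) hs0 ht.1 hH.le
      (fun r₁ hr₁ => hmem2 r₁ (hsub8 hr₁)) hqm
      (fun r₁ hr₁ r hr hrs => hhol k hk _ (dom_mono (by norm_num) (hmem7 r₁ (hsub8 hr₁))) r hr
        (hrs.trans hs16) k)
    have b6 : 2 * (σ * s ^ 2 / 8) * t / s ^ 2 ≤ σ / 32 := by
      rw [show 2 * (σ * s ^ 2 / 8) * t / s ^ 2 = σ / 4 * t by field_simp; ring]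
      nlinarith [ht.2]
    rw [hnσ₁] at b1 b2
    rw [abs_le] at *
    constructor <;>
      linarith [b1.1, b1.2, b2.1, b2.2, b3.1, b3.2, b4.1, b4.2, b5.1, b5.2]
  have hfirst : ∀ y ∈ Dom z (7 / 16) j (z j), |pd j (v k) y| ≤ 3 * ρ := by
    intro y hy
    have hρ4 : ρ ≤ 1 / 4 := min_le_left _ _
    refine (h.first_le hρ0 (by linarith) hy j k).trans ?_
    have : 2 * μ / ρ ≤ 2 * ρ := by
      rw [div_le_iff₀ hρ0]
      nlinarith
    linarith
  have b1 := abs_shift_sub_mul_le (f := pd j (v k)) (η := 1 / 8) hO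
    ((smooth_pd hO1 (h.smooth_v k) j).mono hsub) (by norm_num) hmem7 hdiff
  have b2 := hfirst x hx7
  have b3 := hfirst _ (hmem7 (1 / 8) (by norm_num))
  rw [abs_le] at *
  constructor <;> linarith [b1.1, b1.2, b2.1, b2.2, b3.1, b3.2]

end BoundaryCore

section Scaling

variable {n : ℕ} {D : Set (EuclideanSpace ℝ (Fin n))} {x z : EuclideanSpace ℝ (Fin n)}
  {v : Fin n → EuclideanSpace ℝ (Fin n) → ℝ} {q : EuclideanSpace ℝ (Fin n) → ℝ} {ε ν R c : ℝ}
  {m : Fin n}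

lemma smooth_comp_scale {f : EuclideanSpace ℝ (Fin n) → ℝ} (hf : ContDiffOn ℝ ∞ f D) (a r : ℝ) :
    ContDiffOn ℝ ∞ (fun y => a * f (z + r • y)) {y | z + r • y ∈ D} :=
  contDiffOn_const.mul (hf.comp
    (contDiff_const.add (contDiff_id.const_smul r) : ContDiff ℝ ∞ fun y => z + r • y).contDiffOn
    fun _ hy => hy)

lemma pd_pd_comp_scale (f : EuclideanSpace ℝ (Fin n) → ℝ) (z : EuclideanSpace ℝ (Fin n))
    (a r : ℝ) (i j : Fin n) :
    pd i (pd j (fun y => a * f (z + r • y))) = fun y => (a * r * r) * pd i (pd j f) (z + r • y) := by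
  rw [pd_comp_scale, pd_comp_scale]

/-- The Navier-Stokes scaling, with an independent scaling of the velocity. -/
lemma IsSol.scale (h : IsSol 1 v q D) {a r : ℝ} (ha : 0 < a) (z : EuclideanSpace ℝ (Fin n)) :
    IsSol (r / a) (fun k y => a * v k (z + r • y)) (fun y => (a * r) * q (z + r • y))
      {y | z + r • y ∈ D} := by
  refine ⟨fun k => smooth_comp_scale (h.smooth_v k) a r, smooth_comp_scale h.smooth_q _ r,
    fun y hy j => ?_, fun y hy => ?_⟩
  · have e := h.eq _ hy j
    simp only [lap, conv, one_mul] at e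
    simp only [lap, conv, pd_comp_scale]
    rw [← Finset.mul_sum, e, mul_add, Finset.mul_sum, Finset.mul_sum]
    congr 1
    refine Finset.sum_congr rfl fun i _ => ?_
    field_simp
  · simp only [pd_comp_scale]
    rw [← Finset.mul_sum, h.div _ hy, mul_zero]

lemma IsSol.scale_small (h : IsSol 1 v q D) {M Λ r : ℝ} (hr : 0 < r) (hΛ : 0 < Λ)
    (hM : ∀ x ∈ D, ∀ k, |v k x| ≤ M) (hH : ∀ x ∈ D, ∀ i j k, |pd i (pd j (v k)) x| ≤ Λ)
    (h1 : M ≤ ν * (r ^ 2 * Λ)) (h2 : r ^ 3 * Λ ≤ 1) (z : EuclideanSpace ℝ (Fin n)) :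
    IsSmallSol (r ^ 3 * Λ) ν (fun k y => (r ^ 2 * Λ)⁻¹ * v k (z + r • y))
      (fun y => ((r ^ 2 * Λ)⁻¹ * r) * q (z + r • y)) {y | z + r • y ∈ D} := by
  have ha : 0 < (r ^ 2 * Λ)⁻¹ := by positivity
  have e : r / (r ^ 2 * Λ)⁻¹ = r ^ 3 * Λ := by
    field_simp
  have h3 := h.scale (r := r) ha z
  rw [e] at h3
  refine ⟨h3, by positivity, h2, fun y hy k => ?_, fun y hy i j k => ?_⟩
  · rw [abs_mul, abs_of_pos ha, inv_mul_le_iff₀ (by positivity), mul_comm]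
    exact (hM _ hy k).trans h1
  · rw [pd_pd_comp_scale, abs_mul]
    have e2 : (r ^ 2 * Λ)⁻¹ * r * r = Λ⁻¹ := by field_simp
    rw [e2, abs_of_pos (by positivity), inv_mul_le_iff₀ hΛ, mul_one]
    exact hH _ hy i j k

/-- Second derivatives improve by the factor `σ` at scales where the velocity is relatively
small. -/
lemma second_deriv_improve (hn : 2 ≤ n) {σ : ℝ} (hσ : 0 < σ) :
    ∃ μ > 0, ∀ (x : EuclideanSpace ℝ (Fin n)) (m : Fin n)
      (v : Fin n → EuclideanSpace ℝ (Fin n) → ℝ) (q : EuclideanSpace ℝ (Fin n) → ℝ) (M Λ r : ℝ),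
      0 < x m → 0 < r → 0 < Λ → IsSol 1 v q (Dom x r m 0) →
      (∀ y ∈ Dom x r m 0, ∀ k, |v k y| ≤ M) →
      (∀ y ∈ Dom x r m 0, ∀ i j k, |pd i (pd j (v k)) y| ≤ Λ) →
      (∀ k, LinVanish m 0 (Dom x r m 0) (v k)) →
      M ≤ μ * (r ^ 2 * Λ) → r ^ 3 * Λ ≤ 1 → ∀ i j k, |pd i (pd j (v k)) x| ≤ σ * Λ := by
  obtain ⟨μ₁, hμ₁, H₁⟩ := second_deriv_small_interior hn hσ
  obtain ⟨μ₂, hμ₂, H₂⟩ := second_deriv_small_boundary (n := n) (by omega) hσ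
  refine ⟨min (μ₁ / 64) (μ₂ / 4), by positivity,
    fun x m v q M Λ r hx hr hΛ h hM hH hBC h1 h2 i j k => ?_⟩
  have hrΛ : 0 < r ^ 2 * Λ := by positivity
  rcases le_or_gt (r / 8) (x m) with hxr | hxr
  · have hM1 : M ≤ μ₁ * ((r / 8) ^ 2 * Λ) := by
      have := mul_le_mul_of_nonneg_right (min_le_left (μ₁ / 64) (μ₂ / 4)) hrΛ.le
      linarith
    have hsub : Metric.ball x (r / 8) ⊆ Dom x r m 0 := by
      intro y hy
      rw [mem_ball_iff_norm] at hy
      have t1 : |y m - x m| ≤ ‖y - x‖ := by simpa using PiLp.norm_apply_le (y - x) m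
      have t2 := neg_abs_le (y m - x m)
      exact ⟨by linarith, by linarith⟩
    have hs := (h.mono hsub).scale_small (r := r / 8) (by positivity) hΛ
      (fun y hy => hM y (hsub hy)) (fun y hy => hH y (hsub hy)) hM1
      (by nlinarith [mul_pos hr hrΛ]) x
    have hsub2 : Metric.ball 0 1 ⊆ {y | x + (r / 8) • y ∈ Metric.ball x (r / 8)} := by
      intro y hy
      rw [mem_ball_iff_norm, sub_zero] at hy
      rw [Set.mem_ofPred_eq, mem_ball_iff_norm, add_sub_cancel_left, norm_smul, Real.norm_eq_abs,
        abs_of_pos (by positivity)]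
      nlinarith
    have := H₁ 0 _ _ _ (hs.mono hsub2) i j k
    rw [pd_pd_comp_scale] at this
    beta_reduce at this
    rw [smul_zero, add_zero, abs_mul] at this
    have e2 : ((r / 8) ^ 2 * Λ)⁻¹ * (r / 8) * (r / 8) = Λ⁻¹ := by field_simp
    rwa [e2, abs_of_pos (by positivity), inv_mul_le_iff₀ hΛ, mul_comm] at this
  · have hM1 : M ≤ μ₂ * ((r / 2) ^ 2 * Λ) := by
      have := mul_le_mul_of_nonneg_right (min_le_right (μ₁ / 64) (μ₂ / 4)) hrΛ.le
      linarith
    set z := x + (-(x m)) • EuclideanSpace.single m (1 : ℝ) with hz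
    have hzm : z m = 0 := by
      rw [hz, add_smul_single_apply, if_pos rfl]
      ring
    have hxz : x - z = (x m) • EuclideanSpace.single m (1 : ℝ) := by
      rw [hz, neg_smul]
      abel
    have hxz' : ‖x - z‖ = x m := by rw [hxz, norm_smul_single, abs_of_pos hx]
    have hsub : Dom z (r / 2) m 0 ⊆ Dom x r m 0 := by
      refine dom_subset ?_
      rw [norm_sub_rev, hxz']
      linarith
    have hs := (h.mono hsub).scale_small (r := r / 2) (by positivity) hΛ
      (fun y hy => hM y (hsub hy)) (fun y hy => hH y (hsub hy)) hM1
      (by nlinarith [mul_pos hr hrΛ]) z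
    have hsub2 : Dom 0 1 m ((0 : EuclideanSpace ℝ (Fin n)) m)
        ⊆ {y | z + (r / 2) • y ∈ Dom z (r / 2) m 0} := by
      rintro y ⟨hy, hym⟩
      rw [sub_zero] at hy
      simp only [PiLp.zero_apply] at hym
      refine ⟨?_, ?_⟩
      · rw [add_sub_cancel_left, norm_smul, Real.norm_eq_abs, abs_of_pos (by positivity)]
        nlinarith
      · simp only [PiLp.add_apply, PiLp.smul_apply, smul_eq_mul, hzm]
        positivity
    have hpt : z + (r / 2) • ((2 / r) • (x - z)) = x := by
      rw [smul_smul, div_mul_div_cancel₀ (by norm_num), div_self hr.ne', one_smul]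
      abel
    have := H₂ 0 m _ _ _ (hs.mono hsub2) (fun k' => ?_) ((2 / r) • (x - z)) ⟨?_, ?_⟩ i j k
    · rw [pd_pd_comp_scale] at this
      beta_reduce at this
      rw [hpt, abs_mul] at this
      have e2 : ((r / 2) ^ 2 * Λ)⁻¹ * (r / 2) * (r / 2) = Λ⁻¹ := by field_simp
      rwa [e2, abs_of_pos (by positivity), inv_mul_le_iff₀ hΛ, mul_comm] at this
    · obtain ⟨K, hK⟩ := hBC k'
      refine ⟨((r / 2) ^ 2 * Λ)⁻¹ * (K * (r / 2)), fun y hy => ?_⟩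
      have b := hK _ (hsub (hsub2 hy))
      simp only [PiLp.add_apply, PiLp.smul_apply, smul_eq_mul, hzm, zero_add, sub_zero] at b
      rw [abs_mul, abs_of_pos (by positivity), PiLp.zero_apply, sub_zero, mul_assoc]
      exact mul_le_mul_of_nonneg_left (by linarith) (by positivity)
    · rw [sub_zero, norm_smul, hxz', Real.norm_eq_abs, abs_of_pos (by positivity), div_mul_eq_mul_div,
        div_lt_iff₀ hr]
      linarith
    · rw [hxz, PiLp.zero_apply]
      simp only [PiLp.smul_apply, smul_eq_mul, PiLp.single_apply, if_pos]
      positivity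

/-- Scale-invariant bound for the second derivatives at the centre of a domain. -/
lemma second_deriv_le (hn : 2 ≤ n) :
    ∃ μ > 0, ∀ (x : EuclideanSpace ℝ (Fin n)) (m : Fin n)
      (v : Fin n → EuclideanSpace ℝ (Fin n) → ℝ) (q : EuclideanSpace ℝ (Fin n) → ℝ) (M R B : ℝ),
      0 < x m → 0 < R → 0 < M → IsSol 1 v q (Dom x R m 0) →
      (∀ y ∈ Dom x R m 0, ∀ k, |v k y| ≤ M) →
      (∀ y ∈ Dom x R m 0, ∀ i j k, |pd i (pd j (v k)) y| ≤ B) →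
      (∀ k, LinVanish m 0 (Dom x R m 0) (v k)) →
      ∀ i j k, R ^ 2 * |pd i (pd j (v k)) x| ≤ M / μ + R ^ 2 * (M / μ) ^ 3 := by
  obtain ⟨μ, hμ, H⟩ := second_deriv_improve hn (σ := 1 / 16) (by norm_num)
  refine ⟨μ, hμ, fun x m v q M R B hxm hR hM h hv hB hBC i j k => ?_⟩
  by_contra! hcon
  set A : Set ℝ := {t | ∃ y ∈ Dom x R m 0, ∃ i j k,
    t = (R - ‖y - x‖) ^ 2 * |pd i (pd j (v k)) y|} with hA
  have hAb : BddAbove A := by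
    refine ⟨R ^ 2 * B, ?_⟩
    rintro t ⟨y, hy, i', j', k', rfl⟩
    have h1 := hy.1
    have h2 := norm_nonneg (y - x)
    have h3 : R - ‖y - x‖ ≤ R := by linarith
    have h4 : 0 ≤ R - ‖y - x‖ := by linarith
    exact mul_le_mul (pow_le_pow_left₀ h4 h3 2) (hB y hy i' j' k') (abs_nonneg _) (by positivity)
  have hmem : R ^ 2 * |pd i (pd j (v k)) x| ∈ A :=
    ⟨x, ⟨by simpa using hR, hxm⟩, i, j, k, by simp⟩
  set S := sSup A with hS
  have hST := hcon.trans_le (le_csSup hAb hmem)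
  rw [← hS] at hST
  set N := M / μ with hN
  have hN0 : 0 < N := by positivity
  have hS0 : 0 < S := lt_trans (by positivity) hST
  obtain ⟨t, ⟨x₀, hx₀, i₀, j₀, k₀, rfl⟩, ht⟩ :=
    exists_lt_of_lt_csSup ⟨_, hmem⟩ (show S / 2 < sSup A by linarith)
  set d := R - ‖x₀ - x‖ with hd
  have hd0 : 0 < d := by linarith [hx₀.1]
  have hdR : d ≤ R := by linarith [norm_nonneg (x₀ - x)]
  set Λ := 4 * S / d ^ 2 with hΛ
  have hΛ0 : 0 < Λ := by positivity
  have hsub : Dom x₀ (d / 2) m 0 ⊆ Dom x R m 0 := dom_subset (by linarith)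
  have hH : ∀ y ∈ Dom x₀ (d / 2) m 0, ∀ i j k, |pd i (pd j (v k)) y| ≤ Λ := by
    intro y hy i j k
    have h1 := le_csSup hAb ⟨y, hsub hy, i, j, k, rfl⟩
    rw [← hS] at h1
    have h2 : ‖y - x‖ ≤ ‖y - x₀‖ + ‖x₀ - x‖ := by simpa using norm_add_le (y - x₀) (x₀ - x)
    have h3 : d / 2 ≤ R - ‖y - x‖ := by linarith [hy.1]
    have h4 := mul_le_mul_of_nonneg_right (pow_le_pow_left₀ (by positivity) h3 2)
      (abs_nonneg (pd i (pd j (v k)) y))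
    rw [hΛ, le_div_iff₀ (by positivity)]
    linarith
  set θ := Real.sqrt (N / (4 * S)) with hθ
  have hθ2 : θ ^ 2 = N / (4 * S) := Real.sq_sqrt (by positivity)
  have hθ0 : 0 < θ := by positivity
  have hNS : N < S := by
    have : 0 < R ^ 2 * N ^ 3 := by positivity
    linarith
  have hθ1 : θ ≤ 1 / 2 := by
    refine Real.sqrt_le_iff.2 ⟨by norm_num, ?_⟩
    rw [div_le_iff₀ (by positivity)]
    linarith
  have hr : θ * d ≤ d / 2 := by nlinarith
  have hsub' : Dom x₀ (θ * d) m 0 ⊆ Dom x₀ (d / 2) m 0 := dom_mono hr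
  have eq1 : (θ * d) ^ 2 * Λ = N := by
    rw [mul_pow, hθ2, hΛ]
    field_simp
  have key := H x₀ m v q M Λ (θ * d) hx₀.2 (by positivity) hΛ0 (h.mono (hsub'.trans hsub))
    (fun y hy => hv y (hsub (hsub' hy))) (fun y hy => hH y (hsub' hy))
    (fun k => (hBC k).mono (hsub'.trans hsub))
    (by rw [eq1, hN]; exact le_of_eq (by field_simp))
    (by
      have e : (θ * d) ^ 3 * Λ = θ * d * N := by rw [← eq1]; ring
      rw [e]
      refine (sq_le_one_iff₀ (by positivity)).1 ?_
      have e2 : (θ * d * N) ^ 2 = d ^ 2 * N ^ 3 / (4 * S) := by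
        rw [mul_pow, mul_pow, hθ2]
        field_simp
      rw [e2, div_le_one (by positivity)]
      have : d ^ 2 * N ^ 3 ≤ R ^ 2 * N ^ 3 := by gcongr
      linarith) i₀ j₀ k₀
  rw [hΛ] at key
  have k2 := mul_le_mul_of_nonneg_left key (sq_nonneg d)
  have e3 : d ^ 2 * (1 / 16 * (4 * S / d ^ 2)) = S / 4 := by
    field_simp
    ring
  linarith

end Scaling

section HalfSpace

variable {n : ℕ} {m : Fin n}

/-- The closed half space without the origin. -/
def closedHalf (m : Fin n) : Set (EuclideanSpace ℝ (Fin n)) := {x | 0 ≤ x m} \ {0}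

/-- The open half space. -/
def openHalf (m : Fin n) : Set (EuclideanSpace ℝ (Fin n)) := {x | 0 < x m}

lemma isOpen_openHalf : IsOpen (openHalf m) :=
  isOpen_lt continuous_const (EuclideanSpace.proj (𝕜 := ℝ) m).continuous

lemma ne_zero_of_mem_openHalf {x : EuclideanSpace ℝ (Fin n)} (hx : x ∈ openHalf m) : x ≠ 0 := by
  rintro rfl
  exact lt_irrefl _ (show (0 : ℝ) < 0 from hx)

lemma openHalf_subset : openHalf m ⊆ closedHalf m := fun _ hx =>
  ⟨show (0 : ℝ) ≤ _ from le_of_lt hx, ne_zero_of_mem_openHalf hx⟩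

lemma uniqueDiffOn_closedHalf : UniqueDiffOn ℝ (closedHalf m) := by
  have h1 : Convex ℝ {x : EuclideanSpace ℝ (Fin n) | 0 ≤ x m} :=
    convex_halfSpace_ge (EuclideanSpace.proj (𝕜 := ℝ) m).toLinearMap.isLinear 0
  have h2 : (interior {x : EuclideanSpace ℝ (Fin n) | 0 ≤ x m}).Nonempty := by
    refine ⟨EuclideanSpace.single m 1, mem_interior.2 ⟨openHalf m, fun y hy => show (0 : ℝ) ≤ _ from le_of_lt hy,
      isOpen_openHalf, ?_⟩⟩
    simp [openHalf]
  exact (uniqueDiffOn_convex h1 h2).inter isOpen_compl_singleton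

/-- Partial derivatives extend smoothly to the boundary. -/
lemma exists_pd_extension {f : EuclideanSpace ℝ (Fin n) → ℝ} (hf : ContDiffOn ℝ ∞ f (closedHalf m))
    (i : Fin n) : ∃ g, ContDiffOn ℝ ∞ g (closedHalf m) ∧ Set.EqOn (pd i f) g (openHalf m) := by
  refine ⟨fun x => fderivWithin ℝ f (closedHalf m) x (EuclideanSpace.single i 1),
    (hf.fderivWithin uniqueDiffOn_closedHalf (by norm_num)).clm_apply contDiffOn_const,
    fun x hx => ?_⟩
  have : closedHalf m ∈ 𝓝 x :=
    Filter.mem_of_superset (isOpen_openHalf.mem_nhds hx) openHalf_subset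
  simp only [pd, fderivWithin_of_mem_nhds this]

lemma isCompact_annulus (a b : ℝ) :
    IsCompact {y : EuclideanSpace ℝ (Fin n) | a ≤ ‖y‖ ∧ ‖y‖ ≤ b ∧ 0 ≤ y m} := by
  refine (isCompact_closedBall (0 : EuclideanSpace ℝ (Fin n)) b).of_isClosed_subset ?_
    fun y hy => by simpa using hy.2.1
  exact (isClosed_le continuous_const continuous_norm).inter
    ((isClosed_le continuous_norm continuous_const).inter
      (isClosed_le continuous_const (EuclideanSpace.proj (𝕜 := ℝ) m).continuous))

lemma exists_bound_annulus {f : EuclideanSpace ℝ (Fin n) → ℝ}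
    (hf : ContDiffOn ℝ ∞ f (closedHalf m)) {a : ℝ} (ha : 0 < a) (b : ℝ) :
    ∃ B, ∀ y, a ≤ ‖y‖ → ‖y‖ ≤ b → 0 ≤ y m → |f y| ≤ B := by
  obtain ⟨B, hB⟩ := (isCompact_annulus (m := m) a b).exists_bound_of_continuousOn
    (hf.continuousOn.mono fun y hy => ⟨hy.2.2, fun h0 => by
      have h1 := hy.1
      rw [Set.mem_singleton_iff.1 h0, norm_zero] at h1
      linarith⟩)
  exact ⟨B, fun y h1 h2 h3 => hB y ⟨h1, h2, h3⟩⟩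

lemma exists_bound_pd_annulus {f : EuclideanSpace ℝ (Fin n) → ℝ}
    (hf : ContDiffOn ℝ ∞ f (closedHalf m)) {a : ℝ} (ha : 0 < a) (b : ℝ) (i : Fin n) :
    ∃ B, ∀ y, a ≤ ‖y‖ → ‖y‖ ≤ b → 0 < y m → |pd i f y| ≤ B := by
  obtain ⟨g, hg, hfg⟩ := exists_pd_extension hf i
  obtain ⟨B, hB⟩ := exists_bound_annulus hg ha b
  exact ⟨B, fun y h1 h2 h3 => by rw [hfg h3]; exact hB y h1 h2 h3.le⟩

lemma exists_bound_pd_pd_annulus {f : EuclideanSpace ℝ (Fin n) → ℝ}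
    (hf : ContDiffOn ℝ ∞ f (closedHalf m)) {a : ℝ} (ha : 0 < a) (b : ℝ) (i j : Fin n) :
    ∃ B, ∀ y, a ≤ ‖y‖ → ‖y‖ ≤ b → 0 < y m → |pd i (pd j f) y| ≤ B := by
  obtain ⟨g, hg, hfg⟩ := exists_pd_extension hf j
  obtain ⟨B, hB⟩ := exists_bound_pd_annulus hg ha b i
  exact ⟨B, fun y h1 h2 h3 => by rw [pd_congr isOpen_openHalf hfg h3]; exact hB y h1 h2 h3⟩

lemma norm_bounds_of_mem_dom {x y : EuclideanSpace ℝ (Fin n)} (hy : y ∈ Dom x (‖x‖ / 2) m 0) :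
    ‖x‖ / 2 ≤ ‖y‖ ∧ ‖y‖ ≤ 2 * ‖x‖ := by
  have h1 := hy.1
  have h2 : ‖x‖ - ‖y‖ ≤ ‖y - x‖ := by
    rw [norm_sub_rev]
    exact norm_sub_norm_le x y
  have h3 := norm_sub_norm_le y x
  have h4 := norm_nonneg x
  constructor <;> linarith

/-- A function smooth up to the boundary and vanishing there vanishes linearly. -/
lemma linVanish_of_smooth {f : EuclideanSpace ℝ (Fin n) → ℝ}
    (hf : ContDiffOn ℝ ∞ f (closedHalf m)) (h0 : ∀ x, x m = 0 → x ≠ 0 → f x = 0)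
    {x : EuclideanSpace ℝ (Fin n)} (hx : x ∈ openHalf m) :
    LinVanish m 0 (Dom x (‖x‖ / 2) m 0) f := by
  have hxn : 0 < ‖x‖ := norm_pos_iff.2 (ne_zero_of_mem_openHalf hx)
  obtain ⟨M, hM⟩ := exists_bound_annulus hf (show 0 < ‖x‖ / 4 by positivity) (4 * ‖x‖)
  obtain ⟨B, hB⟩ := exists_bound_pd_annulus hf (show 0 < ‖x‖ / 4 by positivity) (4 * ‖x‖) m
  refine ⟨max B (M / (‖x‖ / 4)), fun y hy => ?_⟩
  obtain ⟨hy1, hy2⟩ := norm_bounds_of_mem_dom hy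
  have hym : 0 < y m := hy.2
  rw [sub_zero]
  rcases le_or_gt (‖x‖ / 4) (y m) with h | h
  · have h1 := hM y (by linarith) (by linarith) hym.le
    have h2 : 0 ≤ M := (abs_nonneg _).trans h1
    have h3 : M / (‖x‖ / 4) * (‖x‖ / 4) ≤ M / (‖x‖ / 4) * y m :=
      mul_le_mul_of_nonneg_left h (by positivity)
    rw [div_mul_cancel₀ _ (by positivity)] at h3
    exact h1.trans (h3.trans (mul_le_mul_of_nonneg_right (le_max_right _ _) hym.le))
  · set z := y + (-(y m)) • EuclideanSpace.single m (1 : ℝ) with hz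
    have hzm : ∀ t : ℝ, (z + t • EuclideanSpace.single m (1 : ℝ)) m = t := fun t => by
      rw [hz, add_smul_single_apply, add_smul_single_apply, if_pos rfl, if_pos rfl]
      ring
    have hzt : ∀ t : ℝ, z + t • EuclideanSpace.single m (1 : ℝ)
        = y + (t - y m) • EuclideanSpace.single m (1 : ℝ) := fun t => by
      rw [hz, add_assoc, ← add_smul]
      congr 2
      ring
    have hzn : ∀ t ∈ Set.Icc 0 (y m), ‖x‖ / 4 ≤ ‖z + t • EuclideanSpace.single m (1 : ℝ)‖ ∧
        ‖z + t • EuclideanSpace.single m (1 : ℝ)‖ ≤ 4 * ‖x‖ := by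
      intro t ht
      rw [hzt]
      have h1 := norm_add_le y ((t - y m) • EuclideanSpace.single m (1 : ℝ))
      have h2 := norm_sub_le_norm_add y ((t - y m) • EuclideanSpace.single m (1 : ℝ))
      rw [norm_smul_single, abs_of_nonpos (by linarith [ht.2])] at h1 h2
      constructor <;> linarith [ht.1]
    have hmem : ∀ t ∈ Set.Icc 0 (y m),
        z + t • EuclideanSpace.single m (1 : ℝ) ∈ closedHalf m := fun t ht =>
      ⟨by rw [Set.mem_ofPred_eq, hzm]; exact ht.1, fun e => by
        have := (hzn t ht).1
        rw [Set.mem_singleton_iff.1 e, norm_zero] at this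
        linarith⟩
    have hmem' : ∀ t ∈ Set.Ioo 0 (y m),
        z + t • EuclideanSpace.single m (1 : ℝ) ∈ openHalf m := fun t ht => by
      rw [openHalf, Set.mem_ofPred_eq, hzm]
      exact ht.1
    obtain ⟨t, ht, he⟩ := exists_hasDerivAt_eq_slope
      (fun t : ℝ => f (z + t • EuclideanSpace.single m (1 : ℝ)))
      (fun t => pd m f (z + t • EuclideanSpace.single m (1 : ℝ))) hym
      (hf.continuousOn.comp (by fun_prop) hmem)
      (fun t ht => hasDerivAt_line isOpen_openHalf (hf.mono openHalf_subset) m t (hmem' t ht))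
    have hz0 := hmem 0 (Set.left_mem_Icc.2 hym.le)
    have e1 : f (z + (0 : ℝ) • EuclideanSpace.single m (1 : ℝ)) = 0 := h0 _ (hzm 0) hz0.2
    have e2 : z + (y m) • EuclideanSpace.single m (1 : ℝ) = y := by
      rw [hzt, sub_self, zero_smul, add_zero]
    beta_reduce at he
    rw [e1, e2, sub_zero, sub_zero, eq_div_iff hym.ne'] at he
    rw [← he, abs_mul, abs_of_pos hym]
    refine mul_le_mul_of_nonneg_right (le_trans ?_ (le_max_left _ _)) hym.le
    obtain ⟨h3, h4⟩ := hzn t ⟨ht.1.le, ht.2.le⟩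
    exact hB _ h3 h4 (hmem' t ht)

variable {v : Fin n → EuclideanSpace ℝ (Fin n) → ℝ} {q : EuclideanSpace ℝ (Fin n) → ℝ}

lemma second_deriv_decay (hn : 2 ≤ n) (h : IsSol 1 v q (openHalf m))
    (hv : ∀ k, ContDiffOn ℝ ∞ (v k) (closedHalf m))
    (h0 : ∀ k x, x m = 0 → x ≠ 0 → v k x = 0) {C : ℝ} (hC : 0 < C)
    (hb : ∀ x ∈ openHalf m, ∀ k, |v k x| ≤ C / ‖x‖) :
    ∃ K > 0, ∀ x ∈ openHalf m, ∀ i j k, |pd i (pd j (v k)) x| ≤ K / ‖x‖ ^ 3 := by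
  obtain ⟨μ, hμ, H⟩ := second_deriv_le hn
  refine ⟨4 * (2 * C / μ + 2 * (C / μ) ^ 3), by positivity, fun x hx i j k => ?_⟩
  have hxn : 0 < ‖x‖ := norm_pos_iff.2 (ne_zero_of_mem_openHalf hx)
  have hsub : Dom x (‖x‖ / 2) m 0 ⊆ openHalf m := fun y hy => hy.2
  choose B hB using fun i j k =>
    exists_bound_pd_pd_annulus (hv k) (show 0 < ‖x‖ / 2 by positivity) (2 * ‖x‖) i j
  have hB' : ∀ y ∈ Dom x (‖x‖ / 2) m 0, ∀ i j k,
      |pd i (pd j (v k)) y| ≤ ∑ i, ∑ j, ∑ k, |B i j k| := by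
    intro y hy i j k
    obtain ⟨h1, h2⟩ := norm_bounds_of_mem_dom hy
    refine (hB i j k y h1 h2 hy.2).trans ((le_abs_self _).trans ?_)
    refine le_trans ?_ (Finset.single_le_sum (f := fun i => ∑ j, ∑ k, |B i j k|)
      (fun _ _ => by positivity) (Finset.mem_univ i))
    refine le_trans ?_ (Finset.single_le_sum (f := fun j => ∑ k, |B i j k|)
      (fun _ _ => by positivity) (Finset.mem_univ j))
    exact Finset.single_le_sum (f := fun k => |B i j k|) (fun _ _ => abs_nonneg _)
      (Finset.mem_univ k)
  have key := H x m v q (2 * C / ‖x‖) (‖x‖ / 2) _ hx (by positivity) (by positivity) (h.mono hsub)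
    (fun y hy k => (hb y (hsub hy) k).trans ?_) hB'
    (fun k => linVanish_of_smooth (hv k) (h0 k) hx) i j k
  · rw [le_div_iff₀ (by positivity)]
    have e : (2 * C / ‖x‖ / μ + (‖x‖ / 2) ^ 2 * (2 * C / ‖x‖ / μ) ^ 3) * (4 * ‖x‖)
        = 4 * (2 * C / μ + 2 * (C / μ) ^ 3) := by
      field_simp
    rw [← e]
    have := mul_le_mul_of_nonneg_right key (show 0 ≤ 4 * ‖x‖ by positivity)
    linarith
  · rw [div_le_div_iff₀ (by linarith [norm_bounds_of_mem_dom hy]) hxn]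
    have := (norm_bounds_of_mem_dom hy).1
    nlinarith

lemma add_smul_mem_openHalf {x : EuclideanSpace ℝ (Fin n)} (hx : x ∈ openHalf m) {t : ℝ}
    (ht : 0 ≤ t) (i : Fin n) : x + t • EuclideanSpace.single i (1 : ℝ) ∈ openHalf m := by
  rw [openHalf, Set.mem_ofPred_eq, add_smul_single_apply]
  have : 0 < x m := hx
  split_ifs <;> linarith

/-- Interpolation between the decay of a function and of its second derivatives. -/
lemma first_deriv_decay {f : EuclideanSpace ℝ (Fin n) → ℝ} (hf : ContDiffOn ℝ ∞ f (openHalf m))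
    {C K : ℝ} (hb : ∀ x ∈ openHalf m, |f x| ≤ C / ‖x‖) {i : Fin n}
    (hH : ∀ x ∈ openHalf m, |pd i (pd i f) x| ≤ K / ‖x‖ ^ 3)
    {x : EuclideanSpace ℝ (Fin n)} (hx : x ∈ openHalf m) :
    |pd i f x| ≤ (12 * C + 4 * K) / ‖x‖ ^ 2 := by
  have hxn : 0 < ‖x‖ := norm_pos_iff.2 (ne_zero_of_mem_openHalf hx)
  have hC : 0 ≤ C := by
    have := (abs_nonneg _).trans (hb x hx)
    rwa [le_div_iff₀ hxn, zero_mul] at this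
  have hK : 0 ≤ K := by
    have := (abs_nonneg _).trans (hH x hx)
    rwa [le_div_iff₀ (by positivity), zero_mul] at this
  have hseg : ∀ t ∈ Set.Icc 0 (‖x‖ / 4), x + t • EuclideanSpace.single i (1 : ℝ) ∈ openHalf m :=
    fun t ht => add_smul_mem_openHalf hx ht.1 i
  have hnorm : ∀ t ∈ Set.Icc 0 (‖x‖ / 4), ‖x‖ / 2 ≤ ‖x + t • EuclideanSpace.single i (1 : ℝ)‖ := by
    intro t ht
    have h2 := norm_sub_le_norm_add x (t • EuclideanSpace.single i (1 : ℝ))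
    rw [norm_smul_single, abs_of_nonneg ht.1] at h2
    linarith [ht.2]
  have key := abs_shift_sub_linear_le (A := K / (‖x‖ / 2) ^ 3) isOpen_openHalf hf
    (by positivity) hseg (fun t ht => (hH _ (hseg t ht)).trans (by
      gcongr
      exact hnorm t ht))
  have hr := Set.right_mem_Icc.2 (show 0 ≤ ‖x‖ / 4 by positivity)
  have b1 := hb x hx
  have b2 : |f (x + (‖x‖ / 4) • EuclideanSpace.single i (1 : ℝ))| ≤ C / (‖x‖ / 2) :=
    (hb _ (hseg _ hr)).trans (by
      gcongr
      exact hnorm _ hr)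
  have b3 : |‖x‖ / 4 * pd i f x|
      ≤ C / (‖x‖ / 2) + C / ‖x‖ + K / (‖x‖ / 2) ^ 3 * (‖x‖ / 4) * (‖x‖ / 4) := by
    rw [abs_le] at *
    constructor <;> linarith [b1.1, b1.2, b2.1, b2.2, key.1, key.2]
  rw [abs_mul, abs_of_pos (by positivity)] at b3
  have e : C / (‖x‖ / 2) + C / ‖x‖ + K / (‖x‖ / 2) ^ 3 * (‖x‖ / 4) * (‖x‖ / 4)
      = ‖x‖ / 4 * ((12 * C + 2 * K) / ‖x‖ ^ 2) := by
    field_simp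
    ring
  rw [e] at b3
  refine (le_of_mul_le_mul_left b3 (by positivity)).trans ?_
  gcongr
  norm_num

lemma pressure_gradient_decay (h : IsSol 1 v q (openHalf m)) {C K L : ℝ}
    (hb : ∀ x ∈ openHalf m, ∀ k, |v k x| ≤ C / ‖x‖)
    (hL : ∀ x ∈ openHalf m, ∀ i k, |pd i (v k) x| ≤ L / ‖x‖ ^ 2)
    (hK : ∀ x ∈ openHalf m, ∀ i j k, |pd i (pd j (v k)) x| ≤ K / ‖x‖ ^ 3)
    {x : EuclideanSpace ℝ (Fin n)} (hx : x ∈ openHalf m) :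
    ‖fderiv ℝ q x‖ ≤ (n * (n * K + n * (C * L))) / ‖x‖ ^ 3 := by
  have hxn : 0 < ‖x‖ := norm_pos_iff.2 (ne_zero_of_mem_openHalf hx)
  have hj : ∀ j, |pd j q x| ≤ (n * K + n * (C * L)) / ‖x‖ ^ 3 := by
    intro j
    have e : pd j q x = lap (v j) x - ∑ i, v i x * pd i (v j) x := by
      have := h.eq x hx j
      rw [conv, one_mul] at this
      rw [this]
      ring
    have b1 : |lap (v j) x| ≤ n * (K / ‖x‖ ^ 3) := abs_sum_le_card_mul fun i => hK x hx i i j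
    have b2 : |∑ i, v i x * pd i (v j) x| ≤ n * (C / ‖x‖ * (L / ‖x‖ ^ 2)) :=
      abs_sum_le_card_mul fun i => by
        rw [abs_mul]
        exact mul_le_mul (hb x hx i) (hL x hx i j) (abs_nonneg _)
          ((abs_nonneg _).trans (hb x hx i))
    rw [e]
    refine (abs_sub _ _).trans ((add_le_add b1 b2).trans (le_of_eq ?_))
    field_simp
  refine (norm_fderiv_le_sum_pd q x).trans ((Finset.sum_le_sum fun j _ => hj j).trans
    (le_of_eq ?_))
  rw [Finset.sum_const, Finset.card_univ, Fintype.card_fin, nsmul_eq_mul]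
  ring

/-- A function on the half space with cubically decaying gradient has a limit at infinity,
approached quadratically. -/
lemma exists_limit_of_gradient_decay {f : EuclideanSpace ℝ (Fin n) → ℝ}
    (hf : ContDiffOn ℝ ∞ f (openHalf m)) {G : ℝ}
    (hG : ∀ x ∈ openHalf m, ‖fderiv ℝ f x‖ ≤ G / ‖x‖ ^ 3) :
    ∃ c, ∀ x ∈ openHalf m, |f x - c| ≤ 2 * G / ‖x‖ ^ 2 := by
  have hscale : ∀ x ∈ openHalf m, ∀ t : ℝ, 0 < t → t • x ∈ openHalf m := fun x hx t ht =>
    mul_pos ht hx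
  have hdiff : ∀ x ∈ openHalf m, DifferentiableAt ℝ f x := fun x hx =>
    differentiableAt_of_smooth isOpen_openHalf hf hx
  have he : EuclideanSpace.single m (1 : ℝ) ∈ openHalf m := by simp [openHalf]
  have hG0 : 0 ≤ G := by simpa using (norm_nonneg _).trans (hG _ he)
  have hdouble : ∀ x ∈ openHalf m, |f ((2 : ℝ) • x) - f x| ≤ G / ‖x‖ ^ 2 := by
    intro x hx
    have hxn : 0 < ‖x‖ := norm_pos_iff.2 (ne_zero_of_mem_openHalf hx)
    have hsub : ∀ y ∈ segment ℝ x ((2 : ℝ) • x), ∃ t : ℝ, 1 ≤ t ∧ y = t • x := by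
      rintro y ⟨a, b, ha, hb, hab, rfl⟩
      refine ⟨a + b * 2, by linarith, ?_⟩
      rw [smul_smul, ← add_smul]
    have := Convex.norm_image_sub_le_of_norm_fderiv_le (𝕜 := ℝ) (f := f) (C := G / ‖x‖ ^ 3)
      (fun y hy => by
        obtain ⟨t, ht, rfl⟩ := hsub y hy
        exact hdiff _ (hscale x hx t (by linarith)))
      (fun y hy => by
        obtain ⟨t, ht, rfl⟩ := hsub y hy
        refine (hG _ (hscale x hx t (by linarith))).trans ?_
        gcongr
        rw [norm_smul, Real.norm_eq_abs, abs_of_pos (by linarith)]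
        nlinarith)
      (convex_segment x ((2 : ℝ) • x)) (left_mem_segment ℝ _ _) (right_mem_segment ℝ _ _)
    rw [two_smul, add_sub_cancel_left] at this
    rw [two_smul]
    refine this.trans (le_of_eq ?_)
    field_simp
  have hgeom : ∀ x ∈ openHalf m, ∀ k : ℕ,
      dist (f ((2 : ℝ) ^ k • x)) (f ((2 : ℝ) ^ (k + 1) • x)) ≤ G / ‖x‖ ^ 2 * (1 / 4) ^ k := by
    intro x hx k
    have hxn : 0 < ‖x‖ := norm_pos_iff.2 (ne_zero_of_mem_openHalf hx)
    have := hdouble _ (hscale x hx ((2 : ℝ) ^ k) (by positivity))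
    rw [smul_smul, ← pow_succ', norm_smul, Real.norm_eq_abs,
      abs_of_pos (pow_pos (by norm_num : (0 : ℝ) < 2) k)] at this
    rw [dist_comm, Real.dist_eq]
    refine this.trans (le_of_eq ?_)
    rw [mul_pow, ← pow_mul, mul_comm k 2, pow_mul, one_div, inv_pow]
    norm_num
    field_simp
  have hlim : ∀ x ∈ openHalf m, ∃ c, Filter.Tendsto (fun k : ℕ => f ((2 : ℝ) ^ k • x))
      Filter.atTop (𝓝 c) := fun x hx =>
    cauchySeq_tendsto_of_complete (cauchySeq_of_le_geometric (1 / 4) (G / ‖x‖ ^ 2) (by norm_num)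
      (hgeom x hx))
  obtain ⟨c, hc⟩ := hlim _ he
  refine ⟨c, fun x hx => ?_⟩
  have hxn : 0 < ‖x‖ := norm_pos_iff.2 (ne_zero_of_mem_openHalf hx)
  have hdiff0 : Filter.Tendsto (fun k : ℕ => f ((2 : ℝ) ^ k • x)
      - f ((2 : ℝ) ^ k • EuclideanSpace.single m (1 : ℝ))) Filter.atTop (𝓝 0) := by
    set δ := min (x m) 1 with hδ
    have hx0 : 0 < x m := hx
    have hδ0 : 0 < δ := by positivity
    have hbd : ∀ k : ℕ, ‖f ((2 : ℝ) ^ k • x) - f ((2 : ℝ) ^ k • EuclideanSpace.single m (1 : ℝ))‖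
        ≤ G / δ ^ 3 * ‖x - EuclideanSpace.single m (1 : ℝ)‖ * (1 / 4) ^ k := by
      intro k
      have hpt : ∀ y ∈ {y : EuclideanSpace ℝ (Fin n) | 2 ^ k * δ ≤ y m}, y ∈ openHalf m ∧
          2 ^ k * δ ≤ ‖y‖ := fun y hy =>
        ⟨lt_of_lt_of_le (show (0 : ℝ) < 2 ^ k * δ by positivity) hy,
          le_trans hy ((le_abs_self _).trans (by simpa using PiLp.norm_apply_le y m))⟩
      have := Convex.norm_image_sub_le_of_norm_fderiv_le (𝕜 := ℝ) (f := f)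
        (C := G / (2 ^ k * δ) ^ 3) (s := {y : EuclideanSpace ℝ (Fin n) | 2 ^ k * δ ≤ y m})
        (x := (2 : ℝ) ^ k • EuclideanSpace.single m (1 : ℝ)) (y := (2 : ℝ) ^ k • x)
        (fun y hy => hdiff y (hpt y hy).1)
        (fun y hy => (hG y (hpt y hy).1).trans (by
          gcongr
          exact (hpt y hy).2))
        (convex_halfSpace_ge (EuclideanSpace.proj (𝕜 := ℝ) m).toLinearMap.isLinear _)
        (by
          simp only [Set.mem_ofPred_eq, PiLp.smul_apply, smul_eq_mul]
          gcongr
          simp [hδ])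
        (by
          simp only [Set.mem_ofPred_eq, PiLp.smul_apply, smul_eq_mul]
          gcongr
          exact min_le_left _ _)
      refine this.trans (le_of_eq ?_)
      rw [← smul_sub, norm_smul, Real.norm_eq_abs, abs_of_pos (by positivity),
        show (1 / 4 : ℝ) = (1 / 2) ^ 2 by norm_num, ← pow_mul, mul_comm 2 k, pow_mul, one_div,
        inv_pow]
      field_simp
    refine squeeze_zero_norm hbd ?_
    simpa using (tendsto_pow_atTop_nhds_zero_of_lt_one (r := (1 / 4 : ℝ)) (by norm_num)
      (by norm_num)).const_mul (G / δ ^ 3 * ‖x - EuclideanSpace.single m (1 : ℝ)‖)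
  have hcx : Filter.Tendsto (fun k : ℕ => f ((2 : ℝ) ^ k • x)) Filter.atTop (𝓝 c) := by
    simpa using hdiff0.add hc
  have := dist_le_of_le_geometric_of_tendsto₀ (1 / 4) (G / ‖x‖ ^ 2) (by norm_num)
    (hgeom x hx) hcx
  rw [pow_zero, one_smul, Real.dist_eq] at this
  refine this.trans ?_
  rw [div_le_iff₀ (by norm_num), mul_div_assoc]
  have : 0 ≤ G / ‖x‖ ^ 2 := by positivity
  linarith

end HalfSpace

/-- The norm of a derivative is controlled by the derivatives of the components. -/
lemma norm_fderiv_le_sum_components {n : ℕ}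
    {u : EuclideanSpace ℝ (Fin n) → EuclideanSpace ℝ (Fin n)} {x : EuclideanSpace ℝ (Fin n)}
    (hu : DifferentiableAt ℝ u x) :
    ‖fderiv ℝ u x‖ ≤ ∑ k, ‖fderiv ℝ (fun y => u y k) x‖ := by
  refine ContinuousLinearMap.opNorm_le_bound _ (Finset.sum_nonneg fun _ _ => norm_nonneg _)
    fun h => ?_
  have hk : ∀ k, fderiv ℝ (fun y => u y k) x h = (fderiv ℝ u x h) k := fun k => by
    have := ((EuclideanSpace.proj (𝕜 := ℝ) k).hasFDerivAt.comp x hu.hasFDerivAt).fderiv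
    exact congrArg (fun L => L h) this
  have hsum : fderiv ℝ u x h = ∑ k, (fderiv ℝ u x h) k • EuclideanSpace.single k (1 : ℝ) := by
    ext j
    simp [Pi.single_apply]
  rw [hsum, Finset.sum_mul]
  refine (norm_sum_le _ _).trans (Finset.sum_le_sum fun k _ => ?_)
  rw [norm_smul_single, ← hk, ← Real.norm_eq_abs]
  exact ContinuousLinearMap.le_opNorm _ _

end HalfSpaceNS

open HalfSpaceNS in
/-- **Gradient and pressure estimates in the half space ℝⁿ₊ \ {0}, n ≥ 4, with
Dirichlet boundary conditions.**  If `(u, p)` is a smooth solution of the steady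
Navier-Stokes equations on `Ω = ℝⁿ₊ \ {0}` with `|u(x)| ≤ C/|x|`, extending smoothly
up to the boundary `∂ℝⁿ₊ \ {0}` with `u = 0` there, then after subtracting a suitable
constant from `p` one has `|∇u(x)| + |p(x)| ≤ C'/|x|²` on `Ω`. -/
theorem steady_NS_half_space_gradient_pressure_estimate {n : ℕ} (hn : 4 ≤ n)
    (last : Fin n) (hlast : (last : ℕ) = n - 1)
    (u : EuclideanSpace ℝ (Fin n) → EuclideanSpace ℝ (Fin n))
    (p : EuclideanSpace ℝ (Fin n) → ℝ)
    -- `u` and `p` are smooth up to the boundary (away from the origin)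
    (hu : ContDiffOn ℝ (⊤ : ℕ∞) u ({x : EuclideanSpace ℝ (Fin n) | 0 ≤ x last} \ {0}))
    (hp : ContDiffOn ℝ (⊤ : ℕ∞) p ({x : EuclideanSpace ℝ (Fin n) | 0 ≤ x last} \ {0}))
    -- steady Navier-Stokes equations on Ω = ℝⁿ₊ \ {0}
    (hNS : ∀ x : EuclideanSpace ℝ (Fin n), 0 < x last → x ≠ 0 → ∀ j : Fin n,
      -(∑ i : Fin n, fderiv ℝ (fun y => fderiv ℝ (fun z => u z j) y
            (EuclideanSpace.single i 1)) x (EuclideanSpace.single i 1)) +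
        (∑ i : Fin n, u x i * fderiv ℝ (fun z => u z j) x (EuclideanSpace.single i 1)) +
        fderiv ℝ p x (EuclideanSpace.single j 1) = 0)
    (hdiv : ∀ x : EuclideanSpace ℝ (Fin n), 0 < x last → x ≠ 0 →
      ∑ i : Fin n, fderiv ℝ (fun z => u z i) x (EuclideanSpace.single i 1) = 0)
    -- Dirichlet boundary condition on ∂ℝⁿ₊ \ {0}
    (hDir : ∀ x : EuclideanSpace ℝ (Fin n), x last = 0 → x ≠ 0 → u x = 0)
    (C : ℝ) (hC : 0 < C)
    (hbound : ∀ x : EuclideanSpace ℝ (Fin n), 0 < x last → x ≠ 0 → ‖u x‖ ≤ C / ‖x‖) :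
    ∃ c C' : ℝ, 0 < C' ∧
      ∀ x : EuclideanSpace ℝ (Fin n), 0 < x last → x ≠ 0 →
        ‖fderiv ℝ u x‖ + |p x - c| ≤ C' / ‖x‖ ^ 2 := by
  have hv : ∀ k, ContDiffOn ℝ (⊤ : ℕ∞) (fun y => u y k) (closedHalf last) := fun k =>
    (EuclideanSpace.proj (𝕜 := ℝ) k).contDiff.comp_contDiffOn hu
  have h : IsSol 1 (fun k y => u y k) p (openHalf last) := by
    refine ⟨fun k => (hv k).mono openHalf_subset, hp.mono openHalf_subset, fun x hx j => ?_,
      fun x hx => hdiv x hx (ne_zero_of_mem_openHalf hx)⟩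
    have e := hNS x hx (ne_zero_of_mem_openHalf hx) j
    rw [conv, one_mul]
    change ∑ i, fderiv ℝ (fun y => fderiv ℝ (fun z => u z j) y (EuclideanSpace.single i 1)) x
        (EuclideanSpace.single i 1)
      = ∑ i, u x i * fderiv ℝ (fun z => u z j) x (EuclideanSpace.single i 1)
        + fderiv ℝ p x (EuclideanSpace.single j 1)
    linarith
  have hb : ∀ x ∈ openHalf last, ∀ k, |u x k| ≤ C / ‖x‖ := fun x hx k =>
    (PiLp.norm_apply_le (u x) k).trans (hbound x hx (ne_zero_of_mem_openHalf hx))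
  obtain ⟨K, hK, hH⟩ := second_deriv_decay (by omega) h hv
    (fun k x h1 h2 => by rw [hDir x h1 h2]; rfl) hC hb
  have hL : ∀ x ∈ openHalf last, ∀ i k, |pd i (fun y => u y k) x| ≤ (12 * C + 4 * K) / ‖x‖ ^ 2 :=
    fun x hx i k => first_deriv_decay (h.smooth_v k) (fun y hy => hb y hy k)
      (fun y hy => hH y hy i i k) hx
  set L := 12 * C + 4 * K with hLdef
  have hL0 : 0 < L := by positivity
  obtain ⟨c, hc⟩ := exists_limit_of_gradient_decay h.smooth_q
    fun x hx => pressure_gradient_decay h hb hL hH hx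
  refine ⟨c, n * (n * L) + 2 * (n * (n * K + n * (C * L))) , ?_, fun x hx hx0 => ?_⟩
  · have : (0 : ℝ) < n := by exact_mod_cast (by omega : 0 < n)
    positivity
  · rw [add_div]
    refine add_le_add ?_ (hc x hx)
    refine (norm_fderiv_le_sum_components ((hu.mono openHalf_subset).contDiffAt
      (isOpen_openHalf.mem_nhds hx) |>.differentiableAt (by simp))).trans ?_
    have hk : ∀ k, ‖fderiv ℝ (fun y => u y k) x‖ ≤ n * (L / ‖x‖ ^ 2) := fun k => by
      refine (norm_fderiv_le_sum_pd _ x).trans ((Finset.sum_le_sum fun i _ => hL x hx i k).trans ?_)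
      simp
    refine (Finset.sum_le_sum fun k _ => hk k).trans (le_of_eq ?_)
    rw [Finset.sum_const, Finset.card_univ, Fintype.card_fin, nsmul_eq_mul]
    ring
end

section
/- Let (u, p) be a smooth solution of the steady Navier-Stokes equations on an open set Ω ⊆ ℝⁿ. Then the total head pressure H = |u|²/2 + p satisfies the equation −ΔH + u·∇H = −2|ω|² pointwise on Ω, where ω is the antisymmetric part of ∇u, i.e. ω_{ij} = ½(∂_i u_j − ∂_j u_i), and |ω|² = ∑_{i,j} ω_{ij}². -/
section DirectionalDerivative

variable {E : Type*} [NormedAddCommGroup E] [NormedSpace ℝ E]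

/-- The derivative of `f` in the direction `v`, as a function of the base point. -/
noncomputable def dirDeriv (v : E) (f : E → ℝ) : E → ℝ := fun x => fderiv ℝ f x v

variable {Ω : Set E} {f g : E → ℝ} {x : E}

theorem ContDiffOn.dirDeriv (hΩ : IsOpen Ω) (hf : ContDiffOn ℝ (⊤ : ℕ∞) f Ω) (v : E) :
    ContDiffOn ℝ (⊤ : ℕ∞) (dirDeriv v f) Ω :=
  (hf.fderiv_of_isOpen hΩ (m := (⊤ : ℕ∞)) (by simp)).clm_apply contDiffOn_const

theorem ContDiffOn.differentiableAt_of_isOpen (hΩ : IsOpen Ω)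
    (hf : ContDiffOn ℝ (⊤ : ℕ∞) f Ω) (hx : x ∈ Ω) : DifferentiableAt ℝ f x :=
  (hf.contDiffAt (hΩ.mem_nhds hx)).differentiableAt (by simp)

theorem dirDeriv_congr (hΩ : IsOpen Ω) (h : Set.EqOn f g Ω) (hx : x ∈ Ω) (v : E) :
    dirDeriv v f x = dirDeriv v g x := by
  have : f =ᶠ[nhds x] g := Filter.eventuallyEq_of_mem (hΩ.mem_nhds hx) h
  simp only [dirDeriv, this.fderiv_eq]

theorem dirDeriv_add (hf : DifferentiableAt ℝ f x) (hg : DifferentiableAt ℝ g x) (v : E) :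
    dirDeriv v (fun y => f y + g y) x = dirDeriv v f x + dirDeriv v g x := by
  simp [dirDeriv, fderiv_fun_add hf hg]

theorem dirDeriv_sub (hf : DifferentiableAt ℝ f x) (hg : DifferentiableAt ℝ g x) (v : E) :
    dirDeriv v (fun y => f y - g y) x = dirDeriv v f x - dirDeriv v g x := by
  simp [dirDeriv, fderiv_fun_sub hf hg]

theorem dirDeriv_mul (hf : DifferentiableAt ℝ f x) (hg : DifferentiableAt ℝ g x) (v : E) :
    dirDeriv v (fun y => f y * g y) x = dirDeriv v f x * g x + f x * dirDeriv v g x := by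
  simp only [dirDeriv, fderiv_fun_mul hf hg, add_apply, smul_apply, smul_eq_mul]
  ring

theorem dirDeriv_sum {ι : Type*} {s : Finset ι} {F : ι → E → ℝ}
    (hF : ∀ i ∈ s, DifferentiableAt ℝ (F i) x) (v : E) :
    dirDeriv v (fun y => ∑ i ∈ s, F i y) x = ∑ i ∈ s, dirDeriv v (F i) x := by
  simp [dirDeriv, fderiv_fun_sum hF]

theorem dirDeriv_comm (hΩ : IsOpen Ω) (hf : ContDiffOn ℝ (⊤ : ℕ∞) f Ω) (hx : x ∈ Ω) (v w : E) :
    dirDeriv v (dirDeriv w f) x = dirDeriv w (dirDeriv v f) x := by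
  have hfx := hf.contDiffAt (hΩ.mem_nhds hx)
  have hd : DifferentiableAt ℝ (fderiv ℝ f) x :=
    (hfx.fderiv_right (m := 1) (by norm_cast)).differentiableAt (by simp)
  have key : ∀ a b : E, dirDeriv a (dirDeriv b f) x = fderiv ℝ (fderiv ℝ f) x a b := by
    intro a b
    change fderiv ℝ (fun y => fderiv ℝ f y b) x a = _
    rw [fderiv_clm_apply hd (differentiableAt_const b)]
    simp
  rw [key, key]
  exact hfx.isSymmSndFDerivAt (by simp [minSmoothness_of_isRCLikeNormedField]; norm_cast) v w

end DirectionalDerivative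

section NavierStokes

variable {E ι : Type*} [NormedAddCommGroup E] [NormedSpace ℝ E] [Fintype ι]
  {Ω : Set E} {e : ι → E} {U : ι → E → ℝ} {p : E → ℝ} {x : E}

/-- The pressure equation `Δp = -∑ᵢⱼ ∂ⱼuᵢ ∂ᵢuⱼ` of a steady Navier-Stokes flow. -/
theorem sum_dirDeriv_dirDeriv_pressure (hΩ : IsOpen Ω)
    (hU : ∀ j, ContDiffOn ℝ (⊤ : ℕ∞) (U j) Ω)
    (hNS : ∀ x ∈ Ω, ∀ j, -(∑ i, dirDeriv (e i) (dirDeriv (e i) (U j)) x) +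
      (∑ i, U i x * dirDeriv (e i) (U j) x) + dirDeriv (e j) p x = 0)
    (hdiv : ∀ x ∈ Ω, ∑ i, dirDeriv (e i) (U i) x = 0) (hx : x ∈ Ω) :
    ∑ j, dirDeriv (e j) (dirDeriv (e j) p) x =
      -∑ j, ∑ i, dirDeriv (e j) (U i) x * dirDeriv (e i) (U j) x := by
  have hd : ∀ {f : E → ℝ}, ContDiffOn ℝ (⊤ : ℕ∞) f Ω → ∀ {y}, y ∈ Ω → DifferentiableAt ℝ f y :=
    fun hf _ hy => hf.differentiableAt_of_isOpen hΩ hy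
  have hU1 := fun i j => (hU j).dirDeriv hΩ (e i)
  have hU2 := fun i j => (hU1 i j).dirDeriv hΩ (e i)
  have hdiv1 : ∀ y ∈ Ω, ∀ v, ∑ j, dirDeriv v (dirDeriv (e j) (U j)) y = 0 := by
    intro y hy v
    rw [← dirDeriv_sum fun j _ => hd (hU1 j j) hy,
      dirDeriv_congr (g := fun _ => 0) hΩ hdiv hy v]
    simp [dirDeriv]
  have hdiv2 : ∀ i, ∑ j, dirDeriv (e j) (dirDeriv (e i) (dirDeriv (e i) (U j))) x = 0 := by
    intro i
    calc _ = ∑ j, dirDeriv (e i) (dirDeriv (e i) (dirDeriv (e j) (U j))) x := by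
          refine Finset.sum_congr rfl fun j _ => ?_
          rw [dirDeriv_comm hΩ (hU1 i j) hx]
          exact dirDeriv_congr hΩ (fun y hy => dirDeriv_comm hΩ (hU j) hy _ _) hx _
      _ = dirDeriv (e i) (fun y => ∑ j, dirDeriv (e i) (dirDeriv (e j) (U j)) y) x :=
          (dirDeriv_sum (fun j _ => hd ((hU1 j j).dirDeriv hΩ (e i)) hx) _).symm
      _ = 0 := by
          rw [dirDeriv_congr (g := fun _ => 0) hΩ (fun y hy => hdiv1 y hy (e i)) hx]
          simp [dirDeriv]
  have hpp : ∀ j, dirDeriv (e j) (dirDeriv (e j) p) x =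
      ∑ i, dirDeriv (e j) (dirDeriv (e i) (dirDeriv (e i) (U j))) x -
      ∑ i, (dirDeriv (e j) (U i) x * dirDeriv (e i) (U j) x +
        U i x * dirDeriv (e i) (dirDeriv (e j) (U j)) x) := by
    intro j
    rw [dirDeriv_congr (g := fun y => ∑ i, dirDeriv (e i) (dirDeriv (e i) (U j)) y -
      ∑ i, U i y * dirDeriv (e i) (U j) y) hΩ (fun y hy => by linarith [hNS y hy j]) hx,
      dirDeriv_sub (.fun_sum fun i _ => hd (hU2 i j) hx)
        (.fun_sum fun i _ => (hd (hU i) hx).fun_mul (hd (hU1 i j) hx)),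
      dirDeriv_sum fun i _ => hd (hU2 i j) hx,
      dirDeriv_sum fun i _ => (hd (hU i) hx).fun_mul (hd (hU1 i j) hx)]
    congr 1
    refine Finset.sum_congr rfl fun i _ => ?_
    rw [dirDeriv_mul (hd (hU i) hx) (hd (hU1 i j) hx), dirDeriv_comm hΩ (hU j) hx]
  have hconv : ∑ j, ∑ i, U i x * dirDeriv (e i) (dirDeriv (e j) (U j)) x = 0 := by
    rw [Finset.sum_comm]
    simp_rw [← Finset.mul_sum, hdiv1 x hx, mul_zero, Finset.sum_const_zero]
  have hvisc : ∑ j, ∑ i, dirDeriv (e j) (dirDeriv (e i) (dirDeriv (e i) (U j))) x = 0 := by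
    rw [Finset.sum_comm]
    simp_rw [hdiv2, Finset.sum_const_zero]
  simp_rw [hpp, Finset.sum_sub_distrib, Finset.sum_add_distrib, hconv, hvisc]
  ring

theorem dirDeriv_kinetic_add (hU : ∀ j, DifferentiableAt ℝ (U j) x)
    (hp : DifferentiableAt ℝ p x) (v : E) :
    dirDeriv v (fun y => ∑ j, U j y * U j y / 2 + p y) x =
      ∑ j, U j x * dirDeriv v (U j) x + dirDeriv v p x := by
  have hsq : ∀ j, DifferentiableAt ℝ (fun y => U j y * U j y / 2) x :=
    fun j => by
      simpa only [div_eq_mul_inv] using ((hU j).fun_mul (hU j)).mul_const (2⁻¹ : ℝ)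
  rw [dirDeriv_add (.fun_sum fun j _ => hsq j) hp, dirDeriv_sum fun j _ => hsq j]
  congr 1
  refine Finset.sum_congr rfl fun j _ => ?_
  simp only [div_eq_mul_inv]
  rw [dirDeriv_mul ((hU j).fun_mul (hU j)) (differentiableAt_const _),
    dirDeriv_mul (hU j) (hU j)]
  simp only [dirDeriv, fderiv_fun_const, Pi.zero_apply, zero_apply]
  ring

theorem dirDeriv_dirDeriv_kinetic_add (hΩ : IsOpen Ω)
    (hU : ∀ j, ContDiffOn ℝ (⊤ : ℕ∞) (U j) Ω) (hp : ContDiffOn ℝ (⊤ : ℕ∞) p Ω)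
    (hx : x ∈ Ω) (v : E) :
    dirDeriv v (dirDeriv v (fun y => ∑ j, U j y * U j y / 2 + p y)) x =
      ∑ j, (dirDeriv v (U j) x ^ 2 + U j x * dirDeriv v (dirDeriv v (U j)) x) +
        dirDeriv v (dirDeriv v p) x := by
  have hd : ∀ {f : E → ℝ}, ContDiffOn ℝ (⊤ : ℕ∞) f Ω → ∀ {y}, y ∈ Ω → DifferentiableAt ℝ f y :=
    fun hf _ hy => hf.differentiableAt_of_isOpen hΩ hy
  have hU1 := fun j => (hU j).dirDeriv hΩ v
  have hmul : ∀ j, DifferentiableAt ℝ (fun y => U j y * dirDeriv v (U j) y) x :=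
    fun j => (hd (hU j) hx).fun_mul (hd (hU1 j) hx)
  rw [dirDeriv_congr hΩ
      (fun y hy => dirDeriv_kinetic_add (fun j => hd (hU j) hy) (hd hp hy) v) hx,
    dirDeriv_add (.fun_sum fun j _ => hmul j) (hd (hp.dirDeriv hΩ v) hx),
    dirDeriv_sum fun j _ => hmul j]
  congr 1
  refine Finset.sum_congr rfl fun j _ => ?_
  rw [dirDeriv_mul (hd (hU j) hx) (hd (hU1 j) hx), sq]

theorem sum_sum_antisymm_sq (a : ι → ι → ℝ) :
    -2 * ∑ i, ∑ j, ((a i j - a j i) / 2) ^ 2 =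
      ∑ i, ∑ j, a i j * a j i - ∑ i, ∑ j, a i j ^ 2 := by
  have hswap : ∑ i, ∑ j, a j i ^ 2 = ∑ i, ∑ j, a i j ^ 2 := Finset.sum_comm
  have hexp : ∀ i j, ((a i j - a j i) / 2) ^ 2 =
      4⁻¹ * a i j ^ 2 + 4⁻¹ * a j i ^ 2 - 2⁻¹ * (a i j * a j i) := fun i j => by ring
  simp_rw [hexp, Finset.sum_sub_distrib, Finset.sum_add_distrib, ← Finset.mul_sum, hswap]
  ring

/-- The total head pressure equation, for the derivatives along an arbitrary family `e` of
directions. -/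
theorem dirDeriv_total_head_pressure (hΩ : IsOpen Ω)
    (hU : ∀ j, ContDiffOn ℝ (⊤ : ℕ∞) (U j) Ω) (hp : ContDiffOn ℝ (⊤ : ℕ∞) p Ω)
    (hNS : ∀ x ∈ Ω, ∀ j, -(∑ i, dirDeriv (e i) (dirDeriv (e i) (U j)) x) +
      (∑ i, U i x * dirDeriv (e i) (U j) x) + dirDeriv (e j) p x = 0)
    (hdiv : ∀ x ∈ Ω, ∑ i, dirDeriv (e i) (U i) x = 0) (hx : x ∈ Ω) :
    -(∑ i, dirDeriv (e i) (dirDeriv (e i) (fun y => ∑ j, U j y * U j y / 2 + p y)) x) +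
        ∑ i, U i x * dirDeriv (e i) (fun y => ∑ j, U j y * U j y / 2 + p y) x =
      -2 * ∑ i, ∑ j, ((dirDeriv (e i) (U j) x - dirDeriv (e j) (U i) x) / 2) ^ 2 := by
  have hd : ∀ {f : E → ℝ}, ContDiffOn ℝ (⊤ : ℕ∞) f Ω → DifferentiableAt ℝ f x :=
    fun hf => hf.differentiableAt_of_isOpen hΩ hx
  have henergy : ∑ j, U j x * dirDeriv (e j) p x =
      ∑ i, ∑ j, U j x * dirDeriv (e i) (dirDeriv (e i) (U j)) x -
        ∑ i, ∑ j, U i x * (U j x * dirDeriv (e i) (U j) x) := by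
    rw [Finset.sum_comm,
      Finset.sum_comm (f := fun i j => U i x * (U j x * dirDeriv (e i) (U j) x)), ← Finset.sum_sub_distrib]
    refine Finset.sum_congr rfl fun j _ => ?_
    rw [show dirDeriv (e j) p x = ∑ i, dirDeriv (e i) (dirDeriv (e i) (U j)) x -
      ∑ i, U i x * dirDeriv (e i) (U j) x by linarith [hNS x hx j], mul_sub,
      Finset.mul_sum, Finset.mul_sum]
    congr 1
    exact Finset.sum_congr rfl fun i _ => mul_left_comm _ _ _
  have hpress := sum_dirDeriv_dirDeriv_pressure hΩ hU hNS hdiv hx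
  rw [sum_sum_antisymm_sq fun i j => dirDeriv (e i) (U j) x]
  simp_rw [dirDeriv_dirDeriv_kinetic_add hΩ hU hp hx,
    dirDeriv_kinetic_add (fun j => hd (hU j)) (hd hp), mul_add, Finset.sum_add_distrib,
    Finset.mul_sum, henergy, hpress]
  ring

end NavierStokes

/-- **Equation for the total head pressure.**  If `(u, p)` is a smooth solution of the
steady Navier-Stokes equations on an open set `Ω ⊆ ℝⁿ`, then the total head pressure
`H = |u|²/2 + p` satisfies `-ΔH + u·∇H = -2|ω|²` on `Ω`, where `ω` is the antisymmetric
part of `∇u`, `ω_{ij} = ½(∂ᵢuⱼ - ∂ⱼuᵢ)`. -/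
theorem total_head_pressure_equation {n : ℕ}
    (u : EuclideanSpace ℝ (Fin n) → EuclideanSpace ℝ (Fin n))
    (p : EuclideanSpace ℝ (Fin n) → ℝ)
    (Ω : Set (EuclideanSpace ℝ (Fin n))) (hΩ : IsOpen Ω)
    (hu : ContDiffOn ℝ (⊤ : ℕ∞) u Ω)
    (hp : ContDiffOn ℝ (⊤ : ℕ∞) p Ω)
    (hNS : ∀ x ∈ Ω, ∀ j : Fin n,
      -(∑ i : Fin n, fderiv ℝ (fun y => fderiv ℝ (fun z => u z j) y
            (EuclideanSpace.single i 1)) x (EuclideanSpace.single i 1)) +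
        (∑ i : Fin n, u x i * fderiv ℝ (fun z => u z j) x (EuclideanSpace.single i 1)) +
        fderiv ℝ p x (EuclideanSpace.single j 1) = 0)
    (hdiv : ∀ x ∈ Ω,
      ∑ i : Fin n, fderiv ℝ (fun z => u z i) x (EuclideanSpace.single i 1) = 0) :
    ∀ x ∈ Ω,
      -(∑ i : Fin n, fderiv ℝ (fun y => fderiv ℝ (fun z => ‖u z‖ ^ 2 / 2 + p z) y
            (EuclideanSpace.single i 1)) x (EuclideanSpace.single i 1)) +
        (∑ i : Fin n, u x i *
          fderiv ℝ (fun z => ‖u z‖ ^ 2 / 2 + p z) x (EuclideanSpace.single i 1)) =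
      -2 * ∑ i : Fin n, ∑ j : Fin n,
        ((fderiv ℝ (fun z => u z j) x (EuclideanSpace.single i 1) -
          fderiv ℝ (fun z => u z i) x (EuclideanSpace.single j 1)) / 2) ^ 2 := by
  have hsq : ∀ z, ‖u z‖ ^ 2 / 2 = ∑ j, u z j * u z j / 2 := fun z => by
    rw [EuclideanSpace.real_norm_sq_eq, Finset.sum_div]
    simp only [sq]
  intro x hx
  simp only [hsq]
  exact dirDeriv_total_head_pressure (U := fun j z => u z j)
    (e := fun i => EuclideanSpace.single i 1) hΩ (contDiffOn_euclidean.mp hu) hp hNS hdiv hx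
end
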